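/- arXiv:1906.11274 — 2 statements merged into one kernel-verified Lean document; each statement's English description precedes it below -/
import Mathlib

section
/- Let 1 < p < 5, let f : ℝ → ℝ satisfy |f(s)| ≤ C·s^((p-1)/2) for all s ≥ 0, and let V : ℝ → ℝ be a nonzero even Schwartz function with ∫_ℝ (|V(x)| + |V'(x)|)·cosh(2x) dx < ∞. Then there exist μ₀ > 0 and ε > 0 such that for every μ ∈ (0, μ₀): if u : ℝ × ℝ → ℂ is a global solution of i∂ₜu + ∂ₓₓu = μV(x)u + f(|u|²)u which is smooth, odd in x, with u(t,·) in the Schwartz class in x for each t, and satisfying sup_{t∈ℝ} (‖u(t,·)‖_{L²(ℝ)}² + ‖∂ₓu(t,·)‖_{L²(ℝ)}²) ≤ ε², then for every bounded interval I ⊂ ℝ one has lim_{t→∞} ( ‖u(t,·)‖_{L²(I)} + sup_{x∈I}|u(t,x)| ) = 0. -/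
open MeasureTheory Real Filter

/-- sup bound from the local energy -/
lemma nls_sup (A B A' B' : ℝ → ℝ) (hA : ∀ x, HasDerivAt A (A' x) x)
    (hB : ∀ x, HasDerivAt B (B' x) x) (cA : Continuous A') (cB : Continuous B')
    (A0 : A 0 = 0) (B0 : B 0 = 0) (x η : ℝ) (hx : 0 ≤ x) (hη : 0 < η) :
    A x ^ 2 + B x ^ 2 ≤ ∫ y in (0:ℝ)..x, (η * (A' y ^ 2 + B' y ^ 2)
      + (1/η) * (A y ^ 2 + B y ^ 2)) := by
  have cA0 : Continuous A := continuous_iff_continuousAt.2 fun x => (hA x).continuousAt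
  have cB0 : Continuous B := continuous_iff_continuousAt.2 fun x => (hB x).continuousAt
  have h1 : ∀ y, HasDerivAt (fun y => A y ^ 2 + B y ^ 2) (2 * A y * A' y + 2 * B y * B' y) y := by
    intro y
    have := ((hA y).pow 2).add ((hB y).pow 2)
    refine this.congr_deriv ?_
    push_cast; ring
  have h2 := intervalIntegral.integral_eq_sub_of_hasDerivAt (a := 0) (b := x)
    (fun y _ => h1 y) (Continuous.intervalIntegrable (by fun_prop) _ _)
  simp only [A0, B0] at h2
  have h3 : A x ^ 2 + B x ^ 2 = ∫ y in (0:ℝ)..x, (2 * A y * A' y + 2 * B y * B' y) := by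
    rw [h2]; ring
  rw [h3]
  apply intervalIntegral.integral_mono_on hx
    (Continuous.intervalIntegrable (by fun_prop) _ _)
    (Continuous.intervalIntegrable (by fun_prop) _ _)
  intro y _
  have e1 : ∀ p q : ℝ, 2 * p * q ≤ η * q ^ 2 + (1/η) * p ^ 2 := by
    intro p q
    have : η * q ^ 2 + (1/η) * p ^ 2 - 2 * p * q = (1/η) * (η * q - p) ^ 2 := by
      field_simp; ring
    have h : 0 ≤ (1/η) * (η * q - p) ^ 2 := by positivity
    linarith
  have := e1 (A y) (A' y)
  have := e1 (B y) (B' y)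
  linarith

lemma nls_static (A B A' B' : ℝ → ℝ) (hA : ∀ x, HasDerivAt A (A' x) x)
    (hB : ∀ x, HasDerivAt B (B' x) x) (cA : Continuous A') (cB : Continuous B')
    (A0 : A 0 = 0) (B0 : B 0 = 0) (X : ℝ) (hX : 1 ≤ X) (W : ℝ → ℝ) (cW : Continuous W)
    (W0 : ∀ x, 0 ≤ W x) (KV : ℝ) (hKV : ∫ x in (0:ℝ)..X, W x * exp (2 * x) ≤ KV)
    (r C ε μ : ℝ) (hr : 0 < r) (hC : 0 ≤ C) (hε1 : ε ^ 2 ≤ 1) (hμ : 0 ≤ μ)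
    (hE : ∀ x, 0 ≤ x → A x ^ 2 + B x ^ 2 ≤ ε ^ 2)
    (hμV : μ * (5 * KV) ≤ 1 / 2)
    (hεr : 2 * C * (4 * (1 + r) ^ 2 / r ^ 2 * (ε ^ 2) ^ r) ≤ 1 / 2) :
    (1/4) * (∫ x in (0:ℝ)..X, exp (-2 * x) * (A x ^ 2 + B x ^ 2)) - 4 * C / r / X ≤
    ∫ x in (0:ℝ)..X, (2 * exp (-x) * (A' x ^ 2 + B' x ^ 2)
      - 1/2 * exp (-x) * (A x ^ 2 + B x ^ 2)
      - μ * (W x * (A x ^ 2 + B x ^ 2))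
      - 2 * C * (exp (-x) * (A x ^ 2 + B x ^ 2) ^ (1 + r))) := by
  have hX0 : 0 ≤ X := by linarith
  have cA0 : Continuous A := continuous_iff_continuousAt.2 fun x => (hA x).continuousAt
  have cB0 : Continuous B := continuous_iff_continuousAt.2 fun x => (hB x).continuousAt
  obtain ⟨m, hm⟩ : ∃ m : ℝ → ℝ, m = fun x => exp (-x) * (A x ^ 2 + B x ^ 2) := ⟨_, rfl⟩
  obtain ⟨d, hd⟩ : ∃ d : ℝ → ℝ, d = fun x => exp (-x) *
    ((A' x - A x / 2) ^ 2 + (B' x - B x / 2) ^ 2) := ⟨_, rfl⟩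
  obtain ⟨m', hm'⟩ : ∃ m' : ℝ → ℝ, m' = fun x => 2 * exp (-x) *
    (A x * (A' x - A x / 2) + B x * (B' x - B x / 2)) := ⟨_, rfl⟩
  have cm : Continuous m := by rw [hm]; fun_prop
  have cd : Continuous d := by rw [hd]; fun_prop
  have cm' : Continuous m' := by rw [hm']; fun_prop
  have m0 : m 0 = 0 := by simp [hm, A0, B0]
  have mnn : ∀ x, 0 ≤ m x := fun x => by rw [hm]; positivity
  have dnn : ∀ x, 0 ≤ d x := fun x => by rw [hd]; positivity
  have hexp : ∀ x, HasDerivAt (fun x : ℝ => exp (-x)) (- exp (-x)) x := by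
    intro x
    have := (hasDerivAt_neg x).exp
    refine this.congr_deriv (by ring)
  have hmd : ∀ x, HasDerivAt m (m' x) x := by
    intro x
    have := (hexp x).mul (((hA x).pow 2).add ((hB x).pow 2))
    rw [hm, hm']
    refine this.congr_deriv ?_
    simp only [Pi.add_apply, Pi.pow_apply]
    push_cast; ring
  -- Young inequality
  have young : ∀ x η : ℝ, 0 < η → |m' x| ≤ η * m x + (1/η) * d x := by
    intro x η hη
    have e1 : ∀ p q : ℝ, |2 * (p * q)| ≤ η * p ^ 2 + (1/η) * q ^ 2 := by
      intro p q
      rw [abs_le]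
      have h1 : η * p ^ 2 + (1/η) * q ^ 2 - 2 * (p * q) = (1/η) * (η * p - q) ^ 2 := by
        field_simp; ring
      have h2 : η * p ^ 2 + (1/η) * q ^ 2 + 2 * (p * q) = (1/η) * (η * p + q) ^ 2 := by
        field_simp; ring
      have h3 : 0 ≤ (1/η) * (η * p - q) ^ 2 := by positivity
      have h4 : 0 ≤ (1/η) * (η * p + q) ^ 2 := by positivity
      constructor <;> linarith
    have h1 := e1 (A x) (A' x - A x / 2)
    have h2 := e1 (B x) (B' x - B x / 2)
    have h3 : m' x = exp (-x) * (2 * (A x * (A' x - A x / 2)) + 2 * (B x * (B' x - B x / 2))) := by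
      rw [hm']; ring
    rw [h3, abs_mul, abs_of_pos (exp_pos _)]
    have h4 := abs_add_le (2 * (A x * (A' x - A x / 2))) (2 * (B x * (B' x - B x / 2)))
    have h5 : η * m x + (1/η) * d x = exp (-x) * (η * (A x) ^ 2 + (1/η) * (A' x - A x / 2) ^ 2
      + (η * (B x) ^ 2 + (1/η) * (B' x - B x / 2) ^ 2)) := by
      rw [hm, hd]; ring
    rw [h5]
    apply mul_le_mul_of_nonneg_left _ (exp_pos _).le
    linarith
  obtain ⟨D, hD⟩ : ∃ D : ℝ, D = ∫ x in (0:ℝ)..X, d x := ⟨_, rfl⟩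
  have ii : ∀ g : ℝ → ℝ, Continuous g → ∀ a b, IntervalIntegrable g volume a b :=
    fun g hg a b => hg.intervalIntegrable a b
  have D0 : 0 ≤ D := by
    rw [hD]; exact intervalIntegral.integral_nonneg hX0 fun x _ => dnn x
  -- weighted Hardy
  have hardy : ∀ Y, 0 ≤ Y → ∫ x in (0:ℝ)..Y, exp (-x) * m x ≤ 4 * ∫ x in (0:ℝ)..Y, d x := by
    intro Y hY
    have h1 : ∀ x, HasDerivAt (fun x => exp (-x) * m x) (exp (-x) * m' x - exp (-x) * m x) x := by
      intro x
      refine ((hexp x).mul (hmd x)).congr_deriv (by ring)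
    have h2 := intervalIntegral.integral_eq_sub_of_hasDerivAt (a := 0) (b := Y)
      (fun y _ => h1 y) (ii _ (by fun_prop) _ _)
    have h3 : ∫ x in (0:ℝ)..Y, (exp (-x) * m' x - exp (-x) * m x) ≤
        ∫ x in (0:ℝ)..Y, (2 * d x - 1/2 * (exp (-x) * m x)) := by
      apply intervalIntegral.integral_mono_on hY (ii _ (by fun_prop) _ _) (ii _ (by fun_prop) _ _)
      intro x hx
      have := young x (1/2) (by norm_num)
      have h4 := le_abs_self (m' x)
      have h5 : exp (-x) ≤ 1 := by rw [exp_le_one_iff]; linarith [hx.1]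
      have h6 : exp (-x) * m' x ≤ exp (-x) * (1/2 * m x + 2 * d x) :=
        mul_le_mul_of_nonneg_left (by norm_num at this ⊢; linarith) (exp_pos _).le
      have h7 : exp (-x) * d x ≤ d x := mul_le_of_le_one_left (dnn x) h5
      nlinarith
    rw [h2, intervalIntegral.integral_sub (ii _ (by fun_prop) _ _) (ii _ (by fun_prop) _ _),
      intervalIntegral.integral_const_mul, intervalIntegral.integral_const_mul] at h3
    have h8 : 0 ≤ exp (-Y) * m Y := mul_nonneg (exp_pos _).le (mnn Y)
    rw [m0] at h3
    linarith
  have dle : ∀ Y, 0 ≤ Y → Y ≤ X → ∫ x in (0:ℝ)..Y, d x ≤ D := by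
    intro Y hY hYX
    rw [hD, ← intervalIntegral.integral_add_adjacent_intervals (ii d cd 0 Y) (ii d cd Y X)]
    have := intervalIntegral.integral_nonneg (μ := volume) hYX fun x _ => dnn x
    linarith
  -- pointwise
  have ptw : ∀ Y, 0 ≤ Y → Y ≤ X → m Y ≤ 5 * exp Y * D := by
    intro Y hY hYX
    have h2 := intervalIntegral.integral_eq_sub_of_hasDerivAt (a := 0) (b := Y)
      (fun y _ => hmd y) (ii _ (by fun_prop) _ _)
    have h3 : ∫ x in (0:ℝ)..Y, m' x ≤ ∫ x in (0:ℝ)..Y, (exp (-x) * m x + exp Y * d x) := by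
      apply intervalIntegral.integral_mono_on hY (ii _ (by fun_prop) _ _) (ii _ (by fun_prop) _ _)
      intro x hx
      have := young x (exp (-x)) (exp_pos _)
      have h4 := le_abs_self (m' x)
      have h5 : 1 / exp (-x) = exp x := by rw [exp_neg]; simp
      rw [h5] at this
      have h6 : exp x * d x ≤ exp Y * d x :=
        mul_le_mul_of_nonneg_right (exp_le_exp.2 hx.2) (dnn x)
      linarith
    rw [h2, intervalIntegral.integral_add (ii _ (by fun_prop) _ _) (ii _ (by fun_prop) _ _),
      intervalIntegral.integral_const_mul] at h3
    have h4 := hardy Y hY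
    have h5 := dle Y hY hYX
    have h6 : 1 ≤ exp Y := one_le_exp hY
    have h7 : exp Y * (∫ x in (0:ℝ)..Y, d x) ≤ exp Y * D :=
      mul_le_mul_of_nonneg_left h5 (exp_pos _).le
    have h8 : D ≤ exp Y * D := le_mul_of_one_le_left D0 h6
    rw [m0] at h3
    linarith
  -- potential
  have pot : ∫ x in (0:ℝ)..X, W x * (A x ^ 2 + B x ^ 2) ≤ 5 * KV * D := by
    have h1 : ∫ x in (0:ℝ)..X, W x * (A x ^ 2 + B x ^ 2) ≤
        ∫ x in (0:ℝ)..X, (5 * D) * (W x * exp (2 * x)) := by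
      apply intervalIntegral.integral_mono_on hX0 (ii _ (by fun_prop) _ _) (ii _ (by fun_prop) _ _)
      intro x hx
      have h2 := ptw x hx.1 hx.2
      have h3 : A x ^ 2 + B x ^ 2 = exp x * m x := by
        rw [hm]; simp only; rw [← mul_assoc, ← exp_add]; simp
      rw [h3]
      have h4 : exp x * m x ≤ exp x * (5 * exp x * D) :=
        mul_le_mul_of_nonneg_left h2 (exp_pos _).le
      have h5 : exp (2 * x) = exp x * exp x := by rw [← exp_add]; ring_nf
      rw [h5]
      calc W x * (exp x * m x) ≤ W x * (exp x * (5 * exp x * D)) :=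
            mul_le_mul_of_nonneg_left h4 (W0 x)
        _ = _ := by ring
    rw [intervalIntegral.integral_const_mul] at h1
    have := mul_le_mul_of_nonneg_left hKV (show 0 ≤ 5 * D by linarith)
    linarith
  -- nonlinear
  have cpow : Continuous fun x => (A x ^ 2 + B x ^ 2) ^ r := by
    apply Continuous.rpow_const (by fun_prop) ; intro x; right; exact hr.le
  have cpow1 : Continuous fun x => (A x ^ 2 + B x ^ 2) ^ (1 + r) := by
    apply Continuous.rpow_const (by fun_prop) ; intro x; right; linarith
  obtain ⟨N, hN⟩ : ∃ N : ℝ, N = ∫ x in (0:ℝ)..X, exp (-x) * (A x ^ 2 + B x ^ 2) ^ (1 + r) :=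
    ⟨_, rfl⟩
  have snn : ∀ x, 0 ≤ A x ^ 2 + B x ^ 2 := fun x => by positivity
  have key : ∀ x, exp (-x) * (A x ^ 2 + B x ^ 2) ^ (1 + r) = (A x ^ 2 + B x ^ 2) ^ r * m x := by
    intro x
    rw [rpow_add_of_nonneg (snn x) (by norm_num) hr.le, rpow_one, hm]; ring
  have nonl : N ≤ 2 / r * (1 / X) + 4 * (1 + r) ^ 2 / r ^ 2 * (ε ^ 2) ^ r * D := by
    -- derivative of exp(-x) s^(1+r)
    have hs : ∀ x, HasDerivAt (fun x => A x ^ 2 + B x ^ 2) (exp x * (m' x + m x)) x := by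
      intro x
      have := ((hA x).pow 2).add ((hB x).pow 2)
      refine this.congr_deriv ?_
      rw [hm, hm']
      have : exp x * exp (-x) = 1 := by rw [← exp_add]; simp
      push_cast
      linear_combination (-2 * A x * A' x - 2 * B x * B' x) * this
    have h1 : ∀ x, HasDerivAt (fun x => exp (-x) * (A x ^ 2 + B x ^ 2) ^ (1 + r))
        (r * ((A x ^ 2 + B x ^ 2) ^ r * m x) + (1 + r) * ((A x ^ 2 + B x ^ 2) ^ r * m' x)) x := by
      intro x
      have h2 := (hs x).rpow_const (p := 1 + r) (Or.inr (by linarith))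
      refine ((hexp x).mul h2).congr_deriv ?_
      have h3 := key x
      have : exp x * exp (-x) = 1 := by rw [← exp_add]; simp
      rw [show 1 + r - 1 = r by ring]
      linear_combination -h3 + (1 + r) * ((A x ^ 2 + B x ^ 2) ^ r) * (m' x + m x) * this
    have h2 := intervalIntegral.integral_eq_sub_of_hasDerivAt (a := 0) (b := X)
      (fun y _ => h1 y) (ii _ (by fun_prop) _ _)
    have h3 : ∫ x in (0:ℝ)..X, ((r/2) * ((A x ^ 2 + B x ^ 2) ^ r * m x)
         - (2 * (1 + r) ^ 2 / r) * (ε ^ 2) ^ r * d x) ≤ 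
         ∫ x in (0:ℝ)..X, (r * ((A x ^ 2 + B x ^ 2) ^ r * m x)
          + (1 + r) * ((A x ^ 2 + B x ^ 2) ^ r * m' x)) := by
      apply intervalIntegral.integral_mono_on hX0 (ii _ (by fun_prop) _ _) (ii _ (by fun_prop) _ _)
      intro x hx
      have y := young x (r / (2 * (1 + r))) (by positivity)
      have h4 := neg_abs_le (m' x)
      have p0 : 0 ≤ (A x ^ 2 + B x ^ 2) ^ r := rpow_nonneg (snn x) _
      have p1 : (A x ^ 2 + B x ^ 2) ^ r ≤ (ε ^ 2) ^ r := rpow_le_rpow (snn x) (hE x hx.1) hr.le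
      have h5 : -((r/2) * m x + (2 * (1 + r) ^ 2 / r) * d x) ≤ (1 + r) * m' x := by
        have : (1 + r) * (r / (2 * (1 + r)) * m x + 1 / (r / (2 * (1 + r))) * d x)
          = (r/2) * m x + (2 * (1 + r) ^ 2 / r) * d x := by field_simp
        rw [← this]
        have := mul_le_mul_of_nonneg_left (show -(r / (2 * (1 + r)) * m x + 1 / (r / (2 * (1 + r))) * d x) ≤ m' x by linarith) (show 0 ≤ 1 + r by linarith)
        linarith
      have h6 := mul_le_mul_of_nonneg_left h5 p0
      have h7 : (2 * (1 + r) ^ 2 / r) * (A x ^ 2 + B x ^ 2) ^ r * d x ≤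
          (2 * (1 + r) ^ 2 / r) * (ε ^ 2) ^ r * d x := by
        apply mul_le_mul_of_nonneg_right _ (dnn x)
        exact mul_le_mul_of_nonneg_left p1 (by positivity)
      linarith
    rw [h2, intervalIntegral.integral_sub (ii _ (by fun_prop) _ _) (ii _ (by fun_prop) _ _),
      intervalIntegral.integral_const_mul, intervalIntegral.integral_const_mul, ← hD] at h3
    have h4 : ∫ x in (0:ℝ)..X, ((A x ^ 2 + B x ^ 2) ^ r * m x) = N := by
      rw [hN]; congr 1; ext x; rw [key]
    rw [h4] at h3
    have h5 : exp (-X) * (A X ^ 2 + B X ^ 2) ^ (1 + r) ≤ 1 / X := by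
      have e1 : exp (-X) ≤ 1 / X := by
        rw [exp_neg, ← one_div]
        apply one_div_le_one_div_of_le (by linarith)
        linarith [add_one_le_exp X]
      have e2 : (A X ^ 2 + B X ^ 2) ^ (1 + r) ≤ 1 :=
        rpow_le_one (snn X) ((hE X hX0).trans hε1) (by linarith)
      calc _ ≤ (1 / X) * 1 := mul_le_mul e1 e2 (rpow_nonneg (snn X) _) (by positivity)
        _ = _ := by ring
    have h6 : 0 ≤ exp (-(0:ℝ)) * (A 0 ^ 2 + B 0 ^ 2) ^ (1 + r) :=
      mul_nonneg (exp_pos _).le (rpow_nonneg (snn _) _)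
    have h7 : r / 2 * N ≤ 1 / X + 2 * (1 + r) ^ 2 / r * (ε ^ 2) ^ r * D :=
      sub_le_iff_le_add.1 (h3.trans ((sub_le_self _ h6).trans h5))
    have h8 := mul_le_mul_of_nonneg_left h7 (show 0 ≤ 2 / r by positivity)
    calc N = 2 / r * (r / 2 * N) := by field_simp
      _ ≤ _ := h8
      _ = _ := by field_simp; ring
  -- main identity
  have main : 2 * D ≤ ∫ x in (0:ℝ)..X, (2 * exp (-x) * (A' x ^ 2 + B' x ^ 2)
      - 1/2 * exp (-x) * (A x ^ 2 + B x ^ 2)) := by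
    have h1 : ∀ x, 2 * exp (-x) * (A' x ^ 2 + B' x ^ 2)
      - 1/2 * exp (-x) * (A x ^ 2 + B x ^ 2) = 2 * d x + m' x := by
      intro x; rw [hd, hm']; ring
    simp_rw [h1]
    rw [intervalIntegral.integral_add (ii _ (by fun_prop) _ _) (ii _ (by fun_prop) _ _),
      intervalIntegral.integral_const_mul, ← hD]
    rw [intervalIntegral.integral_eq_sub_of_hasDerivAt (a := 0) (b := X)
      (fun y _ => hmd y) (ii _ (by fun_prop) _ _), m0]
    linarith [mnn X]
  rw [intervalIntegral.integral_sub (ii _ (by fun_prop) _ _) (ii _ (by fun_prop) _ _),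
    intervalIntegral.integral_sub (ii _ (by fun_prop) _ _) (ii _ (by fun_prop) _ _),
    intervalIntegral.integral_const_mul, intervalIntegral.integral_const_mul, ← hN]
  have f1 : ∫ x in (0:ℝ)..X, exp (-2 * x) * (A x ^ 2 + B x ^ 2) ≤ 4 * D := by
    have := hardy X hX0
    rw [← hD] at this
    refine le_of_eq_of_le ?_ this
    congr 1; ext x; rw [hm]; simp only; rw [← mul_assoc, ← exp_add]; ring_nf
  have f2 : μ * (∫ x in (0:ℝ)..X, W x * (A x ^ 2 + B x ^ 2)) ≤ 1/2 * D := by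
    have := mul_le_mul_of_nonneg_left pot hμ
    have := mul_le_mul_of_nonneg_right hμV D0
    linarith
  have f3 : 2 * C * N ≤ 4 * C / r / X + 1/2 * D := by
    have h1 := mul_le_mul_of_nonneg_left nonl (show 0 ≤ 2 * C by linarith)
    have h2 := mul_le_mul_of_nonneg_right hεr D0
    have h3 : 2 * C * (2 / r * (1 / X) + 4 * (1 + r) ^ 2 / r ^ 2 * (ε ^ 2) ^ r * D) =
      4 * C / r / X + 2 * C * (4 * (1 + r) ^ 2 / r ^ 2 * (ε ^ 2) ^ r) * D := by
      field_simp; ring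
    linarith
  linarith

lemma nls_F (S f : ℝ → ℝ) (cS : Continuous S) (S0 : S 0 = 0) (Snn : ∀ x, 0 ≤ S x)
    (cfS : Continuous fun x => f (S x)) (X : ℝ) (hX : 0 ≤ X) (C r : ℝ) (hC : 0 ≤ C) (hr : 0 < r)
    (hf : ∀ s, 0 ≤ s → |f s| ≤ C * s ^ r) :
    ∃ k F : ℝ → ℝ, Continuous k ∧ (∀ s, HasDerivAt F (k s) s) ∧ F 0 = 0 ∧
      (∀ x ∈ Set.Icc 0 X, k (S x) = f (S x)) ∧
      (∀ x ∈ Set.Icc 0 X, |F (S x)| ≤ C * S x ^ (1 + r)) := by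
  obtain ⟨z, hz, hmax⟩ := isCompact_Icc.exists_isMaxOn (Set.nonempty_Icc.2 hX) cS.continuousOn
  have hM : (0:ℝ) ≤ S z := Snn z
  have cf : Continuous fun s : Set.Icc 0 (S z) => f s := by
    let pr : Set.Icc 0 X → Set.Icc 0 (S z) := fun x => ⟨S x, Snn x, hmax x.2⟩
    have cpr : Continuous pr := by
      apply Continuous.subtype_mk
      exact cS.comp continuous_subtype_val
    have spr : Function.Surjective pr := by
      rintro ⟨s, hs⟩
      have := intermediate_value_Icc hz.1 cS.continuousOn
      rw [S0] at this
      obtain ⟨y, hy, hys⟩ := this hs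
      exact ⟨⟨y, hy.1, hy.2.trans hz.2⟩, Subtype.ext hys⟩
    have q := cpr.isClosedMap.isQuotientMap cpr spr
    rw [q.continuous_iff]
    exact cfS.comp continuous_subtype_val
  let k : ℝ → ℝ := Set.IccExtend hM fun s => f s
  have ck : Continuous k := cf.Icc_extend'
  have kk : ∀ s ∈ Set.Icc 0 (S z), k s = f s := fun s hs => Set.IccExtend_of_mem hM _ hs
  refine ⟨k, fun s => ∫ y in (0:ℝ)..s, k y, ck, ?_, by simp, ?_, ?_⟩
  · intro s
    exact intervalIntegral.integral_hasDerivAt_right (ck.intervalIntegrable _ _)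
      (ck.stronglyMeasurableAtFilter _ _) ck.continuousAt
  · intro x hx; exact kk _ ⟨Snn x, hmax hx⟩
  · intro x hx
    have := intervalIntegral.norm_integral_le_of_norm_le_const (a := 0) (b := S x)
      (C := C * S x ^ r) (f := k) (by
        intro y hy
        rw [Set.uIoc_of_le (Snn x)] at hy
        rw [kk y ⟨hy.1.le, hy.2.trans (hmax hx)⟩, norm_eq_abs]
        refine (hf y hy.1.le).trans ?_
        exact mul_le_mul_of_nonneg_left (rpow_le_rpow hy.1.le hy.2 hr.le) hC)
    rw [norm_eq_abs, sub_zero, abs_of_nonneg (Snn x)] at this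
    rw [rpow_add_of_nonneg (Snn x) (by norm_num) hr.le, rpow_one]
    calc _ ≤ _ := this
      _ = _ := by ring

lemma nls_virial (A B A1 B1 A2 B2 At Bt Axt Bxt V V1 k F φ φ1 φ2 φ3 : ℝ → ℝ) (μ X : ℝ)
    (hX : 0 ≤ X)
    (hA : ∀ x, HasDerivAt A (A1 x) x) (hB : ∀ x, HasDerivAt B (B1 x) x)
    (hA1 : ∀ x, HasDerivAt A1 (A2 x) x) (hB1 : ∀ x, HasDerivAt B1 (B2 x) x)
    (hAt : ∀ x, HasDerivAt At (Axt x) x) (hBt : ∀ x, HasDerivAt Bt (Bxt x) x)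
    (hV : ∀ x, HasDerivAt V (V1 x) x) (hF : ∀ x, HasDerivAt F (k x) x)
    (hφ : ∀ x, HasDerivAt φ (φ1 x) x) (hφ1 : ∀ x, HasDerivAt φ1 (φ2 x) x)
    (hφ2 : ∀ x, HasDerivAt φ2 (φ3 x) x)
    (cAxt : Continuous Axt) (cBxt : Continuous Bxt)
    (cV1 : Continuous V1) (ck : Continuous k) (cφ3 : Continuous φ3)
    (A0 : A 0 = 0) (B0 : B 0 = 0) (φ0 : φ 0 = 0)
    (φX : φ X = 0) (φ1X : φ1 X = 0) (φ2X : φ2 X = 0)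
    (e1 : ∀ x ∈ Set.Icc 0 X, Bt x = A2 x - (μ * V x + k (A x ^ 2 + B x ^ 2)) * A x)
    (e2 : ∀ x ∈ Set.Icc 0 X, At x = (μ * V x + k (A x ^ 2 + B x ^ 2)) * B x - B2 x) :
    ∫ x in (0:ℝ)..X, φ x * (At x * B1 x + A x * Bxt x - (Bt x * A1 x + B x * Axt x)) =
    ∫ x in (0:ℝ)..X, (2 * φ1 x * (A1 x ^ 2 + B1 x ^ 2) - 1/2 * φ3 x * (A x ^ 2 + B x ^ 2)
      - μ * (φ x * V1 x * (A x ^ 2 + B x ^ 2))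
      + φ1 x * (k (A x ^ 2 + B x ^ 2) * (A x ^ 2 + B x ^ 2) - F (A x ^ 2 + B x ^ 2))) := by
  have cc : ∀ g g' : ℝ → ℝ, (∀ x, HasDerivAt g (g' x) x) → Continuous g := fun g g' h =>
    continuous_iff_continuousAt.2 fun x => (h x).continuousAt
  have := cc _ _ hA
  have := cc _ _ hB
  have := cc _ _ hA1
  have := cc _ _ hB1
  have := cc _ _ hAt
  have := cc _ _ hBt
  have := cc _ _ hV
  have := cc _ _ hF
  have := cc _ _ hφ
  have := cc _ _ hφ1
  have := cc _ _ hφ2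
  have c1 : Continuous fun x => φ x * (At x * B1 x + A x * Bxt x - (Bt x * A1 x + B x * Axt x)) := by
    fun_prop
  have c2 : Continuous fun x => (2 * φ1 x * (A1 x ^ 2 + B1 x ^ 2) - 1/2 * φ3 x * (A x ^ 2 + B x ^ 2)
      - μ * (φ x * V1 x * (A x ^ 2 + B x ^ 2))
      + φ1 x * (k (A x ^ 2 + B x ^ 2) * (A x ^ 2 + B x ^ 2) - F (A x ^ 2 + B x ^ 2))) := by
    fun_prop
  rw [← sub_eq_zero, ← intervalIntegral.integral_sub (c1.intervalIntegrable _ _)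
    (c2.intervalIntegrable _ _)]
  have hS : ∀ x, HasDerivAt (fun x => A x ^ 2 + B x ^ 2) (2 * A x * A1 x + 2 * B x * B1 x) x := by
    intro x
    refine (((hA x).pow 2).add ((hB x).pow 2)).congr_deriv ?_
    push_cast; ring
  have hP : ∀ x, HasDerivAt (fun x => A1 x ^ 2 + B1 x ^ 2)
      (2 * A1 x * A2 x + 2 * B1 x * B2 x) x := by
    intro x
    refine (((hA1 x).pow 2).add ((hB1 x).pow 2)).congr_deriv ?_
    push_cast; ring
  have c12 : Continuous fun x => φ x * (At x * B1 x + A x * Bxt x - (Bt x * A1 x + B x * Axt x)) -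
      (2 * φ1 x * (A1 x ^ 2 + B1 x ^ 2) - 1/2 * φ3 x * (A x ^ 2 + B x ^ 2)
      - μ * (φ x * V1 x * (A x ^ 2 + B x ^ 2))
      + φ1 x * (k (A x ^ 2 + B x ^ 2) * (A x ^ 2 + B x ^ 2) - F (A x ^ 2 + B x ^ 2))) := c1.sub c2
  rw [intervalIntegral.integral_eq_sub_of_hasDerivAt (f := fun x =>
    φ x * (A x * Bt x - B x * At x) - φ x * (A1 x ^ 2 + B1 x ^ 2)
     - φ1 x * (A x * A1 x + B x * B1 x) + (1/2) * (φ2 x * (A x ^ 2 + B x ^ 2))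
     + μ * (φ x * V x * (A x ^ 2 + B x ^ 2)) + φ x * F (A x ^ 2 + B x ^ 2))
    ?_ (c12.intervalIntegrable _ _)]
  · simp [A0, B0, φ0, φX, φ1X, φ2X]
  · intro x hx
    rw [Set.uIcc_of_le hX] at hx
    have hFS := (hF (A x ^ 2 + B x ^ 2)).comp x (hS x)
    have := (((((hφ x).mul (((hA x).mul (hBt x)).sub ((hB x).mul (hAt x)))).sub
      ((hφ x).mul (hP x))).sub ((hφ1 x).mul (((hA x).mul (hA1 x)).add ((hB x).mul (hB1 x))))).add
      (((hφ2 x).mul (hS x)).const_mul (1/2))).add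
      ((((hφ x).mul (hV x)).mul (hS x)).const_mul μ) |>.add ((hφ x).mul hFS)
    refine this.congr_deriv ?_
    have E1 := e1 x hx
    have E2 := e2 x hx
    simp only [Pi.mul_apply, Pi.sub_apply, Pi.add_apply, Function.comp]
    rw [E1, E2]
    ring

lemma nls_param (G G' : ℝ × ℝ → ℝ) (cG : Continuous G) (cG' : Continuous G')
    (h : ∀ t x, HasDerivAt (fun t => G (t, x)) (G' (t, x)) t) (X t : ℝ) :
    HasDerivAt (fun t => ∫ x in (0:ℝ)..X, G (t, x)) (∫ x in (0:ℝ)..X, G' (t, x)) t := by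
  obtain ⟨K, hK⟩ := ((isCompact_Icc (a := t - 1) (b := t + 1)).prod
    (isCompact_uIcc (a := 0) (b := X))).exists_bound_of_continuousOn cG'.continuousOn
  refine (intervalIntegral.hasDerivAt_integral_of_dominated_loc_of_deriv_le
    (F := fun t x => G (t, x)) (F' := fun t x => G' (t, x)) (bound := fun _ => K)
    (Metric.ball_mem_nhds t one_pos) ?_ ?_ ?_ ?_ ?_ ?_).2
  · refine Eventually.of_forall fun s => ?_
    exact Continuous.aestronglyMeasurable (by fun_prop)
  · exact Continuous.intervalIntegrable (by fun_prop) _ _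
  · exact Continuous.aestronglyMeasurable (by fun_prop)
  · refine Eventually.of_forall fun x hx s hs => ?_
    apply hK
    rw [Metric.mem_ball, Real.dist_eq, abs_lt] at hs
    exact ⟨⟨by linarith, by linarith⟩, Set.uIoc_subset_uIcc hx⟩
  · exact intervalIntegrable_const
  · exact Eventually.of_forall fun x hx s hs => h s x

lemma nls_partials (a : ℝ × ℝ → ℝ) (ha : ContDiff ℝ (⊤ : ℕ∞) a) :
    ∃ ax at' axt : ℝ × ℝ → ℝ, ContDiff ℝ (⊤ : ℕ∞) ax ∧ Continuous at' ∧ Continuous axt ∧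
      (∀ t x, HasDerivAt (fun x => a (t, x)) (ax (t, x)) x) ∧
      (∀ t x, HasDerivAt (fun t => a (t, x)) (at' (t, x)) t) ∧
      (∀ t x, HasDerivAt (fun t => ax (t, x)) (axt (t, x)) t) ∧
      (∀ t x, HasDerivAt (fun x => at' (t, x)) (axt (t, x)) x) := by
  have hx : ∀ (b : ℝ × ℝ → ℝ), ContDiff ℝ (⊤ : ℕ∞) b → ∀ t x, 
      HasDerivAt (fun x => b (t, x)) (fderiv ℝ b (t, x) (0, 1)) x := by
    intro b hb t x
    have h1 : HasFDerivAt b (fderiv ℝ b (t, x)) (t, x) :=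
      (hb.differentiable (by simp)).differentiableAt.hasFDerivAt
    have h2 : HasDerivAt (fun x : ℝ => (t, x)) (0, 1) x :=
      (hasDerivAt_const x t).prodMk (hasDerivAt_id x)
    exact h1.comp_hasDerivAt x h2
  have ht : ∀ (b : ℝ × ℝ → ℝ), ContDiff ℝ (⊤ : ℕ∞) b → ∀ t x, 
      HasDerivAt (fun t => b (t, x)) (fderiv ℝ b (t, x) (1, 0)) t := by
    intro b hb t x
    have h1 : HasFDerivAt b (fderiv ℝ b (t, x)) (t, x) :=
      (hb.differentiable (by simp)).differentiableAt.hasFDerivAt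
    have h2 : HasDerivAt (fun t : ℝ => (t, x)) (1, 0) t :=
      (hasDerivAt_id t).prodMk (hasDerivAt_const t x)
    exact h1.comp_hasDerivAt t h2
  have hfd : ContDiff ℝ (⊤ : ℕ∞) (fderiv ℝ a) := ha.fderiv_right (by simp)
  have s1 : ∀ v : ℝ × ℝ, ContDiff ℝ (⊤ : ℕ∞) (fun p => fderiv ℝ a p v) := fun v =>
    hfd.clm_apply contDiff_const
  have s2 : ContDiff ℝ (⊤ : ℕ∞) (fderiv ℝ fun p => fderiv ℝ a p (0, 1)) :=
    (s1 (0, 1)).fderiv_right (by simp)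
  have sw : ∀ (v w p : ℝ × ℝ), fderiv ℝ (fun p => fderiv ℝ a p v) p w = fderiv ℝ (fderiv ℝ a) p w v := by
    intro v w p
    rw [fderiv_clm_apply (hfd.differentiable (by simp)).differentiableAt (by fun_prop)]
    simp
  refine ⟨fun p => fderiv ℝ a p (0, 1), fun p => fderiv ℝ a p (1, 0),
    fun p => fderiv ℝ (fun p => fderiv ℝ a p (0, 1)) p (1, 0), s1 _, (s1 _).continuous,
    (s2.clm_apply contDiff_const).continuous, hx a ha, ht a ha, ht _ (s1 _), ?_⟩
  intro t x
  have := hx _ (s1 (1, 0)) t x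
  refine this.congr_deriv ?_
  beta_reduce
  rw [sw, sw]
  have hsym : IsSymmSndFDerivAt ℝ a (t, x) := ha.contDiffAt.isSymmSndFDerivAt (by
    simp only [minSmoothness_of_isRCLikeNormedField]; exact WithTop.coe_le_coe.2 (le_top : (2:ℕ∞) ≤ ⊤))
  exact hsym _ _

lemma nls_cutoff (X x : ℝ) (hX : 1 ≤ X) (hx : x ∈ Set.Icc 0 X) :
    |(1 - exp (-x)) * (1 - x * X⁻¹) ^ 3| ≤ 1 ∧
    |exp (-x) * (1 - x * X⁻¹) ^ 3 - 3 * X⁻¹ * ((1 - exp (-x)) * (1 - x * X⁻¹) ^ 2) - exp (-x)|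
      ≤ 6 * X⁻¹ ∧
    |exp (-x) * (1 - x * X⁻¹) ^ 3 + 9 * X⁻¹ * (exp (-x) * (1 - x * X⁻¹) ^ 2)
      + 18 * X⁻¹ ^ 2 * (exp (-x) * (1 - x * X⁻¹)) - 6 * X⁻¹ ^ 3 * (1 - exp (-x)) - exp (-x)|
      ≤ 36 * X⁻¹ := by
  have i0 : 0 ≤ X⁻¹ := by positivity
  have i1 : X⁻¹ ≤ 1 := inv_le_one_of_one_le₀ hX
  have c0 : 0 ≤ 1 - x * X⁻¹ := by
    have := mul_le_mul_of_nonneg_right hx.2 i0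
    rw [mul_inv_cancel₀ (by linarith)] at this
    linarith
  have c1 : 1 - x * X⁻¹ ≤ 1 := by
    have := mul_nonneg hx.1 i0
    linarith
  have e0 : 0 ≤ exp (-x) := (exp_pos _).le
  have e1 : exp (-x) ≤ 1 := by rw [exp_le_one_iff]; linarith [hx.1]
  have ex : exp (-x) * x ≤ 1 := by
    have h1 := add_one_le_exp x
    have h2 : exp (-x) * exp x = 1 := by rw [← exp_add]; simp
    have h3 := mul_le_mul_of_nonneg_left h1 e0
    linarith
  have ec : exp (-x) * (1 - (1 - x * X⁻¹)) ≤ X⁻¹ := by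
    have := mul_le_mul_of_nonneg_right ex i0
    linarith
  generalize X⁻¹ = i at *
  generalize 1 - x * i = c at *
  generalize exp (-x) = e at *
  have k2 : 0 ≤ c ^ 2 := by positivity
  have k2' : c ^ 2 ≤ 1 := pow_le_one₀ c0 c1
  have k3 : 0 ≤ c ^ 3 := by positivity
  have k3' : c ^ 3 ≤ 1 := pow_le_one₀ c0 c1
  have a1 : 0 ≤ (1 - e) * c ^ 3 := mul_nonneg (by linarith) k3
  have a2 : (1 - e) * c ^ 3 ≤ 1 := mul_le_one₀ (by linarith) k3 k3'
  have a3 : 1 - c ^ 3 ≤ 3 * (1 - c) := by nlinarith [mul_nonneg c0 (sub_nonneg.2 c1), mul_nonneg k2 (sub_nonneg.2 c1)]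
  have a4 : e * (1 - c ^ 3) ≤ 3 * i := by
    have := mul_le_mul_of_nonneg_left a3 e0
    linarith
  have a5 : 0 ≤ e * (1 - c ^ 3) := mul_nonneg e0 (by linarith)
  have a6 : 0 ≤ i * ((1 - e) * c ^ 2) := mul_nonneg i0 (mul_nonneg (by linarith) k2)
  have a7 : i * ((1 - e) * c ^ 2) ≤ i :=
    mul_le_of_le_one_right i0 (mul_le_one₀ (by linarith) k2 k2')
  have b1 : 0 ≤ i * (e * c ^ 2) := by positivity
  have b2 : i * (e * c ^ 2) ≤ i := mul_le_of_le_one_right i0 (mul_le_one₀ e1 k2 k2')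
  have j2 : i ^ 2 ≤ i := by nlinarith
  have j3 : i ^ 3 ≤ i := by nlinarith
  have b3 : 0 ≤ i ^ 2 * (e * c) := by positivity
  have b4 : i ^ 2 * (e * c) ≤ i :=
    (mul_le_of_le_one_right (by positivity) (mul_le_one₀ e1 c0 c1)).trans j2
  have b5 : 0 ≤ i ^ 3 * (1 - e) := mul_nonneg (by positivity) (by linarith)
  have b6 : i ^ 3 * (1 - e) ≤ i :=
    (mul_le_of_le_one_right (by positivity) (by linarith)).trans j3
  refine ⟨?_, ?_, ?_⟩ <;> rw [abs_le] <;> constructor <;> linarith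

lemma nls_lower (A B A1 B1 A2 B2 At Bt Axt Bxt V V1 f : ℝ → ℝ) (μ X : ℝ)
    (hX : 1 ≤ X)
    (hA : ∀ x, HasDerivAt A (A1 x) x) (hB : ∀ x, HasDerivAt B (B1 x) x)
    (hA1 : ∀ x, HasDerivAt A1 (A2 x) x) (hB1 : ∀ x, HasDerivAt B1 (B2 x) x)
    (hAt : ∀ x, HasDerivAt At (Axt x) x) (hBt : ∀ x, HasDerivAt Bt (Bxt x) x)
    (hV : ∀ x, HasDerivAt V (V1 x) x)
    (cA2 : Continuous A2) (cB2 : Continuous B2)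
    (cAxt : Continuous Axt) (cBxt : Continuous Bxt)
    (cV1 : Continuous V1)
    (A0 : A 0 = 0) (B0 : B 0 = 0)
    (e1 : ∀ x, Bt x = A2 x - (μ * V x + f (A x ^ 2 + B x ^ 2)) * A x)
    (e2 : ∀ x, At x = (μ * V x + f (A x ^ 2 + B x ^ 2)) * B x - B2 x)
    (KV : ℝ) (hKV : ∫ x in (0:ℝ)..X, |V1 x| * exp (2 * x) ≤ KV)
    (r C ε : ℝ) (hr : 0 < r) (hC : 0 ≤ C) (hε1 : ε ^ 2 ≤ 1) (hμ : 0 ≤ μ)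
    (hf : ∀ s, 0 ≤ s → |f s| ≤ C * s ^ r)
    (hE : ∀ x, 0 ≤ x → ∫ y in (0:ℝ)..x, ((A1 y ^ 2 + B1 y ^ 2) + (A y ^ 2 + B y ^ 2)) ≤ ε ^ 2)
    (hμV : μ * (5 * KV) ≤ 1 / 2)
    (hεr : 2 * C * (4 * (1 + r) ^ 2 / r ^ 2 * (ε ^ 2) ^ r) ≤ 1 / 2) :
    (1/4) * (∫ x in (0:ℝ)..X, exp (-2 * x) * (A x ^ 2 + B x ^ 2))
      - (4 * C / r + (18 + 12 * C)) / X ≤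
    ∫ x in (0:ℝ)..X, ((1 - exp (-x)) * (1 - x * X⁻¹) ^ 3) *
      (At x * B1 x + A x * Bxt x - (Bt x * A1 x + B x * Axt x)) := by
  have hX0 : 0 ≤ X := by linarith
  have cc : ∀ g g' : ℝ → ℝ, (∀ x, HasDerivAt g (g' x) x) → Continuous g := fun g g' h =>
    continuous_iff_continuousAt.2 fun x => (h x).continuousAt
  have cA := cc _ _ hA
  have cB := cc _ _ hB
  have cA1 := cc _ _ hA1
  have cB1 := cc _ _ hB1
  have cAt := cc _ _ hAt
  have cBt := cc _ _ hBt
  have cV := cc _ _ hV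
  have snn : ∀ x, 0 ≤ A x ^ 2 + B x ^ 2 := fun x => by positivity
  have cS : Continuous fun x => A x ^ 2 + B x ^ 2 := by fun_prop
  have hC0 : f 0 = 0 := by
    have := hf 0 le_rfl
    rw [zero_rpow hr.ne', mul_zero] at this
    exact abs_nonpos_iff.1 this
  have cfS : Continuous fun x => f (A x ^ 2 + B x ^ 2) := by
    rw [continuous_iff_continuousAt]
    intro x
    by_cases h : A x ^ 2 + B x ^ 2 = 0
    · have : Tendsto (fun x => C * (A x ^ 2 + B x ^ 2) ^ r) (nhds x) (nhds 0) := by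
        have c : Continuous fun x => C * (A x ^ 2 + B x ^ 2) ^ r :=
          continuous_const.mul (cS.rpow_const fun x => Or.inr hr.le)
        have := c.tendsto x
        rwa [h, zero_rpow hr.ne', mul_zero] at this
      unfold ContinuousAt
      beta_reduce
      rw [h, hC0]
      exact squeeze_zero_norm (fun y => hf _ (snn y)) this
    · have ev : ∀ᶠ y in nhds x, A y ^ 2 + B y ^ 2 ≠ 0 := cS.continuousAt.eventually_ne h
      have h1 : ContinuousAt (fun y => (A y * (A2 y - Bt y) + B y * (At y + B2 y)) /
          (A y ^ 2 + B y ^ 2) - μ * V y) x := by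
        apply ContinuousAt.sub _ (by fun_prop)
        exact ContinuousAt.div (f := fun y => A y * (A2 y - Bt y) + B y * (At y + B2 y))
          (g := fun y => A y ^ 2 + B y ^ 2) (by fun_prop) (by fun_prop) h
      refine h1.congr ?_
      filter_upwards [ev] with y hy
      rw [e1 y, e2 y]
      field_simp
      ring
  obtain ⟨k, F, ck, hF, F0, hk, hFb⟩ := nls_F (fun x => A x ^ 2 + B x ^ 2) f cS (by simp [A0, B0])
    snn cfS X hX0 C r hC hr hf
  have hs1 : ∀ x, 0 ≤ x → A x ^ 2 + B x ^ 2 ≤ ε ^ 2 := by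
    intro x hx
    have := nls_sup A B A1 B1 hA hB cA1 cB1 A0 B0 x 1 hx one_pos
    simp only [one_mul, div_one] at this
    exact this.trans (hE x hx)
  have st := nls_static A B A1 B1 hA hB cA1 cB1 A0 B0 X hX (fun x => |V1 x|) (by fun_prop)
    (fun x => abs_nonneg _) KV hKV r C ε μ hr hC hε1 hμ hs1 hμV hεr
  have he : ∀ x, HasDerivAt (fun x : ℝ => exp (-x)) (- exp (-x)) x := by
    intro x
    refine (hasDerivAt_neg x).exp.congr_deriv (by ring)
  have hc : ∀ x, HasDerivAt (fun x : ℝ => 1 - x * X⁻¹) (-X⁻¹) x := by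
    intro x
    refine (((hasDerivAt_id x).mul_const X⁻¹).const_sub 1).congr_deriv (by ring)
  have he1 : ∀ x, HasDerivAt (fun x : ℝ => 1 - exp (-x)) (exp (-x)) x := by
    intro x
    refine ((he x).const_sub 1).congr_deriv (by ring)
  have vir := nls_virial A B A1 B1 A2 B2 At Bt Axt Bxt V V1 k F
    (fun x => (1 - exp (-x)) * (1 - x * X⁻¹) ^ 3)
    (fun x => exp (-x) * (1 - x * X⁻¹) ^ 3 - 3 * X⁻¹ * ((1 - exp (-x)) * (1 - x * X⁻¹) ^ 2))
    (fun x => - (exp (-x) * (1 - x * X⁻¹) ^ 3) - 6 * X⁻¹ * (exp (-x) * (1 - x * X⁻¹) ^ 2)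
      + 6 * X⁻¹ ^ 2 * ((1 - exp (-x)) * (1 - x * X⁻¹)))
    (fun x => exp (-x) * (1 - x * X⁻¹) ^ 3 + 9 * X⁻¹ * (exp (-x) * (1 - x * X⁻¹) ^ 2)
      + 18 * X⁻¹ ^ 2 * (exp (-x) * (1 - x * X⁻¹)) - 6 * X⁻¹ ^ 3 * (1 - exp (-x)))
    μ X hX0 hA hB hA1 hB1 hAt hBt hV hF
    (by
      intro x
      refine ((he1 x).mul ((hc x).pow 3)).congr_deriv ?_
      simp only [Pi.pow_apply]; push_cast; ring)
    (by
      intro x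
      refine (((he x).mul ((hc x).pow 3)).sub
        (((he1 x).mul ((hc x).pow 2)).const_mul (3 * X⁻¹))).congr_deriv ?_
      simp only [Pi.pow_apply]; push_cast; ring)
    (by
      intro x
      refine ((((he x).mul ((hc x).pow 3)).neg.sub
        (((he x).mul ((hc x).pow 2)).const_mul (6 * X⁻¹))).add
        (((he1 x).mul (hc x)).const_mul (6 * X⁻¹ ^ 2))).congr_deriv ?_
      simp only [Pi.pow_apply]; push_cast; ring)
    cAxt cBxt cV1 ck (by fun_prop) A0 B0 (by simp)
    (by simp [mul_inv_cancel₀ (show X ≠ 0 by linarith)])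
    (by simp [mul_inv_cancel₀ (show X ≠ 0 by linarith)])
    (by simp [mul_inv_cancel₀ (show X ≠ 0 by linarith)])
    (by intro x hx; have := hk x hx; rw [this]; exact e1 x)
    (by intro x hx; have := hk x hx; rw [this]; exact e2 x)
  rw [vir]
  have cF := cc _ _ hF
  have cpow1 : Continuous fun x => (A x ^ 2 + B x ^ 2) ^ (1 + r) := by
    apply Continuous.rpow_const (by fun_prop) ; intro x; right; linarith
  have ii : ∀ g : ℝ → ℝ, Continuous g → ∀ a b, IntervalIntegrable g volume a b :=
    fun g hg a b => hg.intervalIntegrable a b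
  have cmp : ∫ x in (0:ℝ)..X, ((2 * exp (-x) * (A1 x ^ 2 + B1 x ^ 2)
      - 1/2 * exp (-x) * (A x ^ 2 + B x ^ 2)
      - μ * (|V1 x| * (A x ^ 2 + B x ^ 2))
      - 2 * C * (exp (-x) * (A x ^ 2 + B x ^ 2) ^ (1 + r))) - ((18 + 12 * C) * X⁻¹) *
        ((A1 x ^ 2 + B1 x ^ 2) + (A x ^ 2 + B x ^ 2))) ≤
      ∫ x in (0:ℝ)..X, (2 * (exp (-x) * (1 - x * X⁻¹) ^ 3 - 3 * X⁻¹ * ((1 - exp (-x)) * (1 - x * X⁻¹) ^ 2)) * (A1 x ^ 2 + B1 x ^ 2) - 1/2 * (exp (-x) * (1 - x * X⁻¹) ^ 3 + 9 * X⁻¹ * (exp (-x) * (1 - x * X⁻¹) ^ 2)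
      + 18 * X⁻¹ ^ 2 * (exp (-x) * (1 - x * X⁻¹)) - 6 * X⁻¹ ^ 3 * (1 - exp (-x))) * (A x ^ 2 + B x ^ 2)
      - μ * ((1 - exp (-x)) * (1 - x * X⁻¹) ^ 3 * V1 x * (A x ^ 2 + B x ^ 2))
      + (exp (-x) * (1 - x * X⁻¹) ^ 3 - 3 * X⁻¹ * ((1 - exp (-x)) * (1 - x * X⁻¹) ^ 2)) * (k (A x ^ 2 + B x ^ 2) * (A x ^ 2 + B x ^ 2) - F (A x ^ 2 + B x ^ 2))) := by
    apply intervalIntegral.integral_mono_on hX0 (ii _ (by fun_prop) _ _) (ii _ (by fun_prop) _ _)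
    intro x hx
    obtain ⟨q0, q1, q3⟩ := nls_cutoff X x hX hx
    have hkx := hk x hx
    have hFx := hFb x hx
    have hfx := hf _ (snn x)
    rw [hkx]
    have i0 : 0 ≤ X⁻¹ := by positivity
    have s0 := snn x
    have sle : (A x ^ 2 + B x ^ 2) ^ (1 + r) ≤ A x ^ 2 + B x ^ 2 := by
      have h1 : A x ^ 2 + B x ^ 2 ≤ 1 := (hs1 x hx.1).trans hε1
      have := rpow_le_rpow_of_exponent_ge' s0 h1 zero_le_one (show 1 ≤ 1 + r by linarith)
      rwa [rpow_one] at this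
    have spow : (A x ^ 2 + B x ^ 2) ^ (1 + r) = (A x ^ 2 + B x ^ 2) ^ r * (A x ^ 2 + B x ^ 2) := by
      rw [rpow_add_of_nonneg s0 (by norm_num) hr.le, rpow_one]; ring
    have n0 : 0 ≤ (A x ^ 2 + B x ^ 2) ^ (1 + r) := rpow_nonneg s0 _
    have P0 : 0 ≤ A1 x ^ 2 + B1 x ^ 2 := by positivity
    have e0 : 0 ≤ exp (-x) := (exp_pos _).le
    have nl : |f (A x ^ 2 + B x ^ 2) * (A x ^ 2 + B x ^ 2) - F (A x ^ 2 + B x ^ 2)| ≤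
        2 * C * (A x ^ 2 + B x ^ 2) ^ (1 + r) := by
      refine (abs_sub _ _).trans ?_
      rw [abs_mul, abs_of_nonneg s0]
      have := mul_le_mul_of_nonneg_right hfx s0
      rw [spow] at hFx ⊢
      linarith
    generalize exp (-x) * (1 - x * X⁻¹) ^ 3 - 3 * X⁻¹ * ((1 - exp (-x)) * (1 - x * X⁻¹) ^ 2) = g1 at *
    generalize exp (-x) * (1 - x * X⁻¹) ^ 3 + 9 * X⁻¹ * (exp (-x) * (1 - x * X⁻¹) ^ 2)
      + 18 * X⁻¹ ^ 2 * (exp (-x) * (1 - x * X⁻¹)) - 6 * X⁻¹ ^ 3 * (1 - exp (-x)) = g3 at *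
    generalize (1 - exp (-x)) * (1 - x * X⁻¹) ^ 3 = g0 at *
    generalize f (A x ^ 2 + B x ^ 2) * (A x ^ 2 + B x ^ 2) - F (A x ^ 2 + B x ^ 2) = n at *
    clear hFx hfx hkx spow
    generalize (A x ^ 2 + B x ^ 2) ^ (1 + r) = N at *
    generalize A x ^ 2 + B x ^ 2 = s at *
    generalize A1 x ^ 2 + B1 x ^ 2 = P at *
    generalize exp (-x) = e at *
    generalize X⁻¹ = i at *
    rw [abs_le] at q1 q3
    have r1 : (e - 6 * i) * P ≤ g1 * P := mul_le_mul_of_nonneg_right (by linarith) P0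
    have r2 : g3 * s ≤ (e + 36 * i) * s := mul_le_mul_of_nonneg_right (by linarith) s0
    have r3 : g0 * V1 x * s ≤ |V1 x| * s := by
      apply mul_le_mul_of_nonneg_right _ s0
      refine (le_abs_self _).trans ?_
      rw [abs_mul]
      exact mul_le_of_le_one_left (abs_nonneg _) q0
    have r4 := mul_le_mul_of_nonneg_left r3 hμ
    have r5 : |g1 * n| ≤ (e + 6 * i) * (2 * C * N) := by
      rw [abs_mul]
      apply mul_le_mul _ nl (abs_nonneg _) (by positivity)
      rw [abs_le]; constructor <;> linarith
    have r6 := neg_abs_le (g1 * n)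
    have r7 : 12 * C * i * N ≤ 12 * C * i * s := mul_le_mul_of_nonneg_left sle (by positivity)
    have r8 : 0 ≤ C * i * P := by positivity
    have r9 : 0 ≤ i * P := by positivity
    linarith
  refine le_trans ?_ cmp
  rw [intervalIntegral.integral_sub (ii _ (by fun_prop) _ _) (ii _ (by fun_prop) _ _),
    intervalIntegral.integral_const_mul]
  have h1 := mul_le_mul_of_nonneg_left ((hE X hX0).trans hε1)
    (show 0 ≤ (18 + 12 * C) * X⁻¹ by positivity)
  have h2 : (4 * C / r + (18 + 12 * C)) / X = 4 * C / r / X + (18 + 12 * C) * X⁻¹ := by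
    rw [add_div, div_eq_mul_inv (18 + 12 * C)]
  rw [h2]
  linarith

/-- Barbalat-type lemma -/
lemma nls_barbalat (h h' : ℝ → ℝ) (L M : ℝ) (hL : 0 < L) (hd : ∀ t, HasDerivAt h (h' t) t)
    (hb : ∀ t, h' t ≤ L) (h0 : ∀ t, 0 ≤ h t) (hM : ∀ T, 0 ≤ T → ∫ t in (0:ℝ)..T, h t ≤ M) :
    Tendsto h atTop (nhds 0) := by
  have ch : Continuous h := continuous_iff_continuousAt.2 fun x => (hd x).continuousAt
  let H : ℝ → ℝ := fun T => ∫ t in (0:ℝ)..T, h t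
  have hH : ∀ t, HasDerivAt H (h t) t := fun t =>
    intervalIntegral.integral_hasDerivAt_right (ch.intervalIntegrable _ _)
      (ch.stronglyMeasurableAtFilter _ _) ch.continuousAt
  have Hmono : Monotone H := monotone_of_hasDerivAt_nonneg hH h0
  have hanti : Antitone fun t => h t ^ 2 - 2 * L * H t := by
    apply antitone_of_hasDerivAt_nonpos (f' := fun t => 2 * h t * h' t - 2 * L * h t)
    · intro t
      refine (((hd t).pow 2).sub ((hH t).const_mul (2 * L))).congr_deriv ?_
      push_cast; ring
    · intro t
      have := mul_le_mul_of_nonneg_left (hb t) (h0 t)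
      simp only [Pi.zero_apply]
      linarith
  have HM : ∀ T, H T ≤ M := fun T => (Hmono (le_max_left T 0)).trans (hM _ (le_max_right T 0))
  obtain ⟨l, hl⟩ : ∃ l, Tendsto H atTop (nhds l) := by
    refine ⟨_, tendsto_atTop_ciSup Hmono ⟨M, ?_⟩⟩
    rintro _ ⟨T, rfl⟩; exact HM T
  have Hl : ∀ T, H T ≤ l := fun T => Hmono.ge_of_tendsto hl T
  rw [Metric.tendsto_atTop]
  intro e he
  -- choose δ
  obtain ⟨δ, δ0, hδ⟩ : ∃ δ > 0, δ ^ 2 + 2 * L * δ < e ^ 2 := by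
    have c : Continuous fun δ : ℝ => δ ^ 2 + 2 * L * δ := by fun_prop
    have ev : ∀ᶠ δ in nhdsWithin (0:ℝ) (Set.Ioi 0), δ ^ 2 + 2 * L * δ < e ^ 2 := by
      apply nhdsWithin_le_nhds
      apply c.continuousAt.eventually_lt continuousAt_const
      simp; positivity
    obtain ⟨δ, h1, h2⟩ := (ev.and self_mem_nhdsWithin).exists
    exact ⟨δ, h2, h1⟩
  obtain ⟨t0, ht0⟩ := (hl.eventually (lt_mem_nhds (show l - δ < l by linarith))).exists
  obtain ⟨t1, ht1, hh1⟩ : ∃ t1, t0 ≤ t1 ∧ h t1 ≤ δ := by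
    by_contra hcon
    push Not at hcon
    have : ∫ t in t0..(t0 + 1), δ ≤ ∫ t in t0..(t0 + 1), h t := by
      apply intervalIntegral.integral_mono_on (by linarith) (by simp) (ch.intervalIntegrable _ _)
      intro t ht; exact (hcon t ht.1).le
    rw [intervalIntegral.integral_const] at this
    have h2 : H t0 + ∫ t in t0..(t0 + 1), h t = H (t0 + 1) :=
      intervalIntegral.integral_add_adjacent_intervals (ch.intervalIntegrable _ _)
        (ch.intervalIntegrable _ _)
    have := Hl (t0 + 1)
    simp at *
    linarith
  refine ⟨t1, fun T hT => ?_⟩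
  have h1 := hanti hT
  simp only at h1
  have h2 := Hl T
  have h3 := Hmono ht1
  have h4 : h t1 ^ 2 ≤ δ ^ 2 := pow_le_pow_left₀ (h0 _) hh1 2
  have h5 : 2 * L * (H T - H t1) ≤ 2 * L * δ :=
    mul_le_mul_of_nonneg_left (by linarith) (by linarith)
  rw [Real.dist_eq, sub_zero, abs_of_nonneg (h0 T)]
  exact lt_of_pow_lt_pow_left₀ 2 he.le (by linarith)

lemma nls_core (a b : ℝ × ℝ → ℝ) (ax at' axt bx bt bxt axx bxx : ℝ × ℝ → ℝ) (V V1 f : ℝ → ℝ)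
    (μ : ℝ) (ca : Continuous a) (cb : Continuous b)
    (cax : Continuous ax) (cbx : Continuous bx) (cat : Continuous at') (cbt : Continuous bt)
    (caxt : Continuous axt) (cbxt : Continuous bxt) (caxx : Continuous axx) (cbxx : Continuous bxx)
    (ha : ∀ t x, HasDerivAt (fun x => a (t, x)) (ax (t, x)) x)
    (hb : ∀ t x, HasDerivAt (fun x => b (t, x)) (bx (t, x)) x)
    (hax : ∀ t x, HasDerivAt (fun x => ax (t, x)) (axx (t, x)) x)
    (hbx : ∀ t x, HasDerivAt (fun x => bx (t, x)) (bxx (t, x)) x)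
    (hatx : ∀ t x, HasDerivAt (fun x => at' (t, x)) (axt (t, x)) x)
    (hbtx : ∀ t x, HasDerivAt (fun x => bt (t, x)) (bxt (t, x)) x)
    (hat : ∀ t x, HasDerivAt (fun t => a (t, x)) (at' (t, x)) t)
    (hbt : ∀ t x, HasDerivAt (fun t => b (t, x)) (bt (t, x)) t)
    (haxt : ∀ t x, HasDerivAt (fun t => ax (t, x)) (axt (t, x)) t)
    (hbxt : ∀ t x, HasDerivAt (fun t => bx (t, x)) (bxt (t, x)) t)
    (hV : ∀ x, HasDerivAt V (V1 x) x) (cV1 : Continuous V1)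
    (a0 : ∀ t, a (t, 0) = 0) (b0 : ∀ t, b (t, 0) = 0)
    (e1 : ∀ t x, bt (t, x) = axx (t, x) - (μ * V x + f (a (t, x) ^ 2 + b (t, x) ^ 2)) * a (t, x))
    (e2 : ∀ t x, at' (t, x) = (μ * V x + f (a (t, x) ^ 2 + b (t, x) ^ 2)) * b (t, x) - bxx (t, x))
    (KV : ℝ) (hKV : ∀ X, 0 ≤ X → ∫ x in (0:ℝ)..X, |V1 x| * exp (2 * x) ≤ KV)
    (r C ε : ℝ) (hr : 0 < r) (hC : 0 ≤ C) (hε1 : ε ^ 2 ≤ 1) (hμ : 0 ≤ μ)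
    (hf : ∀ s, 0 ≤ s → |f s| ≤ C * s ^ r)
    (hE : ∀ t x, 0 ≤ x → ∫ y in (0:ℝ)..x, ((ax (t, y) ^ 2 + bx (t, y) ^ 2)
      + (a (t, y) ^ 2 + b (t, y) ^ 2)) ≤ ε ^ 2)
    (hμV : μ * (5 * KV) ≤ 1 / 2)
    (hεr : 2 * C * (4 * (1 + r) ^ 2 / r ^ 2 * (ε ^ 2) ^ r) ≤ 1 / 2)
    (R : ℝ) (hR : 0 ≤ R) (δ : ℝ) (hδ : 0 < δ) :
    ∀ᶠ t in atTop, ∀ x ∈ Set.Icc 0 R, a (t, x) ^ 2 + b (t, x) ^ 2 ≤ δ := by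
  have ii : ∀ g : ℝ → ℝ, Continuous g → ∀ a b, IntervalIntegrable g volume a b :=
    fun g hg a b => hg.intervalIntegrable a b
  have hE1 : ∀ t x, 0 ≤ x → ∫ y in (0:ℝ)..x, ((ax (t, y) ^ 2 + bx (t, y) ^ 2)
      + (a (t, y) ^ 2 + b (t, y) ^ 2)) ≤ 1 := fun t x hx => (hE t x hx).trans hε1
  obtain ⟨Q, hQ⟩ : ∃ Q, Q = R + 1 := ⟨_, rfl⟩
  have Q0 : 0 < Q := by linarith
  have Q1 : 1 ≤ Q := by linarith
  obtain ⟨h, hh⟩ : ∃ h : ℝ → ℝ, h = fun t => ∫ x in (0:ℝ)..Q,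
    (Q - x) * (a (t, x) ^ 2 + b (t, x) ^ 2) := ⟨_, rfl⟩
  have hhd : ∀ t, HasDerivAt h (∫ x in (0:ℝ)..Q, (Q - x) * (2 * a (t, x) * at' (t, x)
      + 2 * b (t, x) * bt (t, x))) t := by
    intro t
    rw [hh]
    refine nls_param (fun p => (Q - p.2) * (a p ^ 2 + b p ^ 2))
      (fun p => (Q - p.2) * (2 * a p * at' p + 2 * b p * bt p)) (by fun_prop) (by fun_prop) ?_ Q t
    intro t x
    refine ((((hat t x).pow 2).add ((hbt t x).pow 2)).const_mul (Q - x)).congr_deriv ?_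
    push_cast; ring
  have hh' : ∀ t, (∫ x in (0:ℝ)..Q, (Q - x) * (2 * a (t, x) * at' (t, x)
      + 2 * b (t, x) * bt (t, x))) ≤ 1 := by
    intro t
    have h1 : ∀ x, HasDerivAt (fun x => (Q - x) * (2 * (b (t, x) * ax (t, x) - a (t, x) * bx (t, x))))
        ((Q - x) * (2 * a (t, x) * at' (t, x) + 2 * b (t, x) * bt (t, x))
          - 2 * (b (t, x) * ax (t, x) - a (t, x) * bx (t, x))) x := by
      intro x
      refine (((hasDerivAt_id x).const_sub Q).mul ((((hb t x).mul (hax t x)).sub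
        ((ha t x).mul (hbx t x))).const_mul 2)).congr_deriv ?_
      simp only [Pi.mul_apply, Pi.sub_apply, id]
      rw [e1, e2]
      ring
    have h2 := intervalIntegral.integral_eq_sub_of_hasDerivAt (a := 0) (b := Q)
      (fun y _ => h1 y) (ii _ (by fun_prop) _ _)
    rw [intervalIntegral.integral_sub (ii _ (by fun_prop) _ _) (ii _ (by fun_prop) _ _)] at h2
    simp only [a0, b0, sub_self, zero_mul, mul_zero] at h2
    rw [sub_eq_zero] at h2
    rw [h2]
    refine le_trans ?_ (hE1 t Q Q0.le)
    apply intervalIntegral.integral_mono_on Q0.le (ii _ (by fun_prop) _ _) (ii _ (by fun_prop) _ _)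
    intro x _
    nlinarith [sq_nonneg (b (t, x) - ax (t, x)), sq_nonneg (a (t, x) + bx (t, x))]
  have ch : Continuous h := continuous_iff_continuousAt.2 fun x => (hhd x).continuousAt
  have h0 : ∀ t, 0 ≤ h t := by
    intro t; rw [hh]
    apply intervalIntegral.integral_nonneg Q0.le
    intro x hx
    exact mul_nonneg (by linarith [hx.2]) (by positivity)
  obtain ⟨c, hc⟩ : ∃ c, c = 1/4 * (exp (-2 * Q) / Q) := ⟨_, rfl⟩
  have c0 : 0 < c := by rw [hc]; positivity
  have hlow : ∀ t X, Q ≤ X → c * h t ≤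
      (1/4) * (∫ x in (0:ℝ)..X, exp (-2 * x) * (a (t, x) ^ 2 + b (t, x) ^ 2)) := by
    intro t X hX
    rw [hc, hh, mul_assoc]
    apply mul_le_mul_of_nonneg_left _ (by norm_num)
    simp only
    rw [← intervalIntegral.integral_const_mul]
    have s1 : ∫ x in (0:ℝ)..Q, exp (-2 * Q) / Q * ((Q - x) * (a (t, x) ^ 2 + b (t, x) ^ 2)) ≤
        ∫ x in (0:ℝ)..Q, exp (-2 * x) * (a (t, x) ^ 2 + b (t, x) ^ 2) := by
      apply intervalIntegral.integral_mono_on Q0.le (ii _ (by fun_prop) _ _)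
        (ii _ (by fun_prop) _ _)
      intro x hx
      rw [← mul_assoc]
      apply mul_le_mul_of_nonneg_right _ (by positivity)
      calc exp (-2 * Q) / Q * (Q - x) ≤ exp (-2 * Q) / Q * Q :=
            mul_le_mul_of_nonneg_left (by linarith [hx.1]) (by positivity)
        _ = exp (-2 * Q) := by field_simp
        _ ≤ _ := exp_le_exp.2 (by linarith [hx.2])
    refine s1.trans ?_
    rw [← intervalIntegral.integral_add_adjacent_intervals (a := 0) (b := Q) (c := X)
      (ii _ (by fun_prop) _ _) (ii _ (by fun_prop) _ _)]
    have : 0 ≤ ∫ x in Q..X, exp (-2 * x) * (a (t, x) ^ 2 + b (t, x) ^ 2) :=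
      intervalIntegral.integral_nonneg hX fun x _ => by positivity
    linarith
  have hint : ∀ T, 0 ≤ T → ∫ t in (0:ℝ)..T, h t ≤ 3 / c := by
    intro T hT
    obtain ⟨K, hK⟩ : ∃ K, K = 4 * C / r + (18 + 12 * C) := ⟨_, rfl⟩
    have K0 : 0 ≤ K := by rw [hK]; positivity
    obtain ⟨X, hX⟩ : ∃ X, X = Q + K * T := ⟨_, rfl⟩
    have KT : 0 ≤ K * T := mul_nonneg K0 hT
    have QX : Q ≤ X := by linarith
    have X1 : 1 ≤ X := by linarith
    have X0 : 0 ≤ X := by linarith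
    have ib : ∀ x ∈ Set.Icc 0 X, |(1 - exp (-x)) * (1 - x * X⁻¹) ^ 3| ≤ 1 := fun x hx =>
      (nls_cutoff X x X1 hx).1
    obtain ⟨J, hJ⟩ : ∃ J : ℝ → ℝ, J = fun t => ∫ x in (0:ℝ)..X,
      ((1 - exp (-x)) * (1 - x * X⁻¹) ^ 3) * (a (t, x) * bx (t, x) - b (t, x) * ax (t, x)) :=
      ⟨_, rfl⟩
    have hJb : ∀ t, |J t| ≤ 1 := by
      intro t
      have pw : ∀ x ∈ Set.Icc 0 X, |((1 - exp (-x)) * (1 - x * X⁻¹) ^ 3) *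
        (a (t, x) * bx (t, x) - b (t, x) * ax (t, x))| ≤ (ax (t, x) ^ 2 + bx (t, x) ^ 2)
          + (a (t, x) ^ 2 + b (t, x) ^ 2) := by
        intro x hx
        rw [abs_mul]
        refine (mul_le_of_le_one_left (abs_nonneg _) (ib x hx)).trans ?_
        rw [abs_le]
        constructor <;> nlinarith [sq_nonneg (b (t, x) - ax (t, x)), sq_nonneg (a (t, x) + bx (t, x)), sq_nonneg (b (t, x) + ax (t, x)), sq_nonneg (a (t, x) - bx (t, x))]
      rw [hJ]
      refine (intervalIntegral.abs_integral_le_integral_abs X0).trans ?_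
      refine le_trans ?_ (hE1 t X X0)
      exact intervalIntegral.integral_mono_on X0 (ii _ (by fun_prop) _ _) (ii _ (by fun_prop) _ _) pw
    obtain ⟨J', hJ'⟩ : ∃ J' : ℝ → ℝ, J' = fun t => ∫ x in (0:ℝ)..X,
      ((1 - exp (-x)) * (1 - x * X⁻¹) ^ 3) * (at' (t, x) * bx (t, x) + a (t, x) * bxt (t, x)
        - (bt (t, x) * ax (t, x) + b (t, x) * axt (t, x))) := ⟨_, rfl⟩
    have hJd : ∀ t, HasDerivAt J (J' t) t := by
      intro t
      rw [hJ, hJ']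
      refine nls_param (fun p => ((1 - exp (-p.2)) * (1 - p.2 * X⁻¹) ^ 3) * (a p * bx p - b p * ax p))
        (fun p => ((1 - exp (-p.2)) * (1 - p.2 * X⁻¹) ^ 3) * (at' p * bx p + a p * bxt p
          - (bt p * ax p + b p * axt p))) (by fun_prop) (by fun_prop) ?_ X t
      intro t x
      exact (((hat t x).mul (hbxt t x)).sub ((hbt t x).mul (haxt t x))).const_mul ((1 - exp (-x)) * (1 - x * X⁻¹) ^ 3)
    have hJl : ∀ t, c * h t - K / X ≤ J' t := by
      intro t
      have := nls_lower (fun x => a (t, x)) (fun x => b (t, x)) (fun x => ax (t, x))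
        (fun x => bx (t, x)) (fun x => axx (t, x)) (fun x => bxx (t, x)) (fun x => at' (t, x))
        (fun x => bt (t, x)) (fun x => axt (t, x)) (fun x => bxt (t, x)) V V1 f μ X X1
        (ha t) (hb t) (hax t) (hbx t) (hatx t) (hbtx t) hV (by fun_prop) (by fun_prop)
        (by fun_prop) (by fun_prop) cV1 (a0 t) (b0 t) (e1 t) (e2 t) KV (hKV X X0) r C ε hr hC hε1 hμ
        hf (hE t) hμV hεr
      rw [← hK] at this
      have h2 := hlow t X QX
      rw [hJ']
      linarith
    have mono : Monotone fun t => J t - c * (∫ s in (0:ℝ)..t, h s) + K / X * t := by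
      apply monotone_of_hasDerivAt_nonneg (f' := fun t => J' t - c * h t + K / X * 1)
      · intro t
        exact ((hJd t).sub ((intervalIntegral.integral_hasDerivAt_right (ch.intervalIntegrable _ _)
          (ch.stronglyMeasurableAtFilter _ _) ch.continuousAt).const_mul c)).add
          ((hasDerivAt_id t).const_mul (K / X))
      · intro t
        have := hJl t
        simp only [Pi.zero_apply]
        linarith
    have m1 := mono hT
    simp only [intervalIntegral.integral_same, mul_zero, sub_zero, add_zero] at m1
    have k1 : K / X * T ≤ 1 := by
      rw [div_mul_eq_mul_div, div_le_one (by linarith)]; linarith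
    have b1 := abs_le.1 (hJb 0)
    have b2 := abs_le.1 (hJb T)
    rw [le_div_iff₀ c0]
    linarith
  have hlim := nls_barbalat h _ 1 (3 / c) one_pos hhd hh' h0 hint
  have ev := hlim.eventually (gt_mem_nhds (show 0 < (δ/2) ^ 2 by positivity))
  filter_upwards [ev] with t ht x hx
  have s1 := nls_sup (fun x => a (t, x)) (fun x => b (t, x)) (fun x => ax (t, x))
        (fun x => bx (t, x)) (ha t) (hb t) (by fun_prop) (by fun_prop) (a0 t) (b0 t) x (δ/2)
        hx.1 (by linarith)
  have s2 : ∫ y in (0:ℝ)..x, (δ/2 * (ax (t, y) ^ 2 + bx (t, y) ^ 2)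
      + (1/(δ/2)) * (a (t, y) ^ 2 + b (t, y) ^ 2)) ≤
      δ/2 * (∫ y in (0:ℝ)..x, ((ax (t, y) ^ 2 + bx (t, y) ^ 2)
      + (a (t, y) ^ 2 + b (t, y) ^ 2))) + (1/(δ/2)) * ∫ y in (0:ℝ)..x,
        ((Q - y) * (a (t, y) ^ 2 + b (t, y) ^ 2)) := by
    rw [← intervalIntegral.integral_const_mul, ← intervalIntegral.integral_const_mul,
      ← intervalIntegral.integral_add (ii _ (by fun_prop) _ _) (ii _ (by fun_prop) _ _)]
    apply intervalIntegral.integral_mono_on hx.1 (ii _ (by fun_prop) _ _) (ii _ (by fun_prop) _ _)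
    intro y hy
    have q : 1 ≤ Q - y := by linarith [hy.2, hx.2]
    have p1 : a (t, y) ^ 2 + b (t, y) ^ 2 ≤ (Q - y) * (a (t, y) ^ 2 + b (t, y) ^ 2) :=
      le_mul_of_one_le_left (by positivity) q
    have p2 := mul_le_mul_of_nonneg_left p1 (show 0 ≤ 1 / (δ/2) by positivity)
    have p3 : 0 ≤ δ / 2 * (a (t, y) ^ 2 + b (t, y) ^ 2) := by positivity
    linarith
  have s3 : ∫ y in (0:ℝ)..x, ((Q - y) * (a (t, y) ^ 2 + b (t, y) ^ 2)) ≤ h t := by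
    rw [hh]
    simp only
    rw [← intervalIntegral.integral_add_adjacent_intervals (a := 0) (b := x) (c := Q)
      (ii _ (by fun_prop) _ _) (ii _ (by fun_prop) _ _)]
    have : 0 ≤ ∫ y in x..Q, ((Q - y) * (a (t, y) ^ 2 + b (t, y) ^ 2)) :=
      intervalIntegral.integral_nonneg (by linarith [hx.2]) fun y hy =>
        mul_nonneg (by linarith [hy.2]) (by positivity)
    linarith
  have s4 := mul_le_mul_of_nonneg_left (hE1 t x hx.1) (show 0 ≤ δ / 2 by linarith)
  have s5 : (1/(δ/2)) * ∫ y in (0:ℝ)..x, ((Q - y) * (a (t, y) ^ 2 + b (t, y) ^ 2)) ≤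
      (1/(δ/2)) * (δ/2) ^ 2 := mul_le_mul_of_nonneg_left (s3.trans ht.le) (by positivity)
  have s6 : (1/(δ/2)) * (δ/2) ^ 2 = δ / 2 := by field_simp
  linarith

/-- Theorem 1.3 (NLS with potential): decay of small odd solutions on compact sets. -/
theorem decay_small_odd_NLS_potential
    (p C : ℝ) (hp1 : 1 < p) (hp5 : p < 5)
    (f : ℝ → ℝ) (hf : ∀ s : ℝ, 0 ≤ s → |f s| ≤ C * s ^ ((p - 1) / 2))
    (V : SchwartzMap ℝ ℝ) (hV0 : (V : ℝ → ℝ) ≠ 0)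
    (hVeven : ∀ x : ℝ, V (-x) = V x)
    (hVint : Integrable (fun x : ℝ => (|V x| + |deriv (V : ℝ → ℝ) x|) * Real.cosh (2 * x))) :
    ∃ μ₀ > 0, ∃ ε > 0, ∀ μ : ℝ, μ ∈ Set.Ioo 0 μ₀ → ∀ u : ℝ → ℝ → ℂ,
      ContDiff ℝ (⊤ : ℕ∞) (Function.uncurry u) →
      (∀ t x : ℝ, Complex.I * deriv (fun s => u s x) t + deriv (deriv (u t)) x
          = ((μ * V x : ℝ) : ℂ) * u t x + (f (‖u t x‖ ^ 2) : ℂ) * u t x) →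
      (∀ t x : ℝ, u t (-x) = - u t x) →
      (∀ t : ℝ, ∃ g : SchwartzMap ℝ ℂ, ∀ x : ℝ, u t x = g x) →
      (∀ t : ℝ, (∫ x : ℝ, ‖u t x‖ ^ 2) + (∫ x : ℝ, ‖deriv (u t) x‖ ^ 2) ≤ ε ^ 2) →
      ∀ I : Set ℝ, I.OrdConnected → Bornology.IsBounded I →
        Tendsto (fun t : ℝ =>
            Real.sqrt (∫ x in I, ‖u t x‖ ^ 2) + (⨆ x ∈ I, ‖u t x‖))
          atTop (nhds 0) := by
  obtain ⟨r, hr⟩ : ∃ r, r = (p - 1) / 2 := ⟨_, rfl⟩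
  rw [← hr] at hf
  have r0 : 0 < r := by rw [hr]; linarith
  have C0 : 0 ≤ C := by
    have := hf 1 zero_le_one
    rw [one_rpow, mul_one] at this
    exact (abs_nonneg _).trans this
  obtain ⟨KV, hKV⟩ : ∃ KV, KV = 2 * ∫ x : ℝ, (|V x| + |deriv (V : ℝ → ℝ) x|) * Real.cosh (2 * x) :=
    ⟨_, rfl⟩
  have inn : ∀ x : ℝ, 0 ≤ (|V x| + |deriv (V : ℝ → ℝ) x|) * Real.cosh (2 * x) := fun x =>
    mul_nonneg (by positivity) (cosh_pos _).le
  have KV0 : 0 ≤ KV := by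
    rw [hKV]; exact mul_nonneg (by norm_num) (integral_nonneg inn)
  have hVd : ∀ x, HasDerivAt (V : ℝ → ℝ) (deriv (V : ℝ → ℝ) x) x := fun x =>
    V.differentiable.differentiableAt.hasDerivAt
  have cV1 : Continuous (deriv (V : ℝ → ℝ)) := (V.smooth 1).continuous_deriv le_rfl
  have hKVX : ∀ X, 0 ≤ X → ∫ x in (0:ℝ)..X, |deriv (V : ℝ → ℝ) x| * exp (2 * x) ≤ KV := by
    intro X hX
    rw [hKV, ← integral_const_mul, intervalIntegral.integral_of_le hX]
    refine le_trans ?_ (setIntegral_le_integral (s := Set.Ioc 0 X) (hVint.const_mul 2)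
      (Eventually.of_forall fun x => mul_nonneg (by norm_num) (inn x)))
    apply setIntegral_mono
    · exact (Continuous.integrableOn_Icc (by fun_prop)).mono_set Set.Ioc_subset_Icc_self
    · exact (hVint.const_mul 2).integrableOn
    · intro x
      have h1 : exp (2 * x) ≤ 2 * cosh (2 * x) := by
        rw [cosh_eq]; have := exp_pos (-(2 * x)); linarith
      have h2 := abs_nonneg (V x)
      have h3 := cosh_pos (2 * x)
      have h4 := mul_le_mul_of_nonneg_left h1 (abs_nonneg (deriv (V : ℝ → ℝ) x))
      have h5 := mul_nonneg h2 h3.le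
      simp only
      linarith
  obtain ⟨ε, ε0, ε1, hεr⟩ : ∃ ε > 0, ε ^ 2 < 1 ∧
      2 * C * (4 * (1 + r) ^ 2 / r ^ 2 * (ε ^ 2) ^ r) < 1 / 2 := by
    have c1 : Continuous fun ε : ℝ => ε ^ 2 := by fun_prop
    have c2 : Continuous fun ε : ℝ => 2 * C * (4 * (1 + r) ^ 2 / r ^ 2 * (ε ^ 2) ^ r) := by
      have := c1.rpow_const (p := r) fun _ => Or.inr r0.le
      fun_prop
    have v1 : ∀ᶠ ε in nhdsWithin (0:ℝ) (Set.Ioi 0), ε ^ 2 < 1 := by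
      apply nhdsWithin_le_nhds
      apply c1.continuousAt.eventually_lt continuousAt_const
      norm_num
    have v2 : ∀ᶠ ε in nhdsWithin (0:ℝ) (Set.Ioi 0),
        2 * C * (4 * (1 + r) ^ 2 / r ^ 2 * (ε ^ 2) ^ r) < 1 / 2 := by
      apply nhdsWithin_le_nhds
      apply c2.continuousAt.eventually_lt continuousAt_const
      simp [zero_rpow r0.ne']
    obtain ⟨ε, ⟨h1, h2⟩, h3⟩ := ((v1.and v2).and self_mem_nhdsWithin).exists
    exact ⟨ε, h3, h1, h2⟩
  refine ⟨1 / (10 * (KV + 1)), by positivity, ε, ε0, ?_⟩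
  intro μ hμ u hu heq hodd hsch hen I _ hI
  have hμV : μ * (5 * KV) ≤ 1 / 2 := by
    have := hμ.2.le
    rw [le_div_iff₀ (by positivity)] at this
    have := hμ.1
    linarith
  have sa : ContDiff ℝ (⊤ : ℕ∞) (fun p : ℝ × ℝ => (u p.1 p.2).re) :=
    Complex.reCLM.contDiff.comp hu
  have sb : ContDiff ℝ (⊤ : ℕ∞) (fun p : ℝ × ℝ => (u p.1 p.2).im) :=
    Complex.imCLM.contDiff.comp hu
  obtain ⟨a, haa⟩ : ∃ a : ℝ × ℝ → ℝ, a = fun p : ℝ × ℝ => (u p.1 p.2).re := ⟨_, rfl⟩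
  obtain ⟨b, hbb⟩ : ∃ b : ℝ × ℝ → ℝ, b = fun p : ℝ × ℝ => (u p.1 p.2).im := ⟨_, rfl⟩
  rw [← haa] at sa
  rw [← hbb] at sb
  obtain ⟨ax, at', axt, sax, cat, caxt, ha, hat, haxt, hatx⟩ := nls_partials a sa
  obtain ⟨bx, bt, bxt, sbx, cbt, cbxt, hb, hbt, hbxt, hbtx⟩ := nls_partials b sb
  obtain ⟨axx, _, _, saxx, _, _, hax, _⟩ := nls_partials ax sax
  obtain ⟨bxx, _, _, sbxx, _, _, hbx, _⟩ := nls_partials bx sbx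
  have ca := sa.continuous
  have cb := sb.continuous
  have cax := sax.continuous
  have cbx := sbx.continuous
  have comb : ∀ (g k : ℝ → ℝ) (g' k' : ℝ) (y : ℝ), HasDerivAt g g' y → HasDerivAt k k' y →
      HasDerivAt (fun y => (g y : ℂ) + (k y : ℂ) * Complex.I) ((g' : ℂ) + (k' : ℂ) * Complex.I) y :=
    fun g k g' k' y h1 h2 => h1.ofReal_comp.add (h2.ofReal_comp.mul_const _)
  have uab : ∀ t x, u t x = (a (t, x) : ℂ) + (b (t, x) : ℂ) * Complex.I := by
    intro t x; rw [haa, hbb]; exact (Complex.re_add_im _).symm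
  have dux : ∀ t, deriv (u t) = fun x => (ax (t, x) : ℂ) + (bx (t, x) : ℂ) * Complex.I := by
    intro t; ext x
    have := comb _ _ _ _ x (ha t x) (hb t x)
    rw [← this.deriv]
    congr 1; ext y; exact uab t y
  have duxx : ∀ t x, deriv (deriv (u t)) x = (axx (t, x) : ℂ) + (bxx (t, x) : ℂ) * Complex.I := by
    intro t x
    rw [dux]
    exact (comb _ _ _ _ x (hax t x) (hbx t x)).deriv
  have dut : ∀ t x, deriv (fun s => u s x) t = (at' (t, x) : ℂ) + (bt (t, x) : ℂ) * Complex.I := by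
    intro t x
    have := comb _ _ _ _ t (hat t x) (hbt t x)
    rw [← this.deriv]
    congr 1; ext y; exact uab y x
  have nrm : ∀ g k : ℝ, ‖(g : ℂ) + (k : ℂ) * Complex.I‖ ^ 2 = g ^ 2 + k ^ 2 := by
    intro g k
    rw [Complex.sq_norm, Complex.normSq_add_mul_I]
  have eqn : ∀ t x, (- bt (t, x) + axx (t, x) = (μ * V x + f (a (t, x) ^ 2 + b (t, x) ^ 2)) * a (t, x))
      ∧ (at' (t, x) + bxx (t, x) = (μ * V x + f (a (t, x) ^ 2 + b (t, x) ^ 2)) * b (t, x)) := by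
    intro t x
    have h := heq t x
    rw [dut, duxx, uab, nrm] at h
    have h1 := congrArg Complex.re h
    have h2 := congrArg Complex.im h
    simp at h1 h2
    constructor <;> linarith
  have u0 : ∀ t, u t 0 = 0 := by
    intro t
    have := hodd t 0
    rw [neg_zero] at this
    exact self_eq_neg.1 this
  have hE : ∀ t x, 0 ≤ x → ∫ y in (0:ℝ)..x, ((ax (t, y) ^ 2 + bx (t, y) ^ 2)
      + (a (t, y) ^ 2 + b (t, y) ^ 2)) ≤ ε ^ 2 := by
    intro t x hx
    obtain ⟨g, hg⟩ := hsch t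
    have hgu : u t = g := funext hg
    have i1 : Integrable fun x => ‖u t x‖ ^ 2 := by
      have := (g.memLp 2 (volume : Measure ℝ)).integrable_norm_pow (by norm_num)
      rw [hgu]; simpa using this
    have i2 : Integrable fun x => ‖deriv (u t) x‖ ^ 2 := by
      have := ((SchwartzMap.derivCLM ℝ ℂ g).memLp 2 (volume : Measure ℝ)).integrable_norm_pow
        (by norm_num)
      rw [hgu]; simpa using this
    refine le_trans ?_ (hen t)
    rw [← integral_add i1 i2, intervalIntegral.integral_of_le hx]
    refine le_of_eq_of_le ?_ (setIntegral_le_integral (s := Set.Ioc 0 x) (i1.add i2)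
      (Eventually.of_forall fun x => by simp only [Pi.zero_apply, Pi.add_apply]; positivity))
    congr 1
    ext y
    rw [dux, uab, nrm, nrm]
    ring
  obtain ⟨R, R0, hR⟩ : ∃ R, 0 ≤ R ∧ ∀ x ∈ I, |x| ≤ R := by
    obtain ⟨R, hR⟩ := hI.exists_norm_le
    exact ⟨max R 0, le_max_right _ _, fun x hx => (hR x hx).trans (le_max_left _ _)⟩
  have core := nls_core a b ax at' axt bx bt bxt axx bxx V (deriv V) f μ ca cb cax cbx cat cbt caxt cbxt
    saxx.continuous sbxx.continuous ha hb hax hbx hatx hbtx hat hbt haxt hbxt hVd cV1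
    (fun t => by rw [haa]; simp [u0]) (fun t => by rw [hbb]; simp [u0])
    (fun t x => by linarith [(eqn t x).1]) (fun t x => by linarith [(eqn t x).2])
    KV hKVX r C ε r0 C0 ε1.le hμ.1.le hf hE hμV hεr.le R R0
  have vI : volume I < ⊤ := hI.measure_lt_top
  rw [Metric.tendsto_atTop']
  intro e he
  obtain ⟨δ, hδ⟩ : ∃ δ, δ = e / (2 * (Real.sqrt (volume.real I) + 1)) := ⟨_, rfl⟩
  have δ0 : 0 < δ := by rw [hδ]; positivity
  have ev := core (δ ^ 2) (by positivity)
  obtain ⟨T, hT⟩ := eventually_atTop.1 ev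
  refine ⟨T, fun t ht => ?_⟩
  have ptw : ∀ x ∈ I, ‖u t x‖ ≤ δ := by
    intro x hx
    have h1 : ‖u t x‖ = ‖u t |x|‖ := by
      rcases abs_cases x with h | h
      · rw [h.1]
      · rw [h.1, hodd, norm_neg]
    rw [h1]
    have h2 := hT t ht.le |x| ⟨abs_nonneg _, hR x hx⟩
    rw [← nrm, ← uab] at h2
    exact le_of_sq_le_sq h2 δ0.le
  have sup : (⨆ x ∈ I, ‖u t x‖) ≤ δ :=
    Real.iSup_le (fun x => Real.iSup_le (fun hx => ptw x hx) δ0.le) δ0.le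
  have sup0 : 0 ≤ (⨆ x ∈ I, ‖u t x‖) :=
    Real.iSup_nonneg fun x => Real.iSup_nonneg fun hx => norm_nonneg _
  have l2 : (∫ x in I, ‖u t x‖ ^ 2) ≤ δ ^ 2 * volume.real I := by
    refine (le_abs_self _).trans ?_
    have := norm_setIntegral_le_of_norm_le_const (μ := volume) (s := I) (f := fun x => ‖u t x‖ ^ 2)
      (C := δ ^ 2) vI (by
        intro x hx
        rw [norm_pow, norm_norm]
        exact pow_le_pow_left₀ (norm_nonneg _) (ptw x hx) 2)
    exact this
  have l3 : Real.sqrt (∫ x in I, ‖u t x‖ ^ 2) ≤ δ * Real.sqrt (volume.real I) := by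
    refine (Real.sqrt_le_sqrt l2).trans ?_
    rw [Real.sqrt_mul (by positivity), Real.sqrt_sq δ0.le]
  have l4 := Real.sqrt_nonneg (∫ x in I, ‖u t x‖ ^ 2)
  rw [Real.dist_eq, sub_zero, abs_of_nonneg (by linarith)]
  have l5 : δ * (Real.sqrt (volume.real I) + 1) = e / 2 := by
    rw [hδ]; field_simp
  linarith
end

section
/- Let 0 < a < 1. If u : ℝ × ℝ → ℂ is a global solution of the defocusing Hartree equation i∂ₜu + ∂ₓₓu = (|x|^{-a} ∗ |u|²)u which is smooth, odd in x (u(t,-x) = -u(t,x) for all t), with u(t,·) in the Schwartz class in x for each t and sup_{t∈ℝ} (‖u(t,·)‖_{L²(ℝ)}² + ‖∂ₓu(t,·)‖_{L²(ℝ)}²) < ∞, then for every bounded interval I ⊂ ℝ one has lim_{t→∞} ( ‖u(t,·)‖_{L²(I)} + sup_{x∈I}|u(t,x)| ) = 0. No smallness of the solution is required. -/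
open MeasureTheory Real Filter


/-- A jointly smooth real field with named partial derivatives. -/
structure Fld (f ft fx fxx fxt : ℝ → ℝ → ℝ) : Prop where
  c : Continuous (Function.uncurry f)
  ct : Continuous (Function.uncurry ft)
  cx : Continuous (Function.uncurry fx)
  cxx : Continuous (Function.uncurry fxx)
  cxt : Continuous (Function.uncurry fxt)
  dt : ∀ t x, HasDerivAt (fun s => f s x) (ft t x) t
  dx : ∀ t x, HasDerivAt (f t) (fx t x) x
  dxx : ∀ t x, HasDerivAt (fx t) (fxx t x) x
  dxt : ∀ t x, HasDerivAt (fun s => fx s x) (fxt t x) t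
  dtx : ∀ t x, HasDerivAt (ft t) (fxt t x) x

/-- Real and imaginary parts of the solution, with all the facts we use. -/
structure Sol (a M : ℝ) where
  v : ℝ → ℝ → ℝ
  vt : ℝ → ℝ → ℝ
  vx : ℝ → ℝ → ℝ
  vxx : ℝ → ℝ → ℝ
  vxt : ℝ → ℝ → ℝ
  w : ℝ → ℝ → ℝ
  wt : ℝ → ℝ → ℝ
  wx : ℝ → ℝ → ℝ
  wxx : ℝ → ℝ → ℝ
  wxt : ℝ → ℝ → ℝ
  fv : Fld v vt vx vxx vxt
  fw : Fld w wt wx wxx wxt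
  V : ℝ → ℝ → ℝ
  hV : ∀ t x, V t x = ∫ y, |x - y| ^ (-a) * (v t y ^ 2 + w t y ^ 2)
  pde1 : ∀ t x, - wt t x + vxx t x = V t x * v t x
  pde2 : ∀ t x, vt t x + wxx t x = V t x * w t x
  ov : ∀ t x, v t (-x) = - v t x
  ow : ∀ t x, w t (-x) = - w t x
  decay : ∀ t, ∃ C : ℝ, 0 ≤ C ∧ ∀ x, |v t x| ≤ C * (1 + x ^ 2)⁻¹ ∧ |w t x| ≤ C * (1 + x ^ 2)⁻¹ ∧
    |vx t x| ≤ C * (1 + x ^ 2)⁻¹ ∧ |wx t x| ≤ C * (1 + x ^ 2)⁻¹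
  bound : ∀ t, (∫ x, (v t x ^ 2 + w t x ^ 2)) + (∫ x, (vx t x ^ 2 + wx t x ^ 2)) ≤ M

/-- Compactly supported weight with two derivatives. -/
structure Wt (ψ ψ1 ψ2 : ℝ → ℝ) (L : ℝ) : Prop where
  d1 : ∀ x, HasDerivAt ψ (ψ1 x) x
  d2 : ∀ x, HasDerivAt ψ1 (ψ2 x) x
  c2 : Continuous ψ2
  z : ∀ x, L < |x| → ψ x = 0
  z1 : ∀ x, L < |x| → ψ1 x = 0
  z2 : ∀ x, L < |x| → ψ2 x = 0

theorem Wt.c0 {ψ ψ1 ψ2 : ℝ → ℝ} {L : ℝ} (h : Wt ψ ψ1 ψ2 L) : Continuous ψ :=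
  continuous_iff_continuousAt.2 fun x => (h.d1 x).continuousAt
theorem Wt.c1 {ψ ψ1 ψ2 : ℝ → ℝ} {L : ℝ} (h : Wt ψ ψ1 ψ2 L) : Continuous ψ1 :=
  continuous_iff_continuousAt.2 fun x => (h.d2 x).continuousAt

theorem cpt_integrable {f : ℝ → ℝ} {L : ℝ} (hf : Continuous f) (hz : ∀ x, L < |x| → f x = 0) :
    Integrable f := by
  apply hf.integrable_of_hasCompactSupport
  refine HasCompactSupport.intro (isCompact_Icc (a := -L) (b := L)) fun x hx => hz x ?_
  by_contra h
  exact hx (by rw [not_lt] at h; exact abs_le.1 h)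

theorem cpt_integral_eq {f : ℝ → ℝ} {L : ℝ} (hL : 0 ≤ L) (hz : ∀ x, L < |x| → f x = 0) :
    ∫ x, f x = ∫ x in (-L - 1)..L, f x := by
  rw [intervalIntegral.integral_of_le (by linarith)]
  symm
  apply setIntegral_eq_integral_of_forall_compl_eq_zero
  intro x hx
  apply hz
  by_contra h
  rw [not_lt] at h
  have := abs_le.1 h
  exact hx ⟨by linarith, this.2⟩

theorem param_cont {G : ℝ → ℝ → ℝ} {L : ℝ} (hL : 0 ≤ L) (hG : Continuous (Function.uncurry G))
    (hz : ∀ t x, L < |x| → G t x = 0) : Continuous fun t => ∫ x, G t x := by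
  have : (fun t => ∫ x, G t x) = fun t => ∫ x in (-L - 1)..L, G t x :=
    funext fun t => cpt_integral_eq hL (hz t)
  rw [this]
  exact intervalIntegral.continuous_parametric_intervalIntegral_of_continuous' hG _ _

theorem param_deriv {G G' : ℝ → ℝ → ℝ} {L : ℝ} (hL : 0 ≤ L) (hG : Continuous (Function.uncurry G))
    (hG' : Continuous (Function.uncurry G'))
    (hz : ∀ t x, L < |x| → G t x = 0) (hz' : ∀ t x, L < |x| → G' t x = 0)
    (hd : ∀ t x, HasDerivAt (fun s => G s x) (G' t x) t) (t : ℝ) :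
    HasDerivAt (fun t => ∫ x, G t x) (∫ x, G' t x) t := by
  have e1 : (fun t => ∫ x, G t x) = fun t => ∫ x in (-L - 1)..L, G t x :=
    funext fun t => cpt_integral_eq hL (hz t)
  rw [e1, cpt_integral_eq hL (hz' t)]
  have hc : ∀ s, Continuous (G s) := fun s => hG.comp (Continuous.prodMk_right s)
  have hc' : ∀ s, Continuous (G' s) := fun s => hG'.comp (Continuous.prodMk_right s)
  obtain ⟨B, hB⟩ := ((isCompact_Icc (a := t - 1) (b := t + 1)).prod
    (isCompact_Icc (a := -L - 1) (b := L))).exists_bound_of_continuousOn hG'.continuousOn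
  refine (intervalIntegral.hasDerivAt_integral_of_dominated_loc_of_deriv_le (F := G) (F' := G')
    (bound := fun _ => B) (s := Set.Icc (t - 1) (t + 1))
    (Icc_mem_nhds (by linarith) (by linarith)) ?_ ?_ ?_ ?_ ?_ ?_).2
  · exact Eventually.of_forall fun s => (hc s).aestronglyMeasurable
  · exact (hc t).intervalIntegrable _ _
  · exact (hc' t).aestronglyMeasurable
  · refine Eventually.of_forall fun x hx s hs => hB (s, x) ⟨hs, ?_⟩
    rw [Set.uIoc_of_le (by linarith)] at hx
    exact Set.Ioc_subset_Icc_self hx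
  · exact intervalIntegrable_const
  · exact Eventually.of_forall fun x _ s _ => hd s x

namespace Sol
variable {a M : ℝ} (S : Sol a M)

/-- density -/
def rho (t x : ℝ) : ℝ := S.v t x ^ 2 + S.w t x ^ 2
/-- gradient density -/
def dd (t x : ℝ) : ℝ := S.vx t x ^ 2 + S.wx t x ^ 2
/-- half of the derivative of the density -/
def rr (t x : ℝ) : ℝ := S.v t x * S.vx t x + S.w t x * S.wx t x
/-- momentum density -/
def pp (t x : ℝ) : ℝ := S.v t x * S.wx t x - S.w t x * S.vx t x
/-- virial integrand -/
def Q (ψ ψ1 ψ2 : ℝ → ℝ) (t x : ℝ) : ℝ :=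
  2 * ψ1 x * S.dd t x + ψ2 x * S.rr t x + S.V t x * (ψ1 x * S.rho t x + 2 * ψ x * S.rr t x)

theorem rho_nonneg (t x : ℝ) : 0 ≤ S.rho t x := by unfold rho; positivity
theorem dd_nonneg (t x : ℝ) : 0 ≤ S.dd t x := by unfold dd; positivity
theorem rr_le (t x : ℝ) : |S.rr t x| ≤ (S.rho t x + S.dd t x) / 2 := by
  unfold rr rho dd
  rw [abs_le]
  constructor
  · nlinarith [sq_nonneg (S.v t x + S.vx t x), sq_nonneg (S.w t x + S.wx t x)]
  · nlinarith [sq_nonneg (S.v t x - S.vx t x), sq_nonneg (S.w t x - S.wx t x)]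
theorem pp_le (t x : ℝ) : |S.pp t x| ≤ (S.rho t x + S.dd t x) / 2 := by
  unfold pp rho dd
  rw [abs_le]
  constructor
  · nlinarith [sq_nonneg (S.v t x + S.wx t x), sq_nonneg (S.w t x - S.vx t x)]
  · nlinarith [sq_nonneg (S.v t x - S.wx t x), sq_nonneg (S.w t x + S.vx t x)]

theorem rho_deriv (t x : ℝ) : HasDerivAt (S.rho t) (2 * S.rr t x) x := by
  have := ((S.fv.dx t x).pow 2).add ((S.fw.dx t x).pow 2)
  refine this.congr_deriv ?_
  unfold rr; push_cast; ring

theorem momentum {ψ ψ1 ψ2 : ℝ → ℝ} {L : ℝ} (hL : 0 ≤ L) (h : Wt ψ ψ1 ψ2 L) :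
    (∀ t, HasDerivAt (fun t => ∫ x, ψ x * S.pp t x) (∫ x, S.Q ψ ψ1 ψ2 t x) t) ∧
    Continuous (fun t => ∫ x, S.Q ψ ψ1 ψ2 t x) ∧ (∀ t, Continuous (S.Q ψ ψ1 ψ2 t)) := by
  have c0 := h.c0
  have c1 := h.c1
  have c2 := h.c2
  have k1 := S.fv.c; have k2 := S.fv.ct; have k3 := S.fv.cx; have k4 := S.fv.cxx; have k5 := S.fv.cxt
  have l1 := S.fw.c; have l2 := S.fw.ct; have l3 := S.fw.cx; have l4 := S.fw.cxx; have l5 := S.fw.cxt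
  simp only [Function.uncurry_def] at k1 k2 k3 k4 k5 l1 l2 l3 l4 l5
  let G' : ℝ → ℝ → ℝ := fun t x => ψ x * (S.vt t x * S.wx t x + S.v t x * S.wxt t x
    - (S.wt t x * S.vx t x + S.w t x * S.vxt t x))
  let F : ℝ → ℝ → ℝ := fun t x => ψ x * (S.v t x * S.wt t x - S.w t x * S.vt t x)
    - ψ x * (S.vx t x * S.vx t x + S.wx t x * S.wx t x)
    - ψ1 x * (S.v t x * S.vx t x + S.w t x * S.wx t x)
  let F' : ℝ → ℝ → ℝ := fun t x => (ψ1 x * (S.v t x * S.wt t x - S.w t x * S.vt t x) +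
    ψ x * ((S.vx t x * S.wt t x + S.v t x * S.wxt t x) - (S.wx t x * S.vt t x + S.w t x * S.vxt t x)))
    - (ψ1 x * (S.vx t x * S.vx t x + S.wx t x * S.wx t x) +
    ψ x * ((S.vxx t x * S.vx t x + S.vx t x * S.vxx t x) + (S.wxx t x * S.wx t x + S.wx t x * S.wxx t x)))
    - (ψ2 x * (S.v t x * S.vx t x + S.w t x * S.wx t x) +
    ψ1 x * ((S.vx t x * S.vx t x + S.v t x * S.vxx t x) + (S.wx t x * S.wx t x + S.w t x * S.wxx t x)))
  have cG' : Continuous (Function.uncurry G') := by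
    simp only [Function.uncurry_def, G']; fun_prop
  have cF' : Continuous (Function.uncurry F') := by
    simp only [Function.uncurry_def, F']; fun_prop
  have cF : Continuous (Function.uncurry F) := by
    simp only [Function.uncurry_def, F]; fun_prop
  have cG : Continuous (Function.uncurry fun t x => ψ x * S.pp t x) := by
    simp only [Function.uncurry_def, pp]; fun_prop
  have dF : ∀ t x, HasDerivAt (F t) (F' t x) x := by
    intro t x
    exact (((h.d1 x).mul (((S.fv.dx t x).mul (S.fw.dtx t x)).sub ((S.fw.dx t x).mul (S.fv.dtx t x)))).sub
      ((h.d1 x).mul (((S.fv.dxx t x).mul (S.fv.dxx t x)).add ((S.fw.dxx t x).mul (S.fw.dxx t x))))).sub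
      ((h.d2 x).mul (((S.fv.dx t x).mul (S.fv.dxx t x)).add ((S.fw.dx t x).mul (S.fw.dxx t x))))
  have dG : ∀ t x, HasDerivAt (fun s => ψ x * S.pp s x) (G' t x) t := by
    intro t x
    exact (((S.fv.dt t x).mul (S.fw.dxt t x)).sub ((S.fw.dt t x).mul (S.fv.dxt t x))).const_mul (ψ x)
  have zG' : ∀ t x, L < |x| → G' t x = 0 := fun t x hx => by simp [G', h.z x hx]
  have zF : ∀ t x, L < |x| → F t x = 0 := fun t x hx => by simp [F, h.z x hx, h.z1 x hx]
  have zF' : ∀ t x, L < |x| → F' t x = 0 := fun t x hx => by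
    simp [F', h.z x hx, h.z1 x hx, h.z2 x hx]
  have hQ : ∀ t x, S.Q ψ ψ1 ψ2 t x = G' t x - F' t x := by
    intro t x
    have e1 : S.wt t x = S.vxx t x - S.V t x * S.v t x := by linarith [S.pde1 t x]
    have e2 : S.vt t x = S.V t x * S.w t x - S.wxx t x := by linarith [S.pde2 t x]
    simp only [Q, G', F', rho, dd, rr, e1, e2]
    ring
  have cQ : Continuous (Function.uncurry (S.Q ψ ψ1 ψ2)) := by
    have : Function.uncurry (S.Q ψ ψ1 ψ2) = fun p => Function.uncurry G' p - Function.uncurry F' p := by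
      ext ⟨t, x⟩; exact hQ t x
    rw [this]; exact cG'.sub cF'
  have sl : ∀ {H : ℝ → ℝ → ℝ}, Continuous (Function.uncurry H) → ∀ t, Continuous (H t) :=
    fun hH t => hH.comp (Continuous.prodMk_right t)
  refine ⟨fun t => ?_, ?_, sl cQ⟩
  · have := param_deriv hL cG cG' (fun t x hx => by simp [h.z x hx]) zG' dG t
    refine this.congr_deriv ?_
    have z : ∫ x, F' t x = 0 := integral_eq_zero_of_hasDerivAt_of_integrable (dF t)
      (cpt_integrable (sl cF' t) (zF' t)) (cpt_integrable (sl cF t) (zF t))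
    calc ∫ x, G' t x = (∫ x, G' t x) - ∫ x, F' t x := by rw [z, sub_zero]
      _ = ∫ x, (G' t x - F' t x) := (integral_sub (cpt_integrable (sl cG' t) (zG' t))
          (cpt_integrable (sl cF' t) (zF' t))).symm
      _ = _ := by simp only [hQ]
  · exact param_cont hL cQ fun t x hx => by rw [hQ, zG' t x hx, zF' t x hx, sub_zero]

theorem mass {ψ ψ1 ψ2 : ℝ → ℝ} {L : ℝ} (hL : 0 ≤ L) (h : Wt ψ ψ1 ψ2 L) :
    (∀ t, HasDerivAt (fun t => ∫ x, ψ x * S.rho t x) (∫ x, 2 * ψ1 x * S.pp t x) t) ∧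
    Continuous (fun t => ∫ x, 2 * ψ1 x * S.pp t x) := by
  have c0 := h.c0
  have c1 := h.c1
  have k1 := S.fv.c; have k2 := S.fv.ct; have k3 := S.fv.cx; have k4 := S.fv.cxx; have k5 := S.fv.cxt
  have l1 := S.fw.c; have l2 := S.fw.ct; have l3 := S.fw.cx; have l4 := S.fw.cxx; have l5 := S.fw.cxt
  simp only [Function.uncurry_def] at k1 k2 k3 k4 k5 l1 l2 l3 l4 l5
  let G' : ℝ → ℝ → ℝ := fun t x => ψ x * ((S.vt t x * S.v t x + S.v t x * S.vt t x)
    + (S.wt t x * S.w t x + S.w t x * S.wt t x))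
  let F : ℝ → ℝ → ℝ := fun t x => ψ x * (S.v t x * S.wx t x - S.w t x * S.vx t x)
  let F' : ℝ → ℝ → ℝ := fun t x => ψ1 x * (S.v t x * S.wx t x - S.w t x * S.vx t x) +
    ψ x * ((S.vx t x * S.wx t x + S.v t x * S.wxx t x) - (S.wx t x * S.vx t x + S.w t x * S.vxx t x))
  have cG' : Continuous (Function.uncurry G') := by
    simp only [Function.uncurry_def, G']; fun_prop
  have cF' : Continuous (Function.uncurry F') := by
    simp only [Function.uncurry_def, F']; fun_prop
  have cF : Continuous (Function.uncurry F) := by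
    simp only [Function.uncurry_def, F]; fun_prop
  have cG : Continuous (Function.uncurry fun t x => ψ x * S.rho t x) := by
    simp only [Function.uncurry_def, rho]; fun_prop
  have cP : Continuous (Function.uncurry fun t x => 2 * ψ1 x * S.pp t x) := by
    simp only [Function.uncurry_def, pp]; fun_prop
  have dF : ∀ t x, HasDerivAt (F t) (F' t x) x := by
    intro t x
    exact ((h.d1 x).mul (((S.fv.dx t x).mul (S.fw.dxx t x)).sub ((S.fw.dx t x).mul (S.fv.dxx t x))))
  have dG : ∀ t x, HasDerivAt (fun s => ψ x * S.rho s x) (G' t x) t := by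
    intro t x
    have := ((((S.fv.dt t x).mul (S.fv.dt t x)).add ((S.fw.dt t x).mul (S.fw.dt t x))).const_mul (ψ x))
    refine HasDerivAt.congr_of_eventuallyEq this (Eventually.of_forall fun s => ?_)
    simp [rho, pow_two]
  have zG' : ∀ t x, L < |x| → G' t x = 0 := fun t x hx => by simp [G', h.z x hx]
  have zF : ∀ t x, L < |x| → F t x = 0 := fun t x hx => by simp [F, h.z x hx]
  have zF' : ∀ t x, L < |x| → F' t x = 0 := fun t x hx => by
    simp [F', h.z x hx, h.z1 x hx]
  have hQ : ∀ t x, 2 * ψ1 x * S.pp t x = G' t x + 2 * F' t x := by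
    intro t x
    have e1 : S.wt t x = S.vxx t x - S.V t x * S.v t x := by linarith [S.pde1 t x]
    have e2 : S.vt t x = S.V t x * S.w t x - S.wxx t x := by linarith [S.pde2 t x]
    simp only [G', F', pp, e1, e2]
    ring
  have sl : ∀ {H : ℝ → ℝ → ℝ}, Continuous (Function.uncurry H) → ∀ t, Continuous (H t) :=
    fun hH t => hH.comp (Continuous.prodMk_right t)
  refine ⟨fun t => ?_, ?_⟩
  · have := param_deriv hL cG cG' (fun t x hx => by simp [h.z x hx]) zG' dG t
    refine this.congr_deriv ?_
    have z : ∫ x, F' t x = 0 := integral_eq_zero_of_hasDerivAt_of_integrable (dF t)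
      (cpt_integrable (sl cF' t) (zF' t)) (cpt_integrable (sl cF t) (zF t))
    calc ∫ x, G' t x = (∫ x, G' t x) + ∫ x, 2 * F' t x := by rw [integral_const_mul, z]; simp
      _ = ∫ x, (G' t x + 2 * F' t x) := (integral_add (cpt_integrable (sl cG' t) (zG' t))
          ((cpt_integrable (sl cF' t) (zF' t)).const_mul 2)).symm
      _ = _ := by simp only [hQ]
  · exact param_cont hL cP fun t x hx => by simp [h.z1 x hx]

end Sol


theorem ker_int {a : ℝ} (ha1 : a < 1) :
    Integrable (Set.indicator (Set.Icc (-1:ℝ) 1) fun z : ℝ => |z| ^ (-a)) := by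
  rw [integrable_indicator_iff measurableSet_Icc]
  have h1 : IntervalIntegrable (fun z : ℝ => |z| ^ (-a)) volume 0 1 := by
    have : IntervalIntegrable (fun z : ℝ => z ^ (-a)) volume 0 1 :=
      intervalIntegral.intervalIntegrable_rpow' (by linarith)
    refine this.congr ?_
    intro z hz
    rw [Set.uIoc_of_le zero_le_one] at hz
    simp only [abs_of_pos hz.1]
  have h2 : IntervalIntegrable (fun z : ℝ => |z| ^ (-a)) volume (-1) 0 := by
    have := (IntervalIntegrable.iff_comp_neg (f := fun z : ℝ => |z| ^ (-a)) (a := 0) (b := 1)).1 h1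
    simp only [abs_neg, neg_zero] at this
    exact this.symm
  have := h2.trans h1
  rwa [intervalIntegrable_iff_integrableOn_Icc_of_le (by norm_num)] at this

theorem ker_le {a : ℝ} (ha0 : 0 < a) (z : ℝ) :
    |z| ^ (-a) ≤ Set.indicator (Set.Icc (-1:ℝ) 1) (fun z : ℝ => |z| ^ (-a)) z + 1 := by
  by_cases h : z ∈ Set.Icc (-1:ℝ) 1
  · rw [Set.indicator_of_mem h]; linarith
  · rw [Set.indicator_of_notMem h, zero_add]
    have : 1 < |z| := by
      by_contra h'
      exact h (abs_le.1 (not_lt.1 h'))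
    exact rpow_le_one_of_one_le_of_nonpos this.le (by linarith)

theorem ker_meas (a : ℝ) : Measurable fun z : ℝ => |z| ^ (-a) := by
  fun_prop

/-- The kernel constant. -/
noncomputable def kap (a : ℝ) : ℝ := ∫ z, Set.indicator (Set.Icc (-1:ℝ) 1) (fun z : ℝ => |z| ^ (-a)) z

theorem kap_nonneg (a : ℝ) : 0 ≤ kap a := by
  apply integral_nonneg
  intro z
  apply Set.indicator_nonneg
  intro z _; positivity

theorem conv_bound {a : ℝ} (ha0 : 0 < a) (ha1 : a < 1) {r : ℝ → ℝ} {B : ℝ} (hr : Continuous r)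
    (h0 : ∀ x, 0 ≤ r x) (hB : ∀ x, r x ≤ B) (hi : Integrable r) (x : ℝ) :
    Integrable (fun y => |x - y| ^ (-a) * r y) ∧ 0 ≤ (∫ y, |x - y| ^ (-a) * r y) ∧
    (∫ y, |x - y| ^ (-a) * r y) ≤ B * kap a + ∫ y, r y := by
  let k := Set.indicator (Set.Icc (-1:ℝ) 1) fun z : ℝ => |z| ^ (-a)
  have hk : Integrable (fun y => k (x - y)) := (ker_int ha1).comp_sub_left x
  have hdom : Integrable (fun y => B * k (x - y) + r y) := (hk.const_mul B).add hi
  have hk0 : ∀ z, 0 ≤ k z := fun z => Set.indicator_nonneg (fun z _ => by positivity) z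
  have hle : ∀ y, |x - y| ^ (-a) * r y ≤ B * k (x - y) + r y := by
    intro y
    have := mul_le_mul_of_nonneg_right (ker_le ha0 (x - y)) (h0 y)
    have := mul_le_mul_of_nonneg_left (hB y) (hk0 (x - y))
    simp only [k] at *
    nlinarith
  have hnn : ∀ y, 0 ≤ |x - y| ^ (-a) * r y := fun y => mul_nonneg (by positivity) (h0 y)
  have hIn : Integrable (fun y => |x - y| ^ (-a) * r y) := by
    refine hdom.mono' ?_ ?_
    · have : Measurable (fun y => |x - y| ^ (-a)) := by fun_prop
      exact (this.mul hr.measurable).aestronglyMeasurable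
    · refine Eventually.of_forall fun y => ?_
      rw [Real.norm_of_nonneg (hnn y)]; exact hle y
  refine ⟨hIn, integral_nonneg hnn, ?_⟩
  calc _ ≤ ∫ y, (B * k (x - y) + r y) := integral_mono hIn hdom hle
    _ = _ := by
      rw [integral_add (hk.const_mul B) hi, integral_const_mul, integral_sub_left_eq_self]; rfl

theorem ker_antitone {a : ℝ} (ha0 : 0 < a) {z h : ℝ} (hh : 0 < h) (hz : 0 ≤ z) (hne : z ≠ h) :
    |z + h| ^ (-a) ≤ |z - h| ^ (-a) := by
  apply rpow_le_rpow_of_nonpos (abs_pos.2 (sub_ne_zero.2 hne)) _ (by linarith)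
  rw [abs_of_nonneg (by linarith : 0 ≤ z + h), abs_le]
  constructor <;> linarith

theorem dbl_int {a : ℝ} (ha0 : 0 < a) (ha1 : a < 1) {r f : ℝ → ℝ} {B : ℝ} (hr : Continuous r)
    (h0 : ∀ x, 0 ≤ r x) (hB : ∀ x, r x ≤ B) (hi : Integrable r)
    (hf : Continuous f) (hfi : Integrable f) (h : ℝ) :
    Integrable (Function.uncurry fun x y => |x - y - h| ^ (-a) * r y * f x)
      ((volume : Measure ℝ).prod (volume : Measure ℝ)) := by
  have hm : Measurable (Function.uncurry fun x y => |x - y - h| ^ (-a) * r y * f x) := by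
    have := hr.measurable; have := hf.measurable
    simp only [Function.uncurry_def]
    fun_prop
  have key : ∀ x, (fun y => |x - y - h| ^ (-a) * r y * f x) =
      fun y => (|(x - h) - y| ^ (-a) * r y) * f x := by
    intro x; ext y; rw [show x - y - h = x - h - y by ring]
  rw [integrable_prod_iff hm.aestronglyMeasurable]
  constructor
  · refine Eventually.of_forall fun x => ?_
    simp only [Function.uncurry_apply_pair]
    rw [key]
    exact (conv_bound ha0 ha1 hr h0 hB hi (x - h)).1.mul_const _
  · have e : (fun x => ∫ y, ‖Function.uncurry (fun x y => |x - y - h| ^ (-a) * r y * f x) (x, y)‖) =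
        fun x => (∫ y, |(x - h) - y| ^ (-a) * r y) * |f x| := by
      ext x
      rw [← integral_mul_const]
      congr 1; ext y
      simp only [Function.uncurry_apply_pair, norm_mul, Real.norm_eq_abs]
      rw [abs_of_nonneg (h0 y), abs_of_nonneg (by positivity : 0 ≤ |x - y - h| ^ (-a)),
        show x - y - h = x - h - y by ring]
    have hmeas := hm.norm.stronglyMeasurable.integral_prod_right' (ν := (volume : Measure ℝ))
    rw [e] at hmeas ⊢
    refine (hfi.norm.const_mul (B * kap a + ∫ y, r y)).mono' hmeas.aestronglyMeasurable
      (Eventually.of_forall fun x => ?_)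
    obtain ⟨_, p1, p2⟩ := conv_bound ha0 ha1 hr h0 hB hi (x - h)
    rw [Real.norm_eq_abs, abs_mul, abs_abs, abs_of_nonneg p1, Real.norm_eq_abs]
    exact mul_le_mul_of_nonneg_right p2 (abs_nonneg _)

theorem diff_nonneg {a : ℝ} (ha0 : 0 < a) (ha1 : a < 1) {r φ : ℝ → ℝ} {B P : ℝ} (hr : Continuous r)
    (h0 : ∀ x, 0 ≤ r x) (hB : ∀ x, r x ≤ B) (hi : Integrable r)
    (hφ : Continuous φ) (hmono : Monotone φ) (hP : ∀ x, |φ x| ≤ P) (h : ℝ) (hh : 0 < h) :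
    0 ≤ ∫ x, (∫ y, |x - y| ^ (-a) * r y) * (φ (x + h) * r (x + h) - φ (x - h) * r (x - h)) := by
  let f : ℝ → ℝ := fun x => φ x * r x
  have hf : Continuous f := hφ.mul hr
  have hfi : Integrable f := hi.bdd_mul hφ.aestronglyMeasurable (c := P) (Eventually.of_forall hP)
  let A : ℝ → ℝ := fun s => ∫ x, ∫ y, |x - y - s| ^ (-a) * r y * f x
  have hI := fun s => dbl_int ha0 ha1 hr h0 hB hi hf hfi s
  have shift : ∀ s, Integrable (fun x => (∫ y, |x - y| ^ (-a) * r y) * f (x + s)) ∧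
      ∫ x, (∫ y, |x - y| ^ (-a) * r y) * f (x + s) = A s := by
    intro s
    have e : ∀ x, (∫ y, |(x + s) - y - s| ^ (-a) * r y * f (x + s)) =
        (∫ y, |x - y| ^ (-a) * r y) * f (x + s) := by
      intro x
      rw [← integral_mul_const]
      congr 1; ext y; rw [show x + s - y - s = x - y by ring]
    constructor
    · have := (hI s).integral_prod_left.comp_add_right s
      simp only [Function.uncurry_apply_pair] at this
      simpa only [e] using this
    · have := integral_add_right_eq_self (μ := (volume : Measure ℝ))
        (fun x => ∫ y, |x - y - s| ^ (-a) * r y * f x) s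
      simp only [e] at this
      exact this
  have e1 : (∫ x, (∫ y, |x - y| ^ (-a) * r y) * (φ (x + h) * r (x + h) - φ (x - h) * r (x - h)))
      = A h - A (-h) := by
    rw [← (shift h).2, ← (shift (-h)).2, ← integral_sub (shift h).1 (shift (-h)).1]
    congr 1; ext x; simp only [f]; rw [← sub_eq_add_neg]; ring
  have swap : ∀ s, A s = ∫ x, ∫ y, |x - y + s| ^ (-a) * r x * f y := by
    intro s
    simp only [A]
    rw [integral_integral_swap (hI s)]
    congr 1; ext x; congr 1; ext y
    rw [show y - x - s = -(x - y + s) by ring, abs_neg]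
  have hJ : ∀ s, Integrable (Function.uncurry fun x y => |x - y + s| ^ (-a) * r x * f y)
      ((volume : Measure ℝ).prod (volume : Measure ℝ)) := by
    intro s
    have := (hI s).swap
    refine this.congr (Eventually.of_forall fun p => ?_)
    obtain ⟨x, y⟩ := p
    simp only [Function.comp, Prod.swap, Function.uncurry_apply_pair]
    rw [show y - x - s = -(x - y + s) by ring, abs_neg]
  have e2 : 2 * (A h - A (-h)) = ∫ p : ℝ × ℝ, (((|p.1 - p.2 - h| ^ (-a) * r p.2 * f p.1)
      - (|p.1 - p.2 - (-h)| ^ (-a) * r p.2 * f p.1)) +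
      ((|p.1 - p.2 + h| ^ (-a) * r p.1 * f p.2) - (|p.1 - p.2 + (-h)| ^ (-a) * r p.1 * f p.2)))
      ∂((volume : Measure ℝ).prod (volume : Measure ℝ)) := by
    have i1 : A h = _ := integral_integral (hI h)
    have i2 : A (-h) = _ := integral_integral (hI (-h))
    have i3 := (swap h).trans (integral_integral (hJ h))
    have i4 := (swap (-h)).trans (integral_integral (hJ (-h)))
    have j1 := hI h; have j2 := hI (-h); have j3 := hJ h; have j4 := hJ (-h)
    simp only [Function.uncurry_def] at j1 j2 j3 j4
    have k1 := integral_sub j1 j2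
    have k2 := integral_sub j3 j4
    have k3 := integral_add (j1.sub j2) (j3.sub j4)
    simp only [Pi.sub_apply] at k3
    rw [k3, k1, k2, ← i1, ← i2, ← i3, ← i4]
    ring
  rw [e1]
  suffices 0 ≤ 2 * (A h - A (-h)) by linarith
  rw [e2]
  apply integral_nonneg_of_ae
  have hbad : ∀ c : ℝ, ∀ᵐ p : ℝ × ℝ ∂((volume : Measure ℝ).prod (volume : Measure ℝ)), p.1 - p.2 ≠ c := by
    intro c
    have hms : MeasurableSet {p : ℝ × ℝ | p.1 - p.2 ≠ c} :=
      (measurableSet_eq_fun (by fun_prop) (by fun_prop) : MeasurableSet {p : ℝ × ℝ | p.1 - p.2 = c}).compl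
    rw [Measure.ae_prod_iff_ae_ae hms]
    refine Eventually.of_forall fun x => ?_
    have : ∀ᵐ y : ℝ, y ≠ x - c := by simp [ae_iff]
    filter_upwards [this] with y hy hxy
    exact hy (by linarith)
  filter_upwards [hbad h, hbad (-h)] with p hp1 hp2
  obtain ⟨x, y⟩ := p
  simp only [Pi.zero_apply, f] at *
  have rx := h0 x; have ry := h0 y
  have id : (|x - y - h| ^ (-a) * r y * (φ x * r x) - |x - y - -h| ^ (-a) * r y * (φ x * r x) +
      (|x - y + h| ^ (-a) * r x * (φ y * r y) - |x - y + -h| ^ (-a) * r x * (φ y * r y))) =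
      (|x - y - h| ^ (-a) - |x - y + h| ^ (-a)) * (φ x - φ y) * (r x * r y) := by
    rw [sub_neg_eq_add, ← sub_eq_add_neg]; ring
  rw [id]
  apply mul_nonneg _ (mul_nonneg rx ry)
  rcases le_total y x with hxy | hxy
  · have := ker_antitone ha0 hh (sub_nonneg.2 hxy) hp1
    exact mul_nonneg (by linarith) (sub_nonneg.2 (hmono hxy))
  · have := ker_antitone ha0 hh (sub_nonneg.2 hxy) (fun e => hp2 (by linarith))
    rw [show y - x + h = -(x - y - h) by ring, show y - x - h = -(x - y + h) by ring, abs_neg, abs_neg] at this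
    exact mul_nonneg_of_nonpos_of_nonpos (by linarith) (sub_nonpos.2 (hmono hxy))

theorem nonlocal_nonneg {a : ℝ} (ha0 : 0 < a) (ha1 : a < 1) {r r' φ φ' : ℝ → ℝ} {B P C : ℝ}
    (hr : Continuous r)
    (h0 : ∀ x, 0 ≤ r x) (hB : ∀ x, r x ≤ B) (hi : Integrable r)
    (hφ : Continuous φ) (hmono : Monotone φ) (hP : ∀ x, |φ x| ≤ P)
    (dr : ∀ x, HasDerivAt r (r' x) x) (dφ : ∀ x, HasDerivAt φ (φ' x) x) (hC : 0 ≤ C)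
    (hd : ∀ x, |φ' x * r x + φ x * r' x| ≤ C * (1 + x ^ 2)⁻¹) :
    0 ≤ ∫ x, (∫ y, |x - y| ^ (-a) * r y) * (φ' x * r x + φ x * r' x) := by
  let V : ℝ → ℝ := fun x => ∫ y, |x - y| ^ (-a) * r y
  let G : ℝ → ℝ := fun x => φ x * r x
  have dG : ∀ x, HasDerivAt G (φ' x * r x + φ x * r' x) x := fun x => (dφ x).mul (dr x)
  have cG : Continuous G := hφ.mul hr
  let hn : ℕ → ℝ := fun n => 1 / ((n : ℝ) + 1)
  have hn0 : ∀ n, 0 < hn n := fun n => by positivity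
  have hn1 : ∀ n, hn n ≤ 1 := fun n => by
    simp only [hn]; rw [div_le_one (by positivity)]; linarith [(Nat.cast_nonneg n : (0:ℝ) ≤ n)]
  have hnl : Tendsto hn atTop (nhds 0) := tendsto_one_div_add_atTop_nhds_zero_nat
  have hVm : StronglyMeasurable V := by
    have hm : Measurable (Function.uncurry fun x y => |x - y| ^ (-a) * r y) := by
      have := hr.measurable
      simp only [Function.uncurry_def]; fun_prop
    exact hm.stronglyMeasurable.integral_prod_right
  have hVb : ∀ x, |V x| ≤ B * kap a + ∫ y, r y := fun x => by
    obtain ⟨_, p1, p2⟩ := conv_bound ha0 ha1 hr h0 hB hi x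
    rw [abs_of_nonneg p1]; exact p2
  have lim : Tendsto (fun n => ∫ x, V x * ((2 * hn n)⁻¹ * (G (x + hn n) - G (x - hn n)))) atTop
      (nhds (∫ x, V x * (φ' x * r x + φ x * r' x))) := by
    refine tendsto_integral_of_dominated_convergence
      (fun x => (B * kap a + ∫ y, r y) * (3 * C * (1 + x ^ 2)⁻¹)) ?_ ?_ ?_ ?_
    · intro n
      refine hVm.aestronglyMeasurable.mul (Continuous.aestronglyMeasurable ?_)
      fun_prop
    · exact ((integrable_inv_one_add_sq).const_mul (3 * C)).const_mul _
    · intro n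
      refine Eventually.of_forall fun x => ?_
      rw [norm_mul]
      refine mul_le_mul (hVb x) ?_ (norm_nonneg _) ((abs_nonneg _).trans (hVb x))
      have := Convex.norm_image_sub_le_of_norm_hasDerivWithin_le (f := G)
        (f' := fun x => φ' x * r x + φ x * r' x) (C := 3 * C * (1 + x ^ 2)⁻¹)
        (s := Set.Icc (x - hn n) (x + hn n)) (x := x - hn n) (y := x + hn n)
        (fun ξ _ => (dG ξ).hasDerivWithinAt) ?_ (convex_Icc _ _)
        ⟨le_rfl, by linarith [hn0 n]⟩ ⟨by linarith [hn0 n], le_rfl⟩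
      · rw [norm_mul, norm_inv, Real.norm_of_nonneg (by linarith [hn0 n] : 0 ≤ 2 * hn n)]
        rw [show x + hn n - (x - hn n) = 2 * hn n by ring,
          Real.norm_of_nonneg (by linarith [hn0 n] : 0 ≤ 2 * hn n)] at this
        rw [inv_mul_le_iff₀ (by linarith [hn0 n])]
        linarith
      · intro ξ hξ
        refine (hd ξ).trans ?_
        rw [mul_comm 3 C, mul_assoc]
        refine mul_le_mul_of_nonneg_left ?_ hC
        rw [← div_eq_mul_inv, inv_eq_one_div, div_le_div_iff₀ (by positivity) (by positivity)]
        have h1 : |x - ξ| ≤ 1 := abs_le.2 ⟨by linarith [hξ.2, hn1 n], by linarith [hξ.1, hn1 n]⟩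
        have h2 : (x - ξ) ^ 2 ≤ 1 := by rw [← sq_abs]; nlinarith [abs_nonneg (x - ξ)]
        nlinarith [sq_nonneg (x - 2 * ξ)]
    · refine Eventually.of_forall fun x => Tendsto.const_mul _ ?_
      have s1 : Tendsto (fun n => (hn n)⁻¹ * (G (x + hn n) - G x)) atTop
          (nhds (φ' x * r x + φ x * r' x)) := by
        have := (hasDerivAt_iff_tendsto_slope_zero.1 (dG x)).comp
          (tendsto_nhdsWithin_iff.2 ⟨hnl, Eventually.of_forall fun n => (hn0 n).ne'⟩)
        simpa [Function.comp_def] using this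
      have s2 : Tendsto (fun n => (-hn n)⁻¹ * (G (x + -hn n) - G x)) atTop
          (nhds (φ' x * r x + φ x * r' x)) := by
        have hnl' : Tendsto (fun n => -hn n) atTop (nhds 0) := by simpa using hnl.neg
        have := (hasDerivAt_iff_tendsto_slope_zero.1 (dG x)).comp
          (tendsto_nhdsWithin_iff.2 ⟨hnl', Eventually.of_forall fun n =>
            (neg_ne_zero.2 (hn0 n).ne')⟩)
        simpa only [Function.comp_def, smul_eq_mul] using this
      have := ((s1.add s2).const_mul (1/2))
      rw [show 1 / 2 * (φ' x * r x + φ x * r' x + (φ' x * r x + φ x * r' x)) =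
        φ' x * r x + φ x * r' x by ring] at this
      refine this.congr fun n => ?_
      have := (hn0 n).ne'
      rw [← sub_eq_add_neg]
      field_simp
      ring
  refine ge_of_tendsto' lim fun n => ?_
  have := diff_nonneg ha0 ha1 hr h0 hB hi hφ hmono hP (hn n) (hn0 n)
  have e : (∫ x, V x * ((2 * hn n)⁻¹ * (G (x + hn n) - G (x - hn n)))) =
      (2 * hn n)⁻¹ * ∫ x, V x * (G (x + hn n) - G (x - hn n)) := by
    rw [← integral_const_mul]; congr 1; ext x; ring
  rw [e]
  exact mul_nonneg (by have := hn0 n; positivity) this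


theorem hardy_poly {x : ℝ} (hx : 0 ≤ x) :
    4 * (x * (1 + x) ^ 3 + 2 * (1 + x ^ 2) ^ 2) ^ 2 ≤ 42 * (1 + x ^ 2) ^ 3 * (1 + x) ^ 2 := by
  have : 0 ≤ 42 * (1 + x ^ 2) ^ 3 * (1 + x) ^ 2 - 4 * (x * (1 + x) ^ 3 + 2 * (1 + x ^ 2) ^ 2) ^ 2 := by
    ring_nf
    have h2 := pow_nonneg hx 2
    have h3 := pow_nonneg hx 3
    have h4 := pow_nonneg hx 4
    have h5 := pow_nonneg hx 5
    have h6 := pow_nonneg hx 6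
    have h7 := pow_nonneg hx 7
    have h8 := pow_nonneg hx 8
    nlinarith [sq_nonneg (x - 1), mul_nonneg hx (sq_nonneg (x - 1)), mul_nonneg h2 (sq_nonneg (x - 1)),
      mul_nonneg h3 (sq_nonneg (x - 1)), mul_nonneg h4 (sq_nonneg (x - 1)), mul_nonneg h5 (sq_nonneg (x - 1)),
      mul_nonneg h6 (sq_nonneg (x - 1)), sq_nonneg (x * (x - 1)), sq_nonneg (x^2 * (x - 2)), sq_nonneg (x^2*(x-1)), sq_nonneg (x^3*(x-2)), mul_nonneg h5 (sq_nonneg (x - 2)), sq_nonneg (x^3*(x-1))]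
  linarith

theorem quad_form {α β γ X Y : ℝ} (hα : 0 < α) (h : β ^ 2 ≤ 4 * α * γ) :
    0 ≤ α * X ^ 2 - β * (Y * X) + γ * Y ^ 2 := by
  have : 0 ≤ 4 * α * (α * X ^ 2 - β * (Y * X) + γ * Y ^ 2) := by
    nlinarith [sq_nonneg (2 * α * X - β * Y), mul_nonneg (sub_nonneg.2 h) (sq_nonneg Y)]
  exact nonneg_of_mul_nonneg_right this (by positivity)

theorem hardy_coef {x : ℝ} (hx : 0 ≤ x) :
    (2 * x / (1 + x ^ 2) ^ 2 + 4 / (1 + x) ^ 3) ^ 2 ≤ 4 * (2 * (1 + x ^ 2)⁻¹) * (21 / 4 / (1 + x) ^ 4) := by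
  have h1 : 0 < 1 + x := by linarith
  have h2 : 0 < 1 + x ^ 2 := by positivity
  have e1 : (2 * x / (1 + x ^ 2) ^ 2 + 4 / (1 + x) ^ 3) ^ 2 =
      4 * (x * (1 + x) ^ 3 + 2 * (1 + x ^ 2) ^ 2) ^ 2 / ((1 + x ^ 2) ^ 4 * (1 + x) ^ 6) := by
    field_simp; ring
  have e2 : 4 * (2 * (1 + x ^ 2)⁻¹) * (21 / 4 / (1 + x) ^ 4) =
      42 * (1 + x ^ 2) ^ 3 * (1 + x) ^ 2 / ((1 + x ^ 2) ^ 4 * (1 + x) ^ 6) := by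
    field_simp; ring
  rw [e1, e2]
  exact div_le_div_of_nonneg_right (hardy_poly hx) (by positivity)

/-- derivative of arctan -/
noncomputable def ph1 (x : ℝ) : ℝ := (1 + x ^ 2)⁻¹
/-- second derivative of arctan -/
noncomputable def ph2 (x : ℝ) : ℝ := - (2 * x / (1 + x ^ 2) ^ 2)

theorem ph_d1 (x : ℝ) : HasDerivAt arctan (ph1 x) x := by
  have := hasDerivAt_arctan x
  simpa [ph1] using this
theorem ph_d2 (x : ℝ) : HasDerivAt ph1 (ph2 x) x := by
  have h : HasDerivAt (fun x : ℝ => 1 + x ^ 2) (2 * x) x := by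
    simpa using ((hasDerivAt_id x).pow 2).const_add 1
  have := h.inv (by positivity)
  refine this.congr_deriv ?_
  simp [ph2, neg_div]
theorem ph_c1 : Continuous ph1 := continuous_iff_continuousAt.2 fun x => (ph_d2 x).continuousAt
theorem ph_c2 : Continuous ph2 := by
  unfold ph2
  refine Continuous.neg (Continuous.div (by fun_prop) (by fun_prop) fun x => by positivity)
theorem ph_b0 (x : ℝ) : |arctan x| ≤ 2 := by
  have h1 := arctan_lt_pi_div_two x
  have h2 := neg_pi_div_two_lt_arctan x
  have := pi_le_four
  rw [abs_le]; constructor <;> linarith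
theorem ph_pos1 (x : ℝ) : 0 < ph1 x := by unfold ph1; positivity
theorem ph_b1 (x : ℝ) : |ph1 x| ≤ 1 := by
  rw [abs_of_pos (ph_pos1 x), ph1]
  apply inv_le_one_of_one_le₀; nlinarith [sq_nonneg x]
theorem ph_b2 (x : ℝ) : |ph2 x| ≤ 1 := by
  rw [ph2, abs_neg, abs_div, abs_of_pos (by positivity : 0 < (1 + x ^ 2) ^ 2), div_le_one (by positivity),
    abs_le]
  constructor
  · nlinarith [sq_nonneg (x + 1), sq_nonneg (x ^ 2), sq_nonneg x]
  · nlinarith [sq_nonneg (x - 1), sq_nonneg (x ^ 2), sq_nonneg x]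

namespace Sol
variable {a M : ℝ} (S : Sol a M)

theorem cslice {H : ℝ → ℝ → ℝ} (hH : Continuous (Function.uncurry H)) (t : ℝ) : Continuous (H t) :=
  hH.comp (Continuous.prodMk_right t)

theorem c_rho (t : ℝ) : Continuous (S.rho t) :=
  ((cslice S.fv.c t).pow 2).add ((cslice S.fw.c t).pow 2)
theorem c_dd (t : ℝ) : Continuous (S.dd t) :=
  ((cslice S.fv.cx t).pow 2).add ((cslice S.fw.cx t).pow 2)
theorem c_rr (t : ℝ) : Continuous (S.rr t) :=
  ((cslice S.fv.c t).mul (cslice S.fv.cx t)).add ((cslice S.fw.c t).mul (cslice S.fw.cx t))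
theorem c_pp (t : ℝ) : Continuous (S.pp t) :=
  ((cslice S.fv.c t).mul (cslice S.fw.cx t)).sub ((cslice S.fw.c t).mul (cslice S.fv.cx t))

theorem dec (t : ℝ) : ∃ C : ℝ, 0 ≤ C ∧ ∀ x, S.rho t x ≤ C * (1 + x ^ 2)⁻¹ ∧
    S.dd t x ≤ C * (1 + x ^ 2)⁻¹ := by
  obtain ⟨C, hC, h⟩ := S.decay t
  refine ⟨2 * C ^ 2, by positivity, fun x => ?_⟩
  obtain ⟨h1, h2, h3, h4⟩ := h x
  have hp : 0 < (1 + x ^ 2)⁻¹ := by positivity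
  have hp1 : (1 + x ^ 2)⁻¹ ≤ 1 := by
    apply inv_le_one_of_one_le₀; nlinarith [sq_nonneg x]
  have key : ∀ z : ℝ, |z| ≤ C * (1 + x ^ 2)⁻¹ → z ^ 2 ≤ C ^ 2 * (1 + x ^ 2)⁻¹ := by
    intro z hz
    rw [← sq_abs]
    calc |z| ^ 2 ≤ (C * (1 + x ^ 2)⁻¹) ^ 2 := by gcongr
      _ = C ^ 2 * (1 + x ^ 2)⁻¹ * (1 + x ^ 2)⁻¹ := by ring
      _ ≤ C ^ 2 * (1 + x ^ 2)⁻¹ * 1 := by gcongr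
      _ = _ := by ring
  unfold rho dd
  constructor
  · linarith [key _ h1, key _ h2]
  · linarith [key _ h3, key _ h4]

theorem i_rho (t : ℝ) : Integrable (S.rho t) := by
  obtain ⟨C, hC, h⟩ := S.dec t
  refine (integrable_inv_one_add_sq.const_mul C).mono' (S.c_rho t).aestronglyMeasurable
    (Eventually.of_forall fun x => ?_)
  rw [Real.norm_of_nonneg (S.rho_nonneg t x)]; exact (h x).1
theorem i_dd (t : ℝ) : Integrable (S.dd t) := by
  obtain ⟨C, hC, h⟩ := S.dec t
  refine (integrable_inv_one_add_sq.const_mul C).mono' (S.c_dd t).aestronglyMeasurable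
    (Eventually.of_forall fun x => ?_)
  rw [Real.norm_of_nonneg (S.dd_nonneg t x)]; exact (h x).2
theorem i_e (t : ℝ) : Integrable (fun x => S.rho t x + S.dd t x) := (S.i_rho t).add (S.i_dd t)

theorem e_le (t : ℝ) : ∫ x, (S.rho t x + S.dd t x) ≤ M := by
  rw [integral_add (S.i_rho t) (S.i_dd t)]
  exact S.bound t
theorem irho_nonneg (t : ℝ) : 0 ≤ ∫ x, S.rho t x := integral_nonneg (S.rho_nonneg t)
theorem idd_nonneg (t : ℝ) : 0 ≤ ∫ x, S.dd t x := integral_nonneg (S.dd_nonneg t)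
theorem irho_le (t : ℝ) : ∫ x, S.rho t x ≤ M := by
  have := S.e_le t
  rw [integral_add (S.i_rho t) (S.i_dd t)] at this
  linarith [S.idd_nonneg t]
theorem idd_le (t : ℝ) : ∫ x, S.dd t x ≤ M := by
  have := S.e_le t
  rw [integral_add (S.i_rho t) (S.i_dd t)] at this
  linarith [S.irho_nonneg t]
theorem M_nonneg {a M : ℝ} (S : Sol a M) : 0 ≤ M := (S.irho_nonneg 0).trans (S.irho_le 0)

theorem v0 (t : ℝ) : S.v t 0 = 0 := by have := S.ov t 0; rw [neg_zero] at this; linarith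
theorem w0 (t : ℝ) : S.w t 0 = 0 := by have := S.ow t 0; rw [neg_zero] at this; linarith
theorem rho0 (t : ℝ) : S.rho t 0 = 0 := by simp [rho, S.v0, S.w0]

theorem rho_ftc (t x : ℝ) : S.rho t x = ∫ y in (0:ℝ)..x, 2 * S.rr t y := by
  rw [intervalIntegral.integral_eq_sub_of_hasDerivAt (fun y _ => S.rho_deriv t y)
    (((S.c_rr t).const_mul 2).intervalIntegrable _ _), S.rho0, sub_zero]

theorem rho_le (t x : ℝ) : S.rho t x ≤ M := by
  rw [S.rho_ftc]
  calc _ ≤ ‖∫ y in (0:ℝ)..x, 2 * S.rr t y‖ := Real.le_norm_self _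
    _ ≤ ∫ y in Set.uIoc 0 x, ‖2 * S.rr t y‖ := intervalIntegral.norm_integral_le_integral_norm_uIoc
    _ ≤ ∫ y in Set.uIoc 0 x, (S.rho t y + S.dd t y) := by
      refine setIntegral_mono ?_ (S.i_e t).integrableOn fun y => ?_
      · refine (S.i_e t).integrableOn.mono' ((S.c_rr t).const_mul 2).norm.aestronglyMeasurable
          (Eventually.of_forall fun y => ?_)
        simp only [norm_mul, Real.norm_eq_abs, abs_abs, abs_two]; linarith [S.rr_le t y]
      · simp only [norm_mul, Real.norm_eq_abs, abs_two]; linarith [S.rr_le t y]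
    _ ≤ ∫ y, (S.rho t y + S.dd t y) := setIntegral_le_integral (S.i_e t)
        (Eventually.of_forall fun y => add_nonneg (S.rho_nonneg t y) (S.dd_nonneg t y))
    _ ≤ M := S.e_le t

theorem V_bd (ha0 : 0 < a) (ha1 : a < 1) (t x : ℝ) : 0 ≤ S.V t x ∧ S.V t x ≤ M * kap a + M := by
  rw [S.hV]
  obtain ⟨_, h1, h2⟩ := conv_bound ha0 ha1 (S.c_rho t) (S.rho_nonneg t) (S.rho_le t) (S.i_rho t) x
  exact ⟨h1, h2.trans (by linarith [S.irho_le t])⟩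

theorem V_meas (t : ℝ) : StronglyMeasurable (S.V t) := by
  have hm : Measurable (Function.uncurry fun x y => |x - y| ^ (-a) * S.rho t y) := by
    have := (S.c_rho t).measurable
    simp only [Function.uncurry_def]; fun_prop
  have := hm.stronglyMeasurable.integral_prod_right (ν := (volume : Measure ℝ))
  have e : S.V t = fun x => ∫ y, |x - y| ^ (-a) * S.rho t y := by ext x; exact S.hV t x
  rw [e]; exact this

theorem Q_bd (ha0 : 0 < a) (ha1 : a < 1) {ψ ψ1 ψ2 : ℝ → ℝ} {B : ℝ} (x : ℝ) (h0 : |ψ x| ≤ B) (h1 : |ψ1 x| ≤ B)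
    (h2 : |ψ2 x| ≤ B) (t : ℝ) :
    |S.Q ψ ψ1 ψ2 t x| ≤ B * (3 + 2 * (M * kap a + M)) * (S.rho t x + S.dd t x) := by
  obtain ⟨p1, p2⟩ := S.V_bd ha0 ha1 t x
  have r1 := S.rho_nonneg t x
  have r2 := S.dd_nonneg t x
  have r3 := S.rr_le t x
  have hB : 0 ≤ B := (abs_nonneg _).trans h0
  set C := M * kap a + M
  unfold Q
  have q1 : |2 * ψ1 x * S.dd t x| ≤ 2 * B * S.dd t x := by
    rw [abs_mul, abs_mul, abs_two, abs_of_nonneg r2]; gcongr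
  have q2 : |ψ2 x * S.rr t x| ≤ B * ((S.rho t x + S.dd t x) / 2) := by
    rw [abs_mul]; gcongr
  have q3 : |S.V t x * (ψ1 x * S.rho t x + 2 * ψ x * S.rr t x)| ≤
      C * (B * S.rho t x + 2 * B * ((S.rho t x + S.dd t x) / 2)) := by
    rw [abs_mul, abs_of_nonneg p1]
    refine mul_le_mul p2 ((abs_add_le _ _).trans (add_le_add ?_ ?_)) (abs_nonneg _) (p1.trans p2)
    · rw [abs_mul, abs_of_nonneg r1]; gcongr
    · rw [abs_mul, abs_mul, abs_two]; gcongr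
  have hC : 0 ≤ C := p1.trans p2
  refine ((abs_add_le _ _).trans (add_le_add_left (abs_add_le _ _) _)).trans ?_
  have t1 : 0 ≤ B * S.rho t x := by positivity
  have t2 : 0 ≤ B * S.dd t x := by positivity
  have t3 : 0 ≤ C * (B * S.dd t x) := by positivity
  nlinarith

/-- limiting virial functional -/
noncomputable def K (t : ℝ) : ℝ := ∫ x, S.Q arctan ph1 ph2 t x

theorem hardy (t : ℝ) : (3 / 4) * ∫ x, S.rho t x / (1 + |x|) ^ 4 ≤
    ∫ x, (2 * ph1 x * S.dd t x + ph2 x * S.rr t x) := by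
  have irr : Integrable (S.rr t) := (S.i_e t).mono' (S.c_rr t).aestronglyMeasurable
    (Eventually.of_forall fun x => (S.rr_le t x).trans (by
      linarith [S.rho_nonneg t x, S.dd_nonneg t x]))
  have j1 : Integrable (fun x => 2 * ph1 x * S.dd t x + ph2 x * S.rr t x) := by
    refine Integrable.add ?_ ?_
    · refine (S.i_dd t).bdd_mul (c := 2) (ph_c1.const_mul 2).aestronglyMeasurable
        (Eventually.of_forall fun x => ?_)
      rw [norm_mul, Real.norm_eq_abs, Real.norm_eq_abs, abs_two]; linarith [ph_b1 x]
    · exact irr.bdd_mul (c := 1) ph_c2.aestronglyMeasurable (Eventually.of_forall fun x => ph_b2 x)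
  have cden : Continuous (fun x : ℝ => ((1 + |x|) ^ 4)⁻¹) :=
    Continuous.inv₀ (by fun_prop) fun x => by positivity
  have j2 : Integrable (fun x => S.rho t x / (1 + |x|) ^ 4) := by
    simp only [div_eq_inv_mul]
    refine (S.i_rho t).bdd_mul (c := 1) cden.aestronglyMeasurable (Eventually.of_forall fun x => ?_)
    rw [Real.norm_of_nonneg (by positivity)]
    exact inv_le_one_of_one_le₀ (one_le_pow₀ (by linarith [abs_nonneg x]))
  let g : ℝ → ℝ := fun x => 2 * ph1 x * S.dd t x + ph2 x * S.rr t x - 3 / 4 * (S.rho t x / (1 + |x|) ^ 4)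
  have jg : Integrable g := j1.sub (j2.const_mul _)
  suffices h : 0 ≤ ∫ x, g x by
    have e : ∫ x, g x = (∫ x, (2 * ph1 x * S.dd t x + ph2 x * S.rr t x)) -
        (3 / 4) * ∫ x, S.rho t x / (1 + |x|) ^ 4 := by
      rw [← integral_const_mul]; exact integral_sub j1 (j2.const_mul _)
    linarith
  have ovx : ∀ x, S.vx t (-x) = S.vx t x := by
    intro x
    have h1 := ((S.fv.dx t (-x)).comp x (hasDerivAt_neg x))
    have h2 : HasDerivAt (S.v t ∘ Neg.neg) (-S.vx t x) x := by
      refine (S.fv.dx t x).neg.congr_of_eventuallyEq (Eventually.of_forall fun y => ?_)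
      simp [S.ov]
    have := h1.unique h2
    linarith
  have owx : ∀ x, S.wx t (-x) = S.wx t x := by
    intro x
    have h1 := ((S.fw.dx t (-x)).comp x (hasDerivAt_neg x))
    have h2 : HasDerivAt (S.w t ∘ Neg.neg) (-S.wx t x) x := by
      refine (S.fw.dx t x).neg.congr_of_eventuallyEq (Eventually.of_forall fun y => ?_)
      simp [S.ow]
    have := h1.unique h2
    linarith
  have even : ∀ x, g (-x) = g x := by
    intro x
    simp only [g, ph1, ph2, rho, dd, rr, S.ov, S.ow, ovx, owx, abs_neg]
    ring
  have ev : ∀ x, g x = g |x| := by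
    intro x
    rcases abs_choice x with h | h <;> rw [h]
    exact (even x).symm
  have e2 : ∫ x, g x = 2 * ∫ x in Set.Ioi (0:ℝ), g x := by
    rw [← integral_comp_abs]; congr 1; ext x; exact ev x
  rw [e2]
  apply mul_nonneg zero_le_two
  let q : ℝ → ℝ := fun x => 2 * ((1 + x) ^ 3)⁻¹
  let H' : ℝ → ℝ := fun x => -(6 / (1 + x) ^ 4) * S.rho t x + q x * (2 * S.rr t x)
  have dH : ∀ x ∈ Set.Ici (0:ℝ), HasDerivAt (fun x => q x * S.rho t x) (H' x) x := by
    intro x hx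
    have hx' : (0:ℝ) ≤ x := hx
    have hp : 0 < 1 + x := by linarith
    have d1 : HasDerivAt (fun x : ℝ => (1 + x) ^ 3) (3 * (1 + x) ^ 2) x := by
      refine (((hasDerivAt_id x).const_add 1).pow 3).congr_deriv ?_
      simp
    have d2 := (d1.inv (by positivity)).const_mul 2
    have d3 : HasDerivAt q (-(6 / (1 + x) ^ 4)) x := by
      refine d2.congr_deriv ?_
      field_simp; ring
    exact d3.mul (S.rho_deriv t x)
  have qb : ∀ x ∈ Set.Ioi (0:ℝ), ‖q x‖ ≤ 2 := by
    intro x hx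
    have hx' : (0:ℝ) < x := hx
    simp only [q]
    rw [Real.norm_of_nonneg (by positivity)]
    have : ((1 + x) ^ 3)⁻¹ ≤ 1 := inv_le_one_of_one_le₀ (one_le_pow₀ (by linarith))
    linarith
  have hH' : IntegrableOn H' (Set.Ioi 0) := by
    refine Integrable.add ?_ ?_
    · refine (S.i_rho t).integrableOn.bdd_mul (c := 6) ?_ ?_
      · have : Measurable fun x : ℝ => -(6 / (1 + x) ^ 4) := by fun_prop
        exact this.aestronglyMeasurable
      · refine (ae_restrict_iff' measurableSet_Ioi).2 (Eventually.of_forall fun x hx => ?_)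
        have hx' : (0:ℝ) < x := hx
        rw [norm_neg, Real.norm_of_nonneg (by positivity)]
        exact div_le_self (by norm_num) (one_le_pow₀ (by linarith))
    · refine (irr.const_mul 2).integrableOn.bdd_mul (c := 2) ?_
        ((ae_restrict_iff' measurableSet_Ioi).2 (Eventually.of_forall qb))
      have : Measurable q := by fun_prop
      exact this.aestronglyMeasurable
  have lim : Tendsto (fun x => q x * S.rho t x) atTop (nhds 0) := by
    obtain ⟨C, hC, h⟩ := S.dec t
    have l1 : Tendsto (fun x : ℝ => 2 * (C * (1 + x ^ 2)⁻¹)) atTop (nhds 0) := by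
      have : Tendsto (fun x : ℝ => 1 + x ^ 2) atTop atTop :=
        tendsto_atTop_add_const_left _ _ (tendsto_pow_atTop two_ne_zero)
      simpa using (this.inv_tendsto_atTop.const_mul C).const_mul 2
    refine squeeze_zero_norm' ?_ l1
    filter_upwards [eventually_gt_atTop 0] with x hx
    rw [norm_mul]
    refine mul_le_mul (qb x hx) ?_ (norm_nonneg _) zero_le_two
    rw [Real.norm_of_nonneg (S.rho_nonneg t x)]; exact (h x).1
  have zero : ∫ x in Set.Ioi (0:ℝ), H' x = 0 := by
    rw [integral_Ioi_of_hasDerivAt_of_tendsto' dH hH' lim, S.rho0]; simp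
  refine zero.symm.le.trans ?_
  refine setIntegral_mono_on hH' jg.integrableOn measurableSet_Ioi fun x hx => ?_
  have hx' : (0:ℝ) < x := hx
  have hp : 0 < 1 + x := by linarith
  have α : 0 < 2 * (1 + x ^ 2)⁻¹ := by positivity
  have a1 := quad_form (X := S.vx t x) (Y := S.v t x) α (hardy_coef hx'.le)
  have a2 := quad_form (X := S.wx t x) (Y := S.w t x) α (hardy_coef hx'.le)
  simp only [H', g, q, ph1, ph2, rho, dd, rr, abs_of_pos hx']
  have e : ((1 + x) ^ 3)⁻¹ = 1 / (1 + x) ^ 3 := by rw [one_div]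
  rw [e]
  have := add_nonneg a1 a2
  rw [← sub_nonneg]
  refine this.trans (le_of_eq ?_)
  ring

theorem K_lower (ha0 : 0 < a) (ha1 : a < 1) (t : ℝ) :
    (3 / 4) * ∫ x, S.rho t x / (1 + |x|) ^ 4 ≤ S.K t := by
  have irr : Integrable (S.rr t) := (S.i_e t).mono' (S.c_rr t).aestronglyMeasurable
    (Eventually.of_forall fun x => (S.rr_le t x).trans (by
      linarith [S.rho_nonneg t x, S.dd_nonneg t x]))
  have j1 : Integrable (fun x => 2 * ph1 x * S.dd t x + ph2 x * S.rr t x) := by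
    refine Integrable.add ?_ ?_
    · refine (S.i_dd t).bdd_mul (c := 2) (ph_c1.const_mul 2).aestronglyMeasurable
        (Eventually.of_forall fun x => ?_)
      rw [norm_mul, Real.norm_eq_abs, Real.norm_eq_abs, abs_two]; linarith [ph_b1 x]
    · exact irr.bdd_mul (c := 1) ph_c2.aestronglyMeasurable (Eventually.of_forall fun x => ph_b2 x)
  have j2 : Integrable (fun x => S.V t x * (ph1 x * S.rho t x + arctan x * (2 * S.rr t x))) := by
    refine Integrable.bdd_mul (c := M * kap a + M) ?_ (S.V_meas t).aestronglyMeasurable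
      (Eventually.of_forall fun x => ?_)
    · refine Integrable.add ?_ ?_
      · exact (S.i_rho t).bdd_mul (c := 1) ph_c1.aestronglyMeasurable (Eventually.of_forall fun x => ph_b1 x)
      · exact (irr.const_mul 2).bdd_mul (c := 2) continuous_arctan.aestronglyMeasurable
          (Eventually.of_forall fun x => ph_b0 x)
    · rw [Real.norm_of_nonneg (S.V_bd ha0 ha1 t x).1]; exact (S.V_bd ha0 ha1 t x).2
  have nl : 0 ≤ ∫ x, S.V t x * (ph1 x * S.rho t x + arctan x * (2 * S.rr t x)) := by
    obtain ⟨C, hC, h⟩ := S.dec t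
    have := nonlocal_nonneg ha0 ha1 (φ := arctan) (φ' := ph1) (P := 2) (C := 5 * C) (S.c_rho t)
      (S.rho_nonneg t) (S.rho_le t) (S.i_rho t) continuous_arctan arctan_strictMono.monotone ph_b0
      (S.rho_deriv t) ph_d1 (by positivity) ?_
    · have e : ∀ x, S.V t x = ∫ y, |x - y| ^ (-a) * S.rho t y := fun x => S.hV t x
      simp only [e]; exact this
    · intro x
      have b1 := ph_b1 x; have b0 := ph_b0 x; have r1 := S.rho_nonneg t x
      have r3 := S.rr_le t x
      have q1 : |ph1 x * S.rho t x| ≤ 1 * S.rho t x := by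
        rw [abs_mul, abs_of_nonneg r1]; gcongr
      have q2 : |arctan x * (2 * S.rr t x)| ≤ 2 * (2 * ((S.rho t x + S.dd t x) / 2)) := by
        rw [abs_mul, abs_mul, abs_two]; gcongr
      refine (abs_add_le _ _).trans ((add_le_add q1 q2).trans ?_)
      linarith [(h x).1, (h x).2]
  have e : S.K t = (∫ x, (2 * ph1 x * S.dd t x + ph2 x * S.rr t x)) +
      ∫ x, S.V t x * (ph1 x * S.rho t x + arctan x * (2 * S.rr t x)) := by
    rw [← integral_add j1 j2]
    unfold K Q
    congr 1; ext x; ring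
  rw [e]
  linarith [S.hardy t]

end Sol


theorem exists_cutoff : ∃ χ χ1 χ2 : ℝ → ℝ, ∃ B : ℝ, Wt χ χ1 χ2 2 ∧ (∀ x, 0 ≤ χ x) ∧ (∀ x, χ x ≤ 1) ∧
    (∀ x, |x| ≤ 1 → χ x = 1) ∧ (∀ x, |x| < 1 → χ1 x = 0) ∧ (∀ x, |x| < 1 → χ2 x = 0) ∧
    (∀ x, |χ1 x| ≤ B) ∧ (∀ x, |χ2 x| ≤ B) := by
  let f : ContDiffBump (0:ℝ) := ⟨1, 2, zero_lt_one, one_lt_two⟩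
  have hf : ContDiff ℝ 2 f := f.contDiff
  have hf1 : ContDiff ℝ 1 (deriv f) := by
    have := (contDiff_succ_iff_deriv (n := 1) (f := f)).1 (by simpa [one_add_one_eq_two] using hf)
    exact this.2.2
  have hf2 : Continuous (deriv (deriv f)) := hf1.continuous_deriv le_rfl
  have z : ∀ x, 2 < |x| → f x = 0 := fun x hx => f.zero_of_le_dist (by simpa [f] using hx.le)
  have o2 : IsOpen {x : ℝ | 2 < |x|} := isOpen_lt continuous_const continuous_abs
  have o1 : IsOpen {x : ℝ | |x| < 1} := isOpen_lt continuous_abs continuous_const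
  have der0 : ∀ (g : ℝ → ℝ) (U : Set ℝ) (c : ℝ), IsOpen U → (∀ x ∈ U, g x = c) → ∀ x ∈ U, deriv g x = 0 := by
    intro g U c hU hg x hx
    have : g =ᶠ[nhds x] fun _ => c := by
      filter_upwards [hU.mem_nhds hx] with y hy using hg y hy
    rw [this.deriv_eq]; simp
  have z1 := der0 f _ 0 o2 z
  have z2 := der0 (deriv f) _ 0 o2 z1
  have one : ∀ x, |x| ≤ 1 → f x = 1 := fun x hx => f.one_of_mem_closedBall (by simpa [f] using hx)
  have y1 := der0 f _ 1 o1 (fun x hx => one x (le_of_lt hx))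
  have y2 := der0 (deriv f) _ 0 o1 y1
  have bd : ∀ g : ℝ → ℝ, Continuous g → (∀ x, 2 < |x| → g x = 0) → ∃ B, ∀ x, |g x| ≤ B := by
    intro g hg hz
    obtain ⟨B, hB⟩ := (isCompact_Icc (a := (-2:ℝ)) (b := 2)).exists_bound_of_continuousOn hg.continuousOn
    refine ⟨max B 0, fun x => ?_⟩
    by_cases hx : 2 < |x|
    · rw [hz x hx]; simp
    · exact (hB x (abs_le.1 (not_lt.1 hx))).trans (le_max_left _ _)
  obtain ⟨B1, hB1⟩ := bd _ hf1.continuous z1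
  obtain ⟨B2, hB2⟩ := bd _ hf2 z2
  refine ⟨f, deriv f, deriv (deriv f), max B1 B2, ⟨?_, ?_, hf2, z, z1, z2⟩, fun x => f.nonneg,
    fun x => f.le_one, one, y1, y2, fun x => (hB1 x).trans (le_max_left _ _),
    fun x => (hB2 x).trans (le_max_right _ _)⟩
  · exact fun x => (hf.differentiable (by norm_num) x).hasDerivAt
  · exact fun x => (hf1.differentiable (by norm_num) x).hasDerivAt

theorem scale_wt {χ χ1 χ2 : ℝ → ℝ} (h : Wt χ χ1 χ2 2) {R : ℝ} (hR : 0 < R) :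
    Wt (fun x => χ (x / R)) (fun x => χ1 (x / R) / R) (fun x => χ2 (x / R) / R / R) (2 * R) := by
  have hx : ∀ x, 2 * R < |x| → 2 < |x / R| := by
    intro x hx
    rw [abs_div, abs_of_pos hR, lt_div_iff₀ hR]; exact hx
  refine ⟨?_, ?_, ?_, fun x k => h.z _ (hx x k), fun x k => ?_, fun x k => ?_⟩
  · intro x
    have := (h.d1 (x / R)).comp x ((hasDerivAt_id x).div_const R)
    refine this.congr_deriv ?_
    ring
  · intro x
    have := ((h.d2 (x / R)).comp x ((hasDerivAt_id x).div_const R)).div_const R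
    refine this.congr_deriv ?_
    ring
  · have := h.c2
    fun_prop
  · simp [h.z1 _ (hx x k)]
  · simp [h.z2 _ (hx x k)]

theorem mul_wt {χ χ1 χ2 : ℝ → ℝ} {L : ℝ} (h : Wt χ χ1 χ2 L) :
    Wt (fun x => χ x * arctan x) (fun x => χ1 x * arctan x + χ x * ph1 x)
      (fun x => (χ2 x * arctan x + χ1 x * ph1 x) + (χ1 x * ph1 x + χ x * ph2 x)) L := by
  refine ⟨fun x => (h.d1 x).mul (ph_d1 x), fun x => ((h.d2 x).mul (ph_d1 x)).add ((h.d1 x).mul (ph_d2 x)),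
    ?_, fun x k => ?_, fun x k => ?_, fun x k => ?_⟩
  · have := h.c0; have := h.c1; have := h.c2; have := ph_c1; have := ph_c2
    fun_prop
  · simp [h.z x k]
  · simp [h.z x k, h.z1 x k]
  · simp [h.z x k, h.z1 x k, h.z2 x k]

/-- a sequence of truncations of arctan -/
theorem exists_weights : ∃ B : ℝ, ∃ ψ ψ1 ψ2 : ℕ → ℝ → ℝ,
    (∀ n, Wt (ψ n) (ψ1 n) (ψ2 n) (2 * ((n:ℝ) + 1))) ∧
    (∀ n x, |ψ n x| ≤ B ∧ |ψ1 n x| ≤ B ∧ |ψ2 n x| ≤ B) ∧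
    (∀ x, ∀ᶠ n in atTop, ψ n x = arctan x ∧ ψ1 n x = ph1 x ∧ ψ2 n x = ph2 x) := by
  obtain ⟨χ, χ1, χ2, B, h, p0, p1, o0, o1, o2, b1, b2⟩ := exists_cutoff
  have hB : 0 ≤ B := (abs_nonneg _).trans (b1 0)
  have hn : ∀ n : ℕ, (0:ℝ) < (n:ℝ) + 1 := fun n => by positivity
  have hn1 : ∀ n : ℕ, (1:ℝ) ≤ (n:ℝ) + 1 := fun n => by linarith [(Nat.cast_nonneg n : (0:ℝ) ≤ n)]
  refine ⟨4 * B + 2, _, _, _, fun n => mul_wt (scale_wt h (hn n)), fun n x => ?_, fun x => ?_⟩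
  · have a0 := ph_b0 x; have a1 := ph_b1 x; have a2 := ph_b2 x
    have c0 : |χ (x / ((n:ℝ) + 1))| ≤ 1 := by rw [abs_of_nonneg (p0 _)]; exact p1 _
    have dv : ∀ z : ℝ, |z| ≤ B → |z / ((n:ℝ) + 1)| ≤ B := by
      intro z hz
      rw [abs_div, abs_of_pos (hn n)]
      exact (div_le_self (abs_nonneg _) (hn1 n)).trans hz
    have c1 := dv _ (b1 (x / ((n:ℝ) + 1)))
    have c2 := dv _ (dv _ (b2 (x / ((n:ℝ) + 1))))
    have mm : ∀ {p q P Z : ℝ}, |p| ≤ P → |q| ≤ Z → |p * q| ≤ P * Z := by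
      intro p q P Z hp hq
      rw [abs_mul]; exact mul_le_mul hp hq (abs_nonneg _) ((abs_nonneg _).trans hp)
    refine ⟨?_, ?_, ?_⟩
    · linarith [mm c0 a0]
    · refine (abs_add_le _ _).trans ?_
      linarith [mm c1 a0, mm c0 a1]
    · refine (abs_add_le _ _).trans ?_
      have := abs_add_le (χ2 (x / ((n:ℝ) + 1)) / ((n:ℝ) + 1) / ((n:ℝ) + 1) * arctan x)
        (χ1 (x / ((n:ℝ) + 1)) / ((n:ℝ) + 1) * ph1 x)
      have := abs_add_le (χ1 (x / ((n:ℝ) + 1)) / ((n:ℝ) + 1) * ph1 x) (χ (x / ((n:ℝ) + 1)) * ph2 x)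
      linarith [mm c2 a0, mm c1 a1, mm c0 a2]
  · obtain ⟨N, hN⟩ := exists_nat_gt |x|
    filter_upwards [eventually_ge_atTop N] with n hNn
    have : |x / ((n:ℝ) + 1)| < 1 := by
      rw [abs_div, abs_of_pos (hn n), div_lt_one (hn n)]
      have : (N:ℝ) ≤ n := by exact_mod_cast hNn
      linarith
    simp [o0 _ this.le, o1 _ this, o2 _ this]

namespace Sol
variable {a M : ℝ} (S : Sol a M)

theorem K_bound (ha0 : 0 < a) (ha1 : a < 1) : ∃ C, ∀ T, 0 ≤ T → IntervalIntegrable S.K volume 0 T ∧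
    ∫ t in (0:ℝ)..T, S.K t ≤ C := by
  obtain ⟨B, ψ, ψ1, ψ2, hw, hb, hl⟩ := exists_weights
  have hB : 0 ≤ B := (abs_nonneg _).trans (hb 0 0).1
  have hL : ∀ n : ℕ, (0:ℝ) ≤ 2 * ((n:ℝ) + 1) := fun n => by positivity
  set D := B * (3 + 2 * (M * kap a + M)) with hD
  have hD0 : 0 ≤ D := by
    have := kap_nonneg a; have := S.M_nonneg; positivity
  have limK : ∀ t, Tendsto (fun n => ∫ x, S.Q (ψ n) (ψ1 n) (ψ2 n) t x) atTop (nhds (S.K t)) := by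
    intro t
    refine tendsto_integral_of_dominated_convergence (fun x => D * (S.rho t x + S.dd t x)) ?_ ?_ ?_ ?_
    · exact fun n => ((S.momentum (hL n) (hw n)).2.2 t).aestronglyMeasurable
    · exact (S.i_e t).const_mul D
    · exact fun n => Eventually.of_forall fun x =>
        S.Q_bd ha0 ha1 x (hb n x).1 (hb n x).2.1 (hb n x).2.2 t
    · refine Eventually.of_forall fun x => tendsto_const_nhds.congr' ?_
      filter_upwards [hl x] with n hn
      simp only [Q, hn.1, hn.2.1, hn.2.2]
  have bdd : ∀ n t, ‖∫ x, S.Q (ψ n) (ψ1 n) (ψ2 n) t x‖ ≤ D * M := by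
    intro n t
    refine (norm_integral_le_of_norm_le ((S.i_e t).const_mul D) (Eventually.of_forall fun x =>
        S.Q_bd ha0 ha1 x (hb n x).1 (hb n x).2.1 (hb n x).2.2 t)).trans ?_
    rw [integral_const_mul]
    exact mul_le_mul_of_nonneg_left (S.e_le t) hD0
  have Kb : ∀ t, ‖S.K t‖ ≤ D * M := fun t => le_of_tendsto' (limK t).norm fun n => bdd n t
  have Km : StronglyMeasurable S.K := by
    refine stronglyMeasurable_of_tendsto (u := atTop)
      (f := fun n t => ∫ x, S.Q (ψ n) (ψ1 n) (ψ2 n) t x)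
      (fun n => ((S.momentum (hL n) (hw n)).2.1).stronglyMeasurable) (tendsto_pi_nhds.2 limK)
  have Jb : ∀ n t, |∫ x, ψ n x * S.pp t x| ≤ B * M := by
    intro n t
    rw [← Real.norm_eq_abs]
    refine (norm_integral_le_of_norm_le (g := fun x => B * (S.rho t x + S.dd t x))
      ((S.i_e t).const_mul B) (Eventually.of_forall fun x => ?_)).trans ?_
    · rw [norm_mul]
      refine mul_le_mul (hb n x).1 ((S.pp_le t x).trans ?_) (norm_nonneg _) hB
      linarith [S.rho_nonneg t x, S.dd_nonneg t x]
    · rw [integral_const_mul]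
      exact mul_le_mul_of_nonneg_left (S.e_le t) hB
  refine ⟨B * M + B * M, fun T hT => ⟨?_, ?_⟩⟩
  · exact (intervalIntegrable_const (c := D * M)).mono_fun' Km.aestronglyMeasurable
      (Eventually.of_forall Kb)
  · have lim : Tendsto (fun n => ∫ t in (0:ℝ)..T, ∫ x, S.Q (ψ n) (ψ1 n) (ψ2 n) t x) atTop
        (nhds (∫ t in (0:ℝ)..T, S.K t)) := by
      refine intervalIntegral.tendsto_integral_filter_of_dominated_convergence (fun _ => D * M) ?_ ?_ ?_ ?_
      · exact Eventually.of_forall fun n =>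
          (S.momentum (hL n) (hw n)).2.1.aestronglyMeasurable
      · exact Eventually.of_forall fun n => Eventually.of_forall fun t _ => bdd n t
      · exact intervalIntegrable_const
      · exact Eventually.of_forall fun t _ => limK t
    refine le_of_tendsto' lim fun n => ?_
    obtain ⟨d, c, _⟩ := S.momentum (hL n) (hw n)
    rw [intervalIntegral.integral_eq_sub_of_hasDerivAt (fun t _ => d t) (c.intervalIntegrable _ _)]
    have q1 := abs_le.1 (Jb n T)
    have q2 := abs_le.1 (Jb n 0)
    linarith

theorem mass_decay (ha0 : 0 < a) (ha1 : a < 1) {R : ℝ} (hR : 0 < R) :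
    Tendsto (fun t => ∫ x in Set.Icc (-R) R, S.rho t x) atTop (nhds 0) := by
  obtain ⟨χ, χ1, χ2, B, h, p0, p1, o0, _, _, b1, _⟩ := exists_cutoff
  have hB : 0 ≤ B := (abs_nonneg _).trans (b1 0)
  have hw := scale_wt h hR
  obtain ⟨md, mc⟩ := S.mass (by positivity) hw
  set m : ℝ → ℝ := fun t => ∫ x, χ (x / R) * S.rho t x with hm
  set m' : ℝ → ℝ := fun t => ∫ x, 2 * (χ1 (x / R) / R) * S.pp t x with hm'
  have mcont : Continuous m := continuous_iff_continuousAt.2 fun t => (md t).continuousAt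
  have m0 : ∀ t, 0 ≤ m t := fun t => integral_nonneg fun x => mul_nonneg (p0 _) (S.rho_nonneg t x)
  have im : ∀ t, Integrable (fun x => χ (x / R) * S.rho t x) := fun t =>
    (S.i_rho t).bdd_mul (c := 1) hw.c0.aestronglyMeasurable (Eventually.of_forall fun x => by
      rw [Real.norm_of_nonneg (p0 _)]; exact p1 _)
  have mM : ∀ t, m t ≤ M := fun t => by
    refine (integral_mono (im t) (S.i_rho t) fun x => ?_).trans (S.irho_le t)
    exact mul_le_of_le_one_left (S.rho_nonneg t x) (p1 _)
  have m'b : ∀ t, ‖m' t‖ ≤ B / R * M := by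
    intro t
    refine (norm_integral_le_of_norm_le (g := fun x => B / R * (S.rho t x + S.dd t x))
      ((S.i_e t).const_mul _) (Eventually.of_forall fun x => ?_)).trans ?_
    · rw [norm_mul, norm_mul, norm_div, Real.norm_eq_abs, Real.norm_eq_abs, Real.norm_eq_abs,
        Real.norm_eq_abs, abs_two, abs_of_pos hR]
      have q1 : |χ1 (x / R)| / R ≤ B / R := by gcongr; exact b1 _
      have q2 := S.pp_le t x
      calc 2 * (|χ1 (x / R)| / R) * |S.pp t x| ≤ 2 * (B / R) * ((S.rho t x + S.dd t x) / 2) := by gcongr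
        _ = _ := by ring
    · rw [integral_const_mul]
      exact mul_le_mul_of_nonneg_left (S.e_le t) (by positivity)
  obtain ⟨C, hC⟩ := S.K_bound ha0 ha1
  let A := (1 + 2 * R) ^ 4 * (4 / 3)
  have mK : ∀ t, m t ≤ A * S.K t := by
    intro t
    have cden : Continuous (fun x : ℝ => ((1 + |x|) ^ 4)⁻¹) :=
      Continuous.inv₀ (by fun_prop) fun x => by positivity
    have j2 : Integrable (fun x => S.rho t x / (1 + |x|) ^ 4) := by
      simp only [div_eq_inv_mul]
      refine (S.i_rho t).bdd_mul (c := 1) cden.aestronglyMeasurable (Eventually.of_forall fun x => ?_)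
      rw [Real.norm_of_nonneg (by positivity)]
      exact inv_le_one_of_one_le₀ (one_le_pow₀ (by linarith [abs_nonneg x]))
    have h1 : m t ≤ (1 + 2 * R) ^ 4 * ∫ x, S.rho t x / (1 + |x|) ^ 4 := by
      rw [← integral_const_mul]
      refine integral_mono (im t) (j2.const_mul _) fun x => ?_
      by_cases hx : 2 * R < |x|
      · simp only [hw.z x hx, zero_mul]
        have := S.rho_nonneg t x
        positivity
      · have r := S.rho_nonneg t x
        have : S.rho t x ≤ (1 + 2 * R) ^ 4 * (S.rho t x / (1 + |x|) ^ 4) := by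
          rw [mul_div_assoc', le_div_iff₀ (by positivity), mul_comm]
          have : (1 + |x|) ^ 4 ≤ (1 + 2 * R) ^ 4 := by gcongr; linarith
          gcongr
        exact (mul_le_of_le_one_left r (p1 _)).trans this
    have h2 := S.K_lower ha0 ha1 t
    have h3 : (0:ℝ) ≤ (1 + 2 * R) ^ 4 := by positivity
    have h4 := mul_le_mul_of_nonneg_left h2 h3
    simp only [A]
    linarith
  have mi : IntegrableOn m (Set.Ioi 0) := by
    refine integrableOn_Ioi_of_intervalIntegral_norm_bounded (l := atTop) (b := id) (A * C) 0
      (fun i => mcont.integrableOn_Ioc) tendsto_id ?_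
    filter_upwards [eventually_ge_atTop 0] with T hT
    simp only [id, Real.norm_of_nonneg (m0 _)]
    obtain ⟨k1, k2⟩ := hC T hT
    calc ∫ t in (0:ℝ)..T, m t ≤ ∫ t in (0:ℝ)..T, A * S.K t :=
          intervalIntegral.integral_mono_on hT (mcont.intervalIntegrable _ _) (k1.const_mul A)
            fun t _ => mK t
      _ = A * ∫ t in (0:ℝ)..T, S.K t := intervalIntegral.integral_const_mul _ _
      _ ≤ A * C := mul_le_mul_of_nonneg_left k2 (by positivity)
  have sq : Tendsto (fun t => m t * m t) atTop (nhds 0) := by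
    refine tendsto_zero_of_hasDerivAt_of_integrableOn_Ioi (a := 0)
      (f' := fun t => m' t * m t + m t * m' t) (fun t _ => (md t).mul (md t)) ?_ ?_
    · refine Integrable.add ?_ ?_
      · exact Integrable.bdd_mul mi mc.aestronglyMeasurable (c := B / R * M) (Eventually.of_forall m'b)
      · exact Integrable.mul_bdd (c := B / R * M) mi mc.aestronglyMeasurable (Eventually.of_forall m'b)
    · exact Integrable.bdd_mul mi mcont.aestronglyMeasurable (c := M) (Eventually.of_forall fun t => by
        rw [Real.norm_of_nonneg (m0 t)]; exact mM t)
  have ml : Tendsto m atTop (nhds 0) := by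
    have := (continuous_sqrt.tendsto 0).comp sq
    rw [sqrt_zero] at this
    refine this.congr fun t => ?_
    exact sqrt_mul_self (m0 t)
  refine squeeze_zero (fun t => setIntegral_nonneg measurableSet_Icc fun x _ => S.rho_nonneg t x)
    (fun t => ?_) ml
  calc ∫ x in Set.Icc (-R) R, S.rho t x = ∫ x in Set.Icc (-R) R, χ (x / R) * S.rho t x := by
        refine setIntegral_congr_fun measurableSet_Icc fun x hx => ?_
        have : |x / R| ≤ 1 := by
          rw [abs_div, abs_of_pos hR, div_le_one hR]; exact abs_le.2 hx
        simp [o0 _ this]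
    _ ≤ m t := setIntegral_le_integral (im t) (Eventually.of_forall fun x =>
        mul_nonneg (p0 _) (S.rho_nonneg t x))

theorem rho_loc (t : ℝ) {R δ x : ℝ} (hx : x ∈ Set.Icc (-R) R) (hδ : 0 < δ) :
    S.rho t x ≤ δ⁻¹ * (∫ x in Set.Icc (-R) R, S.rho t x) + δ * M := by
  have hR : 0 ≤ R := by linarith [hx.1, hx.2]
  have key : ∀ y, ‖2 * S.rr t y‖ ≤ δ⁻¹ * S.rho t y + δ * S.dd t y := by
    intro y
    have gen : ∀ p q : ℝ, 2 * |p * q| ≤ δ⁻¹ * p ^ 2 + δ * q ^ 2 := by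
      intro p q
      have h1 : 0 ≤ δ⁻¹ * (|p| - δ * |q|) ^ 2 := by positivity
      have h2 : δ⁻¹ * (|p| - δ * |q|) ^ 2 = δ⁻¹ * |p| ^ 2 + δ * |q| ^ 2 - 2 * (|p| * |q|) := by
        field_simp; ring
      rw [sq_abs, sq_abs] at h2
      rw [abs_mul]; linarith
    rw [norm_mul, Real.norm_eq_abs, Real.norm_eq_abs, abs_two]
    unfold rr rho dd
    have := abs_add_le (S.v t y * S.vx t y) (S.w t y * S.wx t y)
    linarith [gen (S.v t y) (S.vx t y), gen (S.w t y) (S.wx t y)]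
  have ii : Integrable (fun y => δ⁻¹ * S.rho t y + δ * S.dd t y) :=
    ((S.i_rho t).const_mul _).add ((S.i_dd t).const_mul _)
  rw [S.rho_ftc]
  calc _ ≤ ‖∫ y in (0:ℝ)..x, 2 * S.rr t y‖ := Real.le_norm_self _
    _ ≤ ∫ y in Set.uIoc 0 x, ‖2 * S.rr t y‖ := intervalIntegral.norm_integral_le_integral_norm_uIoc
    _ ≤ ∫ y in Set.uIoc 0 x, (δ⁻¹ * S.rho t y + δ * S.dd t y) := by
      refine setIntegral_mono ?_ ii.integrableOn key
      refine ii.integrableOn.mono' ((S.c_rr t).const_mul 2).norm.aestronglyMeasurable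
          (Eventually.of_forall fun y => ?_)
      rw [norm_norm]; exact key y
    _ ≤ ∫ y in Set.Icc (-R) R, (δ⁻¹ * S.rho t y + δ * S.dd t y) := by
      refine setIntegral_mono_set ii.integrableOn (Eventually.of_forall fun y =>
        add_nonneg (mul_nonneg (by positivity) (S.rho_nonneg t y))
          (mul_nonneg hδ.le (S.dd_nonneg t y))) (LE.le.eventuallyLE ?_)
      exact (Set.uIoc_subset_uIcc).trans (Set.uIcc_subset_Icc ⟨by linarith, hR⟩ hx)
    _ = δ⁻¹ * (∫ x in Set.Icc (-R) R, S.rho t x) + δ * ∫ x in Set.Icc (-R) R, S.dd t x := by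
      rw [integral_add ((S.i_rho t).const_mul _).integrableOn ((S.i_dd t).const_mul _).integrableOn,
        integral_const_mul, integral_const_mul]
    _ ≤ _ := by
      have := (setIntegral_le_integral (s := Set.Icc (-R) R) (S.i_dd t)
        (Eventually.of_forall (S.dd_nonneg t))).trans (S.idd_le t)
      gcongr

end Sol


noncomputable def pt (F : ℝ → ℝ → ℂ) : ℝ → ℝ → ℂ := fun t x => fderiv ℝ (Function.uncurry F) (t, x) (1, 0)
noncomputable def px (F : ℝ → ℝ → ℂ) : ℝ → ℝ → ℂ := fun t x => fderiv ℝ (Function.uncurry F) (t, x) (0, 1)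

theorem pt_smooth {F : ℝ → ℝ → ℂ} (h : ContDiff ℝ (⊤ : ℕ∞) (Function.uncurry F)) :
    ContDiff ℝ (⊤ : ℕ∞) (Function.uncurry (pt F)) := by
  have h1 : ContDiff ℝ (⊤ : ℕ∞) (fderiv ℝ (Function.uncurry F)) := h.fderiv_right (by simp)
  exact h1.clm_apply contDiff_const

theorem px_smooth {F : ℝ → ℝ → ℂ} (h : ContDiff ℝ (⊤ : ℕ∞) (Function.uncurry F)) :
    ContDiff ℝ (⊤ : ℕ∞) (Function.uncurry (px F)) := by
  have h1 : ContDiff ℝ (⊤ : ℕ∞) (fderiv ℝ (Function.uncurry F)) := h.fderiv_right (by simp)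
  exact h1.clm_apply contDiff_const

theorem pt_deriv {F : ℝ → ℝ → ℂ} (h : ContDiff ℝ (⊤ : ℕ∞) (Function.uncurry F)) (t x : ℝ) :
    HasDerivAt (fun s => F s x) (pt F t x) t := by
  have h1 : HasFDerivAt (Function.uncurry F) (fderiv ℝ (Function.uncurry F) (t, x)) (t, x) :=
    (h.differentiable (by simp) (t, x)).hasFDerivAt
  have h2 : HasDerivAt (fun s : ℝ => (s, x)) ((1 : ℝ), (0 : ℝ)) t :=
    (hasDerivAt_id t).prodMk (hasDerivAt_const t x)
  exact h1.comp_hasDerivAt (f := fun s : ℝ => (s, x)) t h2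

theorem px_deriv {F : ℝ → ℝ → ℂ} (h : ContDiff ℝ (⊤ : ℕ∞) (Function.uncurry F)) (t x : ℝ) :
    HasDerivAt (F t) (px F t x) x := by
  have h1 : HasFDerivAt (Function.uncurry F) (fderiv ℝ (Function.uncurry F) (t, x)) (t, x) :=
    (h.differentiable (by simp) (t, x)).hasFDerivAt
  have h2 : HasDerivAt (fun s : ℝ => (t, s)) ((0 : ℝ), (1 : ℝ)) x :=
    (hasDerivAt_const x t).prodMk (hasDerivAt_id x)
  exact h1.comp_hasDerivAt (f := fun s : ℝ => (t, s)) x h2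

theorem pxt_comm {F : ℝ → ℝ → ℂ} (h : ContDiff ℝ (⊤ : ℕ∞) (Function.uncurry F)) (t x : ℝ) :
    px (pt F) t x = pt (px F) t x := by
  have h1 : ContDiff ℝ (⊤ : ℕ∞) (fderiv ℝ (Function.uncurry F)) := h.fderiv_right (by simp)
  have h2 : DifferentiableAt ℝ (fderiv ℝ (Function.uncurry F)) (t, x) :=
    h1.differentiable (by simp) _
  have e : ∀ c : ℝ × ℝ, ∀ d : ℝ × ℝ, fderiv ℝ (fun p => fderiv ℝ (Function.uncurry F) p c) (t, x) d
      = fderiv ℝ (fderiv ℝ (Function.uncurry F)) (t, x) d c := by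
    intro c d
    have := (h2.hasFDerivAt.clm_apply (hasFDerivAt_const c (t, x))).fderiv
    rw [this]; simp
  have s : IsSymmSndFDerivAt ℝ (Function.uncurry F) (t, x) :=
    h.contDiffAt.isSymmSndFDerivAt (by
      rw [minSmoothness_of_isRCLikeNormedField]; exact WithTop.coe_le_coe.2 (le_top : (2 : ℕ∞) ≤ ⊤))
  change fderiv ℝ (fun p => fderiv ℝ (Function.uncurry F) p (1, 0)) (t, x) (0, 1)
    = fderiv ℝ (fun p => fderiv ℝ (Function.uncurry F) p (0, 1)) (t, x) (1, 0)
  rw [e, e]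
  exact s _ _

theorem fld_comp (ℓ : ℂ →L[ℝ] ℝ) {F : ℝ → ℝ → ℂ} (h : ContDiff ℝ (⊤ : ℕ∞) (Function.uncurry F)) :
    Fld (fun t x => ℓ (F t x)) (fun t x => ℓ (pt F t x)) (fun t x => ℓ (px F t x))
      (fun t x => ℓ (px (px F) t x)) (fun t x => ℓ (pt (px F) t x)) where
  c := ℓ.continuous.comp h.continuous
  ct := ℓ.continuous.comp (pt_smooth h).continuous
  cx := ℓ.continuous.comp (px_smooth h).continuous
  cxx := ℓ.continuous.comp (px_smooth (px_smooth h)).continuous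
  cxt := ℓ.continuous.comp (pt_smooth (px_smooth h)).continuous
  dt := fun t x => ℓ.hasFDerivAt.comp_hasDerivAt t (pt_deriv h t x)
  dx := fun t x => ℓ.hasFDerivAt.comp_hasDerivAt x (px_deriv h t x)
  dxx := fun t x => ℓ.hasFDerivAt.comp_hasDerivAt x (px_deriv (px_smooth h) t x)
  dxt := fun t x => ℓ.hasFDerivAt.comp_hasDerivAt t (pt_deriv (px_smooth h) t x)
  dtx := fun t x => by
    rw [← pxt_comm h]
    exact ℓ.hasFDerivAt.comp_hasDerivAt x (px_deriv (pt_smooth h) t x)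

theorem schwartz_dec (g : SchwartzMap ℝ ℂ) : ∃ C : ℝ, 0 ≤ C ∧ ∀ x : ℝ,
    ‖g x‖ ≤ C * (1 + x ^ 2)⁻¹ ∧ ‖deriv g x‖ ≤ C * (1 + x ^ 2)⁻¹ := by
  have key : ∀ n : ℕ, ∃ C : ℝ, 0 < C ∧ ∀ x : ℝ, ‖iteratedDeriv n g x‖ ≤ C * (1 + x ^ 2)⁻¹ := by
    intro n
    obtain ⟨C0, p0, h0⟩ := g.decay 0 n
    obtain ⟨C2, p2, h2⟩ := g.decay 2 n
    refine ⟨C0 + C2, by positivity, fun x => ?_⟩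
    have a0 := h0 x
    have a2 := h2 x
    rw [norm_iteratedFDeriv_eq_norm_iteratedDeriv] at a0 a2
    rw [← div_eq_mul_inv, le_div_iff₀ (by positivity)]
    simp only [Real.norm_eq_abs, sq_abs, pow_zero, one_mul] at a0 a2
    nlinarith
  obtain ⟨C0, p0, h0⟩ := key 0
  obtain ⟨C1, p1, h1⟩ := key 1
  refine ⟨C0 + C1, by positivity, fun x => ?_⟩
  have i : 0 ≤ (1 + x ^ 2)⁻¹ := by positivity
  have a0 := h0 x
  have a1 := h1 x
  rw [iteratedDeriv_zero] at a0
  rw [iteratedDeriv_one] at a1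
  constructor <;> nlinarith

theorem norm_sq_re_im (z : ℂ) : ‖z‖ ^ 2 = z.re ^ 2 + z.im ^ 2 := by
  rw [Complex.sq_norm, Complex.normSq_apply]; ring

theorem exists_sol {a M : ℝ} (u : ℝ → ℝ → ℂ) (h : ContDiff ℝ (⊤ : ℕ∞) (Function.uncurry u))
    (pde : ∀ t x : ℝ, Complex.I * deriv (fun s => u s x) t + deriv (deriv (u t)) x
          = ((∫ y : ℝ, |x - y| ^ (-a) * ‖u t y‖ ^ 2 : ℝ) : ℂ) * u t x)
    (odd : ∀ t x : ℝ, u t (-x) = - u t x)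
    (sch : ∀ t : ℝ, ∃ g : SchwartzMap ℝ ℂ, ∀ x : ℝ, u t x = g x)
    (bd : ∀ t : ℝ, (∫ x : ℝ, ‖u t x‖ ^ 2) + (∫ x : ℝ, ‖deriv (u t) x‖ ^ 2) ≤ M) :
    ∃ S : Sol a M, ∀ t x, S.rho t x = ‖u t x‖ ^ 2 := by
  have dt : ∀ t x, deriv (fun s => u s x) t = pt u t x := fun t x => (pt_deriv h t x).deriv
  have dx : ∀ t, deriv (u t) = px u t := fun t => funext fun x => (px_deriv h t x).deriv
  have dxx : ∀ t x, deriv (deriv (u t)) x = px (px u) t x := fun t x => by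
    rw [dx]; exact (px_deriv (px_smooth h) t x).deriv
  simp only [dt, dxx] at pde
  simp only [dx] at bd
  let S : Sol a M :=
    { v := fun t x => (u t x).re
      vt := fun t x => (pt u t x).re
      vx := fun t x => (px u t x).re
      vxx := fun t x => (px (px u) t x).re
      vxt := fun t x => (pt (px u) t x).re
      w := fun t x => (u t x).im
      wt := fun t x => (pt u t x).im
      wx := fun t x => (px u t x).im
      wxx := fun t x => (px (px u) t x).im
      wxt := fun t x => (pt (px u) t x).im
      fv := fld_comp Complex.reCLM h
      fw := fld_comp Complex.imCLM h
      V := fun t x => ∫ y : ℝ, |x - y| ^ (-a) * ‖u t y‖ ^ 2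
      hV := fun t x => by simp only [norm_sq_re_im]
      pde1 := fun t x => by
        have := congrArg Complex.re (pde t x)
        rw [Complex.re_ofReal_mul] at this
        simpa using this
      pde2 := fun t x => by
        have := congrArg Complex.im (pde t x)
        rw [Complex.im_ofReal_mul] at this
        simpa using this
      ov := fun t x => by simp [odd]
      ow := fun t x => by simp [odd]
      decay := fun t => by
        obtain ⟨g, hg⟩ := sch t
        have e : u t = g := funext hg
        obtain ⟨C, hC, hb⟩ := schwartz_dec g
        rw [← e, dx] at hb
        exact ⟨C, hC, fun x => ⟨(Complex.abs_re_le_norm _).trans (hb x).1,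
          (Complex.abs_im_le_norm _).trans (hb x).1, (Complex.abs_re_le_norm _).trans (hb x).2,
          (Complex.abs_im_le_norm _).trans (hb x).2⟩⟩
      bound := fun t => by
        simp only [← norm_sq_re_im]; exact bd t }
  refine ⟨S, fun t x => ?_⟩
  rw [norm_sq_re_im]
  rfl

theorem decay_odd_defocusing_Hartree
    (a : ℝ) (ha0 : 0 < a) (ha1 : a < 1) :
    ∀ u : ℝ → ℝ → ℂ,
      ContDiff ℝ (⊤ : ℕ∞) (Function.uncurry u) →
      (∀ t x : ℝ, Complex.I * deriv (fun s => u s x) t + deriv (deriv (u t)) x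
          = ((∫ y : ℝ, |x - y| ^ (-a) * ‖u t y‖ ^ 2 : ℝ) : ℂ) * u t x) →
      (∀ t x : ℝ, u t (-x) = - u t x) →
      (∀ t : ℝ, ∃ g : SchwartzMap ℝ ℂ, ∀ x : ℝ, u t x = g x) →
      (∃ M : ℝ, ∀ t : ℝ,
        (∫ x : ℝ, ‖u t x‖ ^ 2) + (∫ x : ℝ, ‖deriv (u t) x‖ ^ 2) ≤ M) →
      ∀ I : Set ℝ, I.OrdConnected → Bornology.IsBounded I →
        Tendsto (fun t : ℝ =>
            Real.sqrt (∫ x in I, ‖u t x‖ ^ 2) + (⨆ x ∈ I, ‖u t x‖))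
          atTop (nhds 0) := by
  intro u h pde odd sch ⟨M, bd⟩ I hI hIb
  obtain ⟨S, hS⟩ := exists_sol u h pde odd sch bd
  obtain ⟨R, hR, hsub⟩ : ∃ R : ℝ, 0 < R ∧ I ⊆ Set.Icc (-R) R := by
    obtain ⟨R, hR, hs⟩ := hIb.subset_closedBall_lt 0 0
    refine ⟨R, hR, hs.trans ?_⟩
    rw [Real.closedBall_eq_Icc]; simp
  have md := S.mass_decay ha0 ha1 hR
  have M0 : 0 ≤ M := S.M_nonneg
  have t1 : Tendsto (fun t : ℝ => Real.sqrt (∫ x in I, ‖u t x‖ ^ 2)) atTop (nhds 0) := by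
    have m2 : Tendsto (fun t => Real.sqrt (∫ x in Set.Icc (-R) R, S.rho t x)) atTop (nhds 0) := by
      simpa [Function.comp_def] using (Real.continuous_sqrt.tendsto 0).comp md
    refine squeeze_zero (fun t => Real.sqrt_nonneg _) (fun t => Real.sqrt_le_sqrt ?_) m2
    simp only [← hS]
    exact setIntegral_mono_set (S.i_rho t).integrableOn
      (Eventually.of_forall fun x => S.rho_nonneg t x) (Eventually.of_forall hsub)
  have t2 : Tendsto (fun t : ℝ => ⨆ x ∈ I, ‖u t x‖) atTop (nhds 0) := by
    rw [Metric.tendsto_nhds]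
    intro ε hε
    have hd : 0 < (ε / 2) ^ 2 / 2 / (M + 1) := by positivity
    set δ := (ε / 2) ^ 2 / 2 / (M + 1) with hδ
    have hδM : δ * M ≤ (ε / 2) ^ 2 / 2 := by
      rw [hδ, div_mul_eq_mul_div, div_le_iff₀ (by positivity)]
      have : 0 ≤ (ε / 2) ^ 2 / 2 := by positivity
      nlinarith
    have ml : Tendsto (fun t => δ⁻¹ * ∫ x in Set.Icc (-R) R, S.rho t x) atTop (nhds 0) := by
      simpa using md.const_mul δ⁻¹
    have hp : (0:ℝ) < (ε / 2) ^ 2 / 2 := by positivity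
    filter_upwards [ml.eventually (gt_mem_nhds hp)] with t ht
    have nn : 0 ≤ ⨆ x ∈ I, ‖u t x‖ :=
      Real.iSup_nonneg fun x => Real.iSup_nonneg fun _ => norm_nonneg _
    have le : (⨆ x ∈ I, ‖u t x‖) ≤ ε / 2 := by
      refine Real.iSup_le (fun x => Real.iSup_le (fun hx => ?_) (by positivity)) (by positivity)
      have := S.rho_loc t (hsub hx) hd
      rw [hS] at this
      exact abs_le_of_sq_le_sq' (by linarith) (by positivity) |>.2
    rw [Real.dist_eq, sub_zero, abs_of_nonneg nn]
    linarith
  simpa using t1.add t2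
end
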